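/- Let U be a nonnegative solution of the extension problem on the punctured half-ball 𝔅_2^+, with trace u(x) = U(x,0), and suppose the origin is a non-removable singularity, i.e., there is no continuous function on a neighborhood of 0 in ℝⁿ that agrees with u away from 0. Then U blows up at the origin: for every K > 0 there exists δ > 0 such that U(X) ≥ K for all X = (x,t) with 0 < |X| < δ and t ≥ 0. -/

import Mathlib

open scoped Topology MeasureTheory RealInnerProductSpace
open Filter MeasureTheory

noncomputable section

/-- Points of `ℝ^{n+1}`, written `X = (x, t)` with `x ∈ ℝⁿ` and `t ∈ ℝ`. -/
abbrev Pt (n : ℕ) := EuclideanSpace ℝ (Fin n) × ℝ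

/-- The Euclidean norm on `ℝ^{n+1} = ℝⁿ × ℝ`. -/
def enorm' {n : ℕ} (X : Pt n) : ℝ := Real.sqrt (‖X.1‖ ^ 2 + X.2 ^ 2)

/-- Partial derivative in the last (`t`) direction. -/
def dt {n : ℕ} (U : Pt n → ℝ) (X : Pt n) : ℝ := fderiv ℝ U X (0, 1)

/-- Second derivative in the direction `v`. -/
def d2 {n : ℕ} (U : Pt n → ℝ) (X v : Pt n) : ℝ :=
  fderiv ℝ (fun Y => fderiv ℝ U Y v) X v

/-- The Laplacian on `ℝ^{n+1}`. -/
def lapl {n : ℕ} (U : Pt n → ℝ) (X : Pt n) : ℝ :=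
  (∑ i : Fin n, d2 U X (EuclideanSpace.single i (1 : ℝ), (0 : ℝ))) + d2 U X (0, 1)

/-- `U` is a nonnegative solution of the extension problem on the punctured half-ball
`𝔅_R^+`: it is nonnegative and continuous on `{|X| ≤ R, t ≥ 0} \ {0}`, `C²` on `𝔅_R^+`,
satisfies `ΔU + ((1-2σ)/t) ∂_t U = 0` there, and satisfies the nonlinear Neumann condition
`lim_{t→0⁺} t^{1-2σ} ∂_t U(x,t) = -u(x)^{(n+2σ)/(n-2σ)}` for `x ∈ B_R \ {0}`. -/
def ExtSol (n : ℕ) (σ R : ℝ) (U : Pt n → ℝ) : Prop :=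
  (∀ X : Pt n, enorm' X ≤ R → 0 ≤ X.2 → X ≠ 0 → 0 ≤ U X) ∧
  ContinuousOn U ({X : Pt n | enorm' X ≤ R ∧ 0 ≤ X.2} \ {0}) ∧
  ContDiffOn ℝ 2 U {X : Pt n | enorm' X < R ∧ 0 < X.2} ∧
  (∀ X : Pt n, enorm' X < R → 0 < X.2 →
    lapl U X + ((1 - 2 * σ) / X.2) * dt U X = 0) ∧
  (∀ x : EuclideanSpace ℝ (Fin n), ‖x‖ < R → x ≠ 0 →
    Tendsto (fun t : ℝ => t ^ (1 - 2 * σ) * dt U (x, t)) (𝓝[>] 0)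
      (𝓝 (-(U (x, 0) ^ (((n : ℝ) + 2 * σ) / ((n : ℝ) - 2 * σ))))))

namespace FracExt

variable {n : ℕ} {σ : ℝ}

/-! ### Second derivatives and the operator `ΔU + ((1-2σ)/t) ∂_t U` -/

lemma eventually_differentiableAt {U : Pt n → ℝ} {X : Pt n} (h : ContDiffAt ℝ 2 U X) :
    ∀ᶠ Y in 𝓝 X, DifferentiableAt ℝ U Y := by
  filter_upwards [h.eventually (by simp)] with Y hY
  exact hY.differentiableAt (by simp)

lemma differentiableAt_fderiv {U : Pt n → ℝ} {X : Pt n} (h : ContDiffAt ℝ 2 U X) :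
    DifferentiableAt ℝ (fderiv ℝ U) X :=
  (h.fderiv_right (m := 1) (by norm_num)).differentiableAt (by simp)

lemma d2_eq {U : Pt n → ℝ} {X : Pt n} (h : ContDiffAt ℝ 2 U X) (v : Pt n) :
    d2 U X v = fderiv ℝ (fderiv ℝ U) X v v := by
  have := ((differentiableAt_fderiv h).hasFDerivAt.clm_apply (hasFDerivAt_const v X)).fderiv
  simp [d2, this]

lemma d2_add {f g : Pt n → ℝ} {X : Pt n} (hf : ContDiffAt ℝ 2 f X) (hg : ContDiffAt ℝ 2 g X)
    (v : Pt n) : d2 (fun Y => f Y + g Y) X v = d2 f X v + d2 g X v := by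
  have h1 : fderiv ℝ (fun Y => f Y + g Y) =ᶠ[𝓝 X] fun Y => fderiv ℝ f Y + fderiv ℝ g Y := by
    filter_upwards [eventually_differentiableAt hf, eventually_differentiableAt hg] with Y h1 h2
    exact fderiv_fun_add h1 h2
  rw [d2_eq (hf.add hg), d2_eq hf, d2_eq hg, h1.fderiv_eq,
    fderiv_fun_add (differentiableAt_fderiv hf) (differentiableAt_fderiv hg)]
  simp

lemma d2_const_mul {f : Pt n → ℝ} {X : Pt n} (hf : ContDiffAt ℝ 2 f X) (c : ℝ)
    (v : Pt n) : d2 (fun Y => c * f Y) X v = c * d2 f X v := by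
  have h1 : fderiv ℝ (fun Y => c * f Y) =ᶠ[𝓝 X] fun Y => c • fderiv ℝ f Y := by
    filter_upwards [eventually_differentiableAt hf] with Y h1
    exact fderiv_const_mul h1 c
  rw [d2_eq (contDiffAt_const.mul hf), d2_eq hf, h1.fderiv_eq,
    fderiv_fun_const_smul (differentiableAt_fderiv hf)]
  simp

lemma d2_mul {f g : Pt n → ℝ} {X : Pt n} (hf : ContDiffAt ℝ 2 f X) (hg : ContDiffAt ℝ 2 g X)
    (v : Pt n) : d2 (fun Y => f Y * g Y) X v =
      f X * d2 g X v + g X * d2 f X v + 2 * (fderiv ℝ f X v * fderiv ℝ g X v) := by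
  have h1 : fderiv ℝ (fun Y => f Y * g Y) =ᶠ[𝓝 X]
      fun Y => f Y • fderiv ℝ g Y + g Y • fderiv ℝ f Y := by
    filter_upwards [eventually_differentiableAt hf, eventually_differentiableAt hg] with Y h1 h2
    exact fderiv_fun_mul h1 h2
  have df := hf.differentiableAt (by simp)
  have dg := hg.differentiableAt (by simp)
  have h2 := ((df.hasFDerivAt.fun_smul (differentiableAt_fderiv hg).hasFDerivAt).fun_add
    (dg.hasFDerivAt.fun_smul (differentiableAt_fderiv hf).hasFDerivAt)).fderiv
  rw [d2_eq (hf.mul hg), d2_eq hf, d2_eq hg, h1.fderiv_eq, h2]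
  simp
  ring

lemma d2_rpow {f : Pt n → ℝ} {X : Pt n} (hf : ContDiffAt ℝ 2 f X) (hpos : 0 < f X) (γ : ℝ)
    (v : Pt n) : d2 (fun Y => f Y ^ γ) X v =
      γ * f X ^ (γ - 1) * d2 f X v + γ * (γ - 1) * f X ^ (γ - 2) * (fderiv ℝ f X v) ^ 2 := by
  have hp : ∀ᶠ Y in 𝓝 X, 0 < f Y := hf.continuousAt.eventually (lt_mem_nhds hpos)
  have h1 : fderiv ℝ (fun Y => f Y ^ γ) =ᶠ[𝓝 X]
      fun Y => (γ * f Y ^ (γ - 1)) • fderiv ℝ f Y := by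
    filter_upwards [eventually_differentiableAt hf, hp] with Y h1 h2
    exact (h1.hasFDerivAt.rpow_const (Or.inl h2.ne')).fderiv
  have df := hf.differentiableAt (by simp)
  have h2 := (((df.hasFDerivAt.rpow_const (p := γ - 1) (Or.inl hpos.ne')).const_mul γ).fun_smul
    (differentiableAt_fderiv hf).hasFDerivAt).fderiv
  rw [d2_eq (hf.rpow_const_of_ne hpos.ne'), d2_eq hf, h1.fderiv_eq, h2,
    show γ - 2 = γ - 1 - 1 by ring]
  simp
  ring

/-- Second derivatives of a composition; `k` is the derivative of `φ` in the direction `v`. -/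
lemma d2_comp {U : Pt n → ℝ} {φ : Pt n → Pt n} {X v : Pt n} {k : Pt n → Pt n}
    {k' : Pt n →L[ℝ] Pt n}
    (hU : ContDiffAt ℝ 2 U (φ X)) (hφ : ContDiffAt ℝ 2 φ X)
    (hk : ∀ᶠ Y in 𝓝 X, fderiv ℝ φ Y v = k Y) (hk' : HasFDerivAt k k' X) :
    d2 (fun Y => U (φ Y)) X v =
      fderiv ℝ (fderiv ℝ U) (φ X) (k X) (k X) + fderiv ℝ U (φ X) (k' v) := by
  have h1 : (fun Y => fderiv ℝ (fun Y => U (φ Y)) Y v) =ᶠ[𝓝 X]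
      fun Y => fderiv ℝ U (φ Y) (k Y) := by
    have e1 := hφ.continuousAt.eventually (eventually_differentiableAt hU)
    have e2 : ∀ᶠ Y in 𝓝 X, DifferentiableAt ℝ φ Y := by
      filter_upwards [hφ.eventually (by simp)] with Y hY
      exact hY.differentiableAt (by simp)
    filter_upwards [e1, e2, hk] with Y h1 h2 h3
    rw [← h3]
    have := (h1.hasFDerivAt.comp Y h2.hasFDerivAt).fderiv
    simp only [Function.comp_def] at this
    rw [this]; rfl
  have dφ := (hφ.differentiableAt (by simp)).hasFDerivAt
  have h2 := ((((differentiableAt_fderiv hU).hasFDerivAt.comp X dφ)).clm_apply hk').fderiv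
  simp only [Function.comp_def] at h2
  rw [d2, h1.fderiv_eq, h2]
  have : fderiv ℝ φ X v = k X := hk.self_of_nhds
  simp [this, add_comm]

/-- The basis vectors in the horizontal directions. -/
def ex (i : Fin n) : Pt n := (EuclideanSpace.single i (1 : ℝ), (0 : ℝ))

/-- The operator `L w = Δw + ((1-2σ)/t) ∂_t w`. -/
def Lop (σ : ℝ) (w : Pt n → ℝ) (X : Pt n) : ℝ := lapl w X + ((1 - 2 * σ) / X.2) * dt w X

/-- The inner product of the gradients. -/
def gdot (f g : Pt n → ℝ) (X : Pt n) : ℝ :=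
  (∑ i : Fin n, fderiv ℝ f X (ex i) * fderiv ℝ g X (ex i)) + dt f X * dt g X

/-- `w` is `C²` at `X` and `L w X = ℓ`. -/
structure HasL (σ : ℝ) (w : Pt n → ℝ) (X : Pt n) (ℓ : ℝ) : Prop where
  smooth : ContDiffAt ℝ 2 w X
  eq : Lop σ w X = ℓ

lemma dt_add {f g : Pt n → ℝ} {X : Pt n} (hf : ContDiffAt ℝ 2 f X) (hg : ContDiffAt ℝ 2 g X) :
    dt (fun Y => f Y + g Y) X = dt f X + dt g X := by
  simp [dt, fderiv_fun_add (hf.differentiableAt (by simp)) (hg.differentiableAt (by simp))]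

lemma HasL.add {f g : Pt n → ℝ} {X : Pt n} {a b : ℝ} (hf : HasL σ f X a) (hg : HasL σ g X b) :
    HasL σ (fun Y => f Y + g Y) X (a + b) := by
  refine ⟨hf.smooth.add hg.smooth, ?_⟩
  rw [← hf.eq, ← hg.eq, Lop, Lop, Lop, dt_add hf.smooth hg.smooth, lapl, lapl, lapl]
  simp only [d2_add hf.smooth hg.smooth, Finset.sum_add_distrib]
  ring

lemma HasL.const_mul {f : Pt n → ℝ} {X : Pt n} {a : ℝ} (hf : HasL σ f X a) (c : ℝ) :
    HasL σ (fun Y => c * f Y) X (c * a) := by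
  refine ⟨contDiffAt_const.mul hf.smooth, ?_⟩
  have : dt (fun Y => c * f Y) X = c * dt f X := by
    simp [dt, fderiv_const_mul (hf.smooth.differentiableAt (by simp)) c]
  rw [← hf.eq, Lop, Lop, this, lapl, lapl]
  simp only [d2_const_mul hf.smooth, ← Finset.mul_sum]
  ring

lemma HasL.sub {f g : Pt n → ℝ} {X : Pt n} {a b : ℝ} (hf : HasL σ f X a) (hg : HasL σ g X b) :
    HasL σ (fun Y => f Y - g Y) X (a - b) := by
  have := hf.add (hg.const_mul (-1))
  convert this using 1
  · ext; ring
  · ring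

lemma hasL_const (c : ℝ) (X : Pt n) : HasL σ (fun _ => c) X 0 := by
  refine ⟨contDiffAt_const, ?_⟩
  simp [Lop, lapl, d2, dt]

lemma HasL.mul {f g : Pt n → ℝ} {X : Pt n} {a b : ℝ} (hf : HasL σ f X a) (hg : HasL σ g X b) :
    HasL σ (fun Y => f Y * g Y) X (f X * b + g X * a + 2 * gdot f g X) := by
  refine ⟨hf.smooth.mul hg.smooth, ?_⟩
  have : dt (fun Y => f Y * g Y) X = f X * dt g X + g X * dt f X := by
    simp [dt, fderiv_fun_mul (hf.smooth.differentiableAt (by simp))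
      (hg.smooth.differentiableAt (by simp))]
  rw [← hf.eq, ← hg.eq, Lop, Lop, Lop, this, lapl, lapl, lapl, gdot]
  simp only [d2_mul hf.smooth hg.smooth, Finset.sum_add_distrib, ← Finset.mul_sum]
  simp only [ex, dt]
  ring

lemma HasL.rpow {f : Pt n → ℝ} {X : Pt n} {a : ℝ} (hf : HasL σ f X a) (hpos : 0 < f X) (γ : ℝ) :
    HasL σ (fun Y => f Y ^ γ) X
      (γ * f X ^ (γ - 1) * a + γ * (γ - 1) * f X ^ (γ - 2) * gdot f f X) := by
  refine ⟨hf.smooth.rpow_const_of_ne hpos.ne', ?_⟩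
  have : dt (fun Y => f Y ^ γ) X = γ * f X ^ (γ - 1) * dt f X := by
    simp [dt, ((hf.smooth.differentiableAt (by simp)).hasFDerivAt.rpow_const (p := γ)
      (Or.inl hpos.ne')).fderiv]
  rw [← hf.eq, Lop, Lop, this, lapl, lapl, gdot]
  simp only [d2_rpow hf.smooth hpos, Finset.sum_add_distrib, ← Finset.mul_sum]
  simp only [ex, dt, ← sq]
  ring

lemma d2_nonneg_of_isLocalMin {w : Pt n → ℝ} {X : Pt n} (hw : ContDiffAt ℝ 2 w X)
    (hmin : IsLocalMin w X) (v : Pt n) : 0 ≤ d2 w X v := by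
  by_contra! hneg
  let γ : ℝ → Pt n := fun s => X + s • v
  have hγ : ∀ s, HasDerivAt γ v s := fun s => by
    simpa [γ] using ((hasDerivAt_id s).smul_const v).const_add X
  have hγ0 : γ 0 = X := by simp [γ]
  have hγc : Tendsto γ (𝓝 0) (𝓝 X) := by
    have := (hγ 0).continuousAt.tendsto; rwa [hγ0] at this
  have e1 : deriv (w ∘ γ) =ᶠ[𝓝 0] fun s => fderiv ℝ w (γ s) v := by
    filter_upwards [hγc.eventually (eventually_differentiableAt hw)] with s hs
    exact (hs.hasFDerivAt.comp_hasDerivAt s (hγ s)).deriv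
  have d1 : HasDerivAt (fun s => fderiv ℝ w (γ s) v) (d2 w X v) 0 := by
    have h1 : DifferentiableAt ℝ (fun Y => fderiv ℝ w Y v) (γ 0) := by
      rw [hγ0]
      exact (differentiableAt_fderiv hw).clm_apply (differentiableAt_const v)
    have := h1.hasFDerivAt.comp_hasDerivAt 0 (hγ 0)
    simpa [d2, hγ0, Function.comp_def] using this
  have hmin' : IsLocalMin (w ∘ γ) 0 := by
    have := hγc.eventually hmin
    simpa [IsLocalMin, IsMinFilter, hγ0] using this
  have hmax : IsLocalMax (w ∘ γ) 0 := by
    apply isLocalMax_of_deriv_deriv_neg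
    · rw [e1.deriv_eq, d1.deriv]; exact hneg
    · exact hmin'.deriv_eq_zero
    · apply ContinuousAt.comp
      · rw [hγ0]; exact hw.continuousAt
      · exact (hγ 0).continuousAt
  have hc : (w ∘ γ) =ᶠ[𝓝 0] fun _ => (w ∘ γ) 0 := by
    filter_upwards [hmin', hmax] with s h1 h2 using le_antisymm h2 h1
  have hd : deriv (deriv (w ∘ γ)) 0 = 0 := by
    rw [hc.deriv.deriv_eq]; simp
  rw [e1.deriv_eq, d1.deriv] at hd
  exact hneg.ne hd

lemma HasL.nonneg_of_isLocalMin {w : Pt n → ℝ} {X : Pt n} {ℓ : ℝ} (hw : HasL σ w X ℓ)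
    (hmin : IsLocalMin w X) : 0 ≤ ℓ := by
  rw [← hw.eq, Lop, lapl]
  have h0 : dt w X = 0 := by simp [dt, hmin.fderiv_eq_zero]
  rw [h0]
  have := fun v => d2_nonneg_of_isLocalMin hw.smooth hmin v
  have h1 : 0 ≤ ∑ i : Fin n, d2 w X (EuclideanSpace.single i (1 : ℝ), (0 : ℝ)) :=
    Finset.sum_nonneg fun i _ => this _
  linarith [this (0, 1)]

/-! ### Explicit functions -/

lemma HasL.congr {f g : Pt n → ℝ} {X : Pt n} {a b : ℝ} (hf : HasL σ f X a) (h : ∀ Y, f Y = g Y)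
    (hab : a = b) : HasL σ g X b := by
  obtain rfl : f = g := funext h
  exact hab ▸ hf

lemma HasL.sum {ι : Type*} (s : Finset ι) {f : ι → Pt n → ℝ} {X : Pt n} {a : ι → ℝ}
    (hf : ∀ i ∈ s, HasL σ (f i) X (a i)) :
    HasL σ (fun Y => ∑ i ∈ s, f i Y) X (∑ i ∈ s, a i) := by
  classical
  induction s using Finset.induction_on with
  | empty => simpa using hasL_const 0 X
  | insert i s hi ih =>
    simp only [Finset.sum_insert hi]
    exact (hf i (by simp)).add (ih fun j hj => hf j (by simp [hj]))

lemma HasL.add_const {f : Pt n → ℝ} {X : Pt n} {a : ℝ} (hf : HasL σ f X a) (c : ℝ) :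
    HasL σ (fun Y => f Y + c) X a := by
  simpa using hf.add (hasL_const c X)

lemma hasL_clm (l : Pt n →L[ℝ] ℝ) (X : Pt n) :
    HasL σ (fun Y => l Y) X ((1 - 2 * σ) / X.2 * l (0, 1)) := by
  refine ⟨l.contDiff.contDiffAt, ?_⟩
  have : ∀ Y, fderiv ℝ (fun Y => l Y) Y = l := fun Y => l.fderiv
  simp [Lop, lapl, d2, dt, this]

/-- The horizontal linear function `X ↦ ⟪e, x⟫`. -/
def hlin (e : EuclideanSpace ℝ (Fin n)) : Pt n →L[ℝ] ℝ :=
  (innerSL ℝ e).comp (ContinuousLinearMap.fst ℝ _ _)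

@[simp] lemma hlin_apply (e : EuclideanSpace ℝ (Fin n)) (X : Pt n) : hlin e X = ⟪e, X.1⟫ := rfl

lemma hasL_hlin (e p : EuclideanSpace ℝ (Fin n)) (X : Pt n) :
    HasL σ (fun Y : Pt n => ⟪e, Y.1 - p⟫) X 0 := by
  refine ((hasL_clm (hlin e) X).add_const (-⟪e, p⟫)).congr (fun Y => ?_) (by simp)
  rw [hlin_apply, inner_sub_right, sub_eq_add_neg]

lemma fderiv_hlin (e p : EuclideanSpace ℝ (Fin n)) (X : Pt n) :
    fderiv ℝ (fun Y : Pt n => ⟪e, Y.1 - p⟫) X = hlin e := by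
  have : (fun Y : Pt n => ⟪e, Y.1 - p⟫) = fun Y => hlin e Y - ⟪e, p⟫ := by
    ext; simp [inner_sub_right]
  rw [this, fderiv_sub_const]
  exact (hlin e).fderiv

lemma sum_inner_single (v : EuclideanSpace ℝ (Fin n)) :
    ∑ i : Fin n, ⟪v, EuclideanSpace.single i (1 : ℝ)⟫ ^ 2 = ‖v‖ ^ 2 := by
  rw [EuclideanSpace.norm_sq_eq]
  simp [EuclideanSpace.inner_single_right]

lemma gdot_hlin (e p : EuclideanSpace ℝ (Fin n)) (X : Pt n) :
    gdot (fun Y : Pt n => ⟪e, Y.1 - p⟫) (fun Y : Pt n => ⟪e, Y.1 - p⟫) X = ‖e‖ ^ 2 := by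
  simp only [gdot, dt, fderiv_hlin, hlin_apply, ex, ← sq, sum_inner_single]
  simp

lemma hasL_sub_snd (c : ℝ) (X : Pt n) :
    HasL σ (fun Y : Pt n => Y.2 - c) X ((1 - 2 * σ) / X.2) := by
  refine ((hasL_clm (ContinuousLinearMap.snd ℝ _ _) X).add_const (-c)).congr (fun Y => ?_)
    (by simp)
  simp [sub_eq_add_neg]

lemma fderiv_sub_snd (c : ℝ) (X : Pt n) :
    fderiv ℝ (fun Y : Pt n => Y.2 - c) X = ContinuousLinearMap.snd ℝ _ _ := by
  rw [fderiv_sub_const]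
  exact (ContinuousLinearMap.snd ℝ (EuclideanSpace ℝ (Fin n)) ℝ).fderiv

lemma gdot_snd (c : ℝ) (X : Pt n) :
    gdot (fun Y : Pt n => Y.2 - c) (fun Y : Pt n => Y.2 - c) X = 1 := by
  simp [gdot, dt, fderiv_sub_snd, ex]

lemma hasL_sub_snd_sq (c : ℝ) (X : Pt n) :
    HasL σ (fun Y : Pt n => (Y.2 - c) ^ 2) X
      (2 + 2 * (1 - 2 * σ) * (X.2 - c) / X.2) := by
  refine ((hasL_sub_snd c X).mul (hasL_sub_snd c X)).congr (fun Y => by ring) ?_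
  rw [gdot_snd]; ring

lemma hasL_snd_sq {X : Pt n} (hX : 0 < X.2) :
    HasL σ (fun Y : Pt n => Y.2 ^ 2) X (4 * (1 - σ)) := by
  refine (hasL_sub_snd_sq 0 X).congr (fun Y => by ring) ?_
  field_simp; ring

lemma hasL_hlin_sq (e p : EuclideanSpace ℝ (Fin n)) (X : Pt n) :
    HasL σ (fun Y : Pt n => ⟪e, Y.1 - p⟫ ^ 2) X (2 * ‖e‖ ^ 2) := by
  refine ((hasL_hlin e p X).mul (hasL_hlin e p X)).congr (fun Y => by ring) ?_
  rw [gdot_hlin]; ring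

lemma hasL_normsq (p : EuclideanSpace ℝ (Fin n)) (X : Pt n) :
    HasL σ (fun Y : Pt n => ‖Y.1 - p‖ ^ 2) X (2 * n) := by
  refine (HasL.sum Finset.univ fun i _ =>
    hasL_hlin_sq (EuclideanSpace.single i (1 : ℝ)) p X).congr (fun Y => ?_) ?_
  · rw [← sum_inner_single]
    simp [real_inner_comm]
  · simp [mul_comm]

/-- The square of the Euclidean distance of `X` to `P`. -/
def nsq (P X : Pt n) : ℝ := ‖X.1 - P.1‖ ^ 2 + (X.2 - P.2) ^ 2

lemma nsq_nonneg (P X : Pt n) : 0 ≤ nsq P X := by unfold nsq; positivity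

lemma nsq_pos {P X : Pt n} (h : X ≠ P) : 0 < nsq P X := by
  refine lt_of_le_of_ne (nsq_nonneg P X) fun h0 => h ?_
  have h1 : ‖X.1 - P.1‖ ^ 2 = 0 := by unfold nsq at h0; nlinarith [sq_nonneg ‖X.1 - P.1‖, sq_nonneg (X.2 - P.2)]
  have h2 : (X.2 - P.2) ^ 2 = 0 := by unfold nsq at h0; nlinarith [sq_nonneg ‖X.1 - P.1‖, sq_nonneg (X.2 - P.2)]
  ext1
  · simpa [sub_eq_zero] using h1
  · simpa [sub_eq_zero] using h2

@[simp] lemma nsq_self (P : Pt n) : nsq P P = 0 := by simp [nsq]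

lemma continuous_nsq (P : Pt n) : Continuous (nsq P) := by unfold nsq; fun_prop

lemma hasL_nsq (P X : Pt n) :
    HasL σ (nsq P) X (2 * n + 2 + 2 * (1 - 2 * σ) * (X.2 - P.2) / X.2) :=
  ((hasL_normsq P.1 X).add (hasL_sub_snd_sq P.2 X)).congr (fun _ => rfl) (by ring)

lemma hasFDerivAt_nsq (P X : Pt n) : HasFDerivAt (nsq P)
    ((2 : ℝ) • hlin (X.1 - P.1) + (2 * (X.2 - P.2)) • ContinuousLinearMap.snd ℝ _ _) X := by
  have h1 : HasFDerivAt (fun Y : Pt n => Y.1 - P.1) (ContinuousLinearMap.fst ℝ _ _) X :=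
    hasFDerivAt_fst.sub_const _
  have h2 : HasFDerivAt (fun Y : Pt n => Y.2 - P.2) (ContinuousLinearMap.snd ℝ _ _) X :=
    hasFDerivAt_snd.sub_const _
  have := h1.norm_sq.add (h2.pow 2)
  refine this.congr_fderiv ?_
  ext v <;> simp [mul_comm, inner_sub_left]

lemma gdot_nsq (P X : Pt n) : gdot (nsq P) (nsq P) X = 4 * nsq P X := by
  simp only [gdot, dt, (hasFDerivAt_nsq P X).fderiv, ex]
  have := sum_inner_single (X.1 - P.1)
  simp only [add_apply, smul_apply, hlin_apply,
    ContinuousLinearMap.coe_snd', smul_eq_mul, mul_zero, add_zero, inner_zero_right, zero_add,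
    mul_one]
  have h2 : ∀ i : Fin n, 2 * ⟪X.1 - P.1, EuclideanSpace.single i (1 : ℝ)⟫ *
      (2 * ⟪X.1 - P.1, EuclideanSpace.single i (1 : ℝ)⟫) =
      4 * ⟪X.1 - P.1, EuclideanSpace.single i (1 : ℝ)⟫ ^ 2 := fun i => by ring
  rw [Finset.sum_congr rfl fun i _ => h2 i, ← Finset.mul_sum, this, nsq]
  ring

/-- Powers of the distance to `P`. -/
lemma hasL_nsq_rpow {P X : Pt n} (h : X ≠ P) (γ : ℝ) :
    HasL σ (fun Y => nsq P Y ^ γ) X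
      (γ * nsq P X ^ (γ - 1) *
        (2 * n + 2 + 2 * (1 - 2 * σ) * (X.2 - P.2) / X.2 + 4 * (γ - 1))) := by
  have hp := nsq_pos h
  refine ((hasL_nsq P X).rpow hp γ).congr (fun _ => rfl) ?_
  have : nsq P X ^ (γ - 1) = nsq P X ^ (γ - 2) * nsq P X := by
    rw [← Real.rpow_add_one hp.ne']; ring_nf
  rw [gdot_nsq, this]; ring

lemma hasL_nsq_rpow_bdry {P X : Pt n} (hX : 0 < X.2) (hP : P.2 = 0) (γ : ℝ) :
    HasL σ (fun Y => nsq P Y ^ γ) X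
      (2 * γ * (2 * γ + (n - 2 * σ)) * nsq P X ^ (γ - 1)) := by
  refine (hasL_nsq_rpow (P := P) (fun h => ?_) γ).congr (fun _ => rfl) ?_
  · rw [h, hP] at hX; exact lt_irrefl _ hX
  · rw [hP]; field_simp; ring

lemma hasL_snd_rpow {X : Pt n} (hX : 0 < X.2) (γ : ℝ) :
    HasL σ (fun Y : Pt n => Y.2 ^ γ) X (γ * (γ - 2 * σ) * X.2 ^ (γ - 2)) := by
  have h0 := hasL_sub_snd (σ := σ) 0 X
  have h1 := gdot_snd 0 X
  simp only [sub_zero] at h0 h1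
  refine (h0.rpow hX γ).congr (fun _ => rfl) ?_
  have : X.2 ^ (γ - 1) = X.2 ^ (γ - 2) * X.2 := by
    rw [← Real.rpow_add_one hX.ne']; ring_nf
  rw [h1, this]; field_simp; ring

lemma hasL_snd_rpow_two_mul {X : Pt n} (hX : 0 < X.2) :
    HasL σ (fun Y : Pt n => Y.2 ^ (2 * σ)) X 0 :=
  (hasL_snd_rpow hX (2 * σ)).congr (fun _ => rfl) (by ring)

lemma hasL_hlin_rpow {e p : EuclideanSpace ℝ (Fin n)} {X : Pt n} (he : ‖e‖ = 1)
    (h : 0 < ⟪e, X.1 - p⟫) (γ : ℝ) :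
    HasL σ (fun Y : Pt n => ⟪e, Y.1 - p⟫ ^ γ) X (γ * (γ - 1) * ⟪e, X.1 - p⟫ ^ (γ - 2)) := by
  refine ((hasL_hlin e p X).rpow h γ).congr (fun _ => rfl) ?_
  rw [gdot_hlin, he]; ring

/-- Powers of `y² + t²`, where `y = ⟪e, x - p⟫`. -/
lemma hasL_hlin_snd_rpow {e p : EuclideanSpace ℝ (Fin n)} {X : Pt n} (he : ‖e‖ = 1)
    (hX : 0 < X.2) :
    HasL σ (fun Y : Pt n => (⟪e, Y.1 - p⟫ ^ 2 + Y.2 ^ 2) ^ σ) X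
      (2 * σ * (⟪e, X.1 - p⟫ ^ 2 + X.2 ^ 2) ^ (σ - 1)) := by
  have hp : 0 < ⟪e, X.1 - p⟫ ^ 2 + X.2 ^ 2 := by positivity
  have hg : gdot (fun Y : Pt n => ⟪e, Y.1 - p⟫ ^ 2 + Y.2 ^ 2)
      (fun Y : Pt n => ⟪e, Y.1 - p⟫ ^ 2 + Y.2 ^ 2) X = 4 * (⟪e, X.1 - p⟫ ^ 2 + X.2 ^ 2) := by
    have hd : HasFDerivAt (fun Y : Pt n => ⟪e, Y.1 - p⟫ ^ 2 + Y.2 ^ 2)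
        ((2 * ⟪e, X.1 - p⟫) • hlin e + (2 * X.2) • ContinuousLinearMap.snd ℝ _ _) X := by
      have h1 : HasFDerivAt (fun Y : Pt n => ⟪e, Y.1 - p⟫) (hlin e) X := by
        rw [← fderiv_hlin e p X]
        exact ((hasL_hlin (σ := 0) e p X).smooth.differentiableAt (by simp)).hasFDerivAt
      have h2 : HasFDerivAt (fun Y : Pt n => Y.2) (ContinuousLinearMap.snd ℝ _ _) X :=
        hasFDerivAt_snd
      refine ((h1.pow 2).add (h2.pow 2)).congr_fderiv ?_
      ext v <;> simp
    simp only [gdot, dt, hd.fderiv, ex]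
    simp only [add_apply, smul_apply, hlin_apply, ContinuousLinearMap.coe_snd', smul_eq_mul,
      mul_zero, add_zero, inner_zero_right, zero_add, mul_one]
    have h2 : ∀ i : Fin n, 2 * ⟪e, X.1 - p⟫ * ⟪e, EuclideanSpace.single i (1 : ℝ)⟫ *
        (2 * ⟪e, X.1 - p⟫ * ⟪e, EuclideanSpace.single i (1 : ℝ)⟫) =
        (2 * ⟪e, X.1 - p⟫) ^ 2 * ⟪e, EuclideanSpace.single i (1 : ℝ)⟫ ^ 2 := fun i => by ring
    rw [Finset.sum_congr rfl fun i _ => h2 i, ← Finset.mul_sum, sum_inner_single, he]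
    ring
  refine (((hasL_hlin_sq e p X).add (hasL_snd_sq hX)).rpow hp σ).congr (fun _ => rfl) ?_
  have : (⟪e, X.1 - p⟫ ^ 2 + X.2 ^ 2) ^ (σ - 1) =
      (⟪e, X.1 - p⟫ ^ 2 + X.2 ^ 2) ^ (σ - 2) * (⟪e, X.1 - p⟫ ^ 2 + X.2 ^ 2) := by
    rw [← Real.rpow_add_one hp.ne']; ring_nf
  rw [hg, he, this]; ring

/-! ### The weighted Neumann derivative and the minimum principle -/

/-- `w(x, t) = w(x, 0) + g t^{2σ} + o(t^{2σ})` as `t → 0⁺`. -/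
def Neu (σ : ℝ) (w : Pt n → ℝ) (x : EuclideanSpace ℝ (Fin n)) (g : ℝ) : Prop :=
  Tendsto (fun t : ℝ => (w (x, t) - w (x, 0)) / t ^ (2 * σ)) (𝓝[>] 0) (𝓝 g)

lemma Neu.add {f h : Pt n → ℝ} {x : EuclideanSpace ℝ (Fin n)} {a b : ℝ} (hf : Neu σ f x a)
    (hh : Neu σ h x b) : Neu σ (fun Y => f Y + h Y) x (a + b) := by
  refine (Tendsto.add hf hh).congr fun t => ?_
  ring

lemma Neu.const_mul {f : Pt n → ℝ} {x : EuclideanSpace ℝ (Fin n)} {a : ℝ} (hf : Neu σ f x a)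
    (c : ℝ) : Neu σ (fun Y => c * f Y) x (c * a) := by
  refine (Tendsto.const_mul c hf).congr fun t => ?_
  ring

lemma Neu.sub {f h : Pt n → ℝ} {x : EuclideanSpace ℝ (Fin n)} {a b : ℝ} (hf : Neu σ f x a)
    (hh : Neu σ h x b) : Neu σ (fun Y => f Y - h Y) x (a - b) := by
  refine (Tendsto.sub hf hh).congr fun t => ?_
  ring

lemma Neu.congr {f h : Pt n → ℝ} {x : EuclideanSpace ℝ (Fin n)} {a b : ℝ} (hf : Neu σ f x a)
    (e : ∀ t, 0 ≤ t → f (x, t) = h (x, t)) (hab : a = b) : Neu σ h x b := by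
  subst hab
  refine Tendsto.congr' ?_ hf
  filter_upwards [self_mem_nhdsWithin] with t ht
  rw [e t (le_of_lt ht), e 0 le_rfl]

lemma neu_of_forall_eq {f : Pt n → ℝ} {x : EuclideanSpace ℝ (Fin n)}
    (h : ∀ t, 0 ≤ t → f (x, t) = f (x, 0)) : Neu σ f x 0 := by
  refine Tendsto.congr' (f₁ := fun _ => (0 : ℝ)) ?_ tendsto_const_nhds
  filter_upwards [self_mem_nhdsWithin] with t ht
  rw [h t (le_of_lt ht)]; simp

lemma Neu.add_const {f : Pt n → ℝ} {x : EuclideanSpace ℝ (Fin n)} {a : ℝ} (hf : Neu σ f x a)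
    (c : ℝ) : Neu σ (fun Y => f Y + c) x a := by
  simpa using hf.add (neu_of_forall_eq (f := fun _ => c) fun _ _ => rfl)

lemma neu_rpow_two_mul (hσ : 0 < σ) (x : EuclideanSpace ℝ (Fin n)) :
    Neu σ (fun Y : Pt n => Y.2 ^ (2 * σ)) x 1 := by
  refine Tendsto.congr' (f₁ := fun _ => (1 : ℝ)) ?_ tendsto_const_nhds
  filter_upwards [self_mem_nhdsWithin] with t ht
  have : (0 : ℝ) < t ^ (2 * σ) := Real.rpow_pos_of_pos ht _
  simp [Real.zero_rpow (show 2 * σ ≠ 0 by positivity)]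
  field_simp

lemma tendsto_sq_div_rpow (hσ : σ < 1) :
    Tendsto (fun t : ℝ => t ^ 2 / t ^ (2 * σ)) (𝓝[>] 0) (𝓝 0) := by
  have h1 : Tendsto (fun t : ℝ => t ^ (2 - 2 * σ)) (𝓝[>] 0) (𝓝 0) := by
    have := (Real.continuousAt_rpow_const 0 (2 - 2 * σ) (Or.inr (by linarith))).tendsto
    rw [Real.zero_rpow (by linarith)] at this
    exact this.mono_left nhdsWithin_le_nhds
  refine h1.congr' ?_
  filter_upwards [self_mem_nhdsWithin] with t ht
  rw [Real.rpow_sub ht, Real.rpow_two]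

/-- Differentiable functions of `t²` have zero weighted Neumann derivative. -/
lemma neu_of_hasDerivAt (hσ : σ < 1) {w : Pt n → ℝ} {x : EuclideanSpace ℝ (Fin n)} {f : ℝ → ℝ}
    {f' : ℝ} (hf : HasDerivAt f f' 0) (hw : ∀ t, 0 ≤ t → w (x, t) = f (t ^ 2)) :
    Neu σ w x 0 := by
  have h1 : Tendsto (fun t : ℝ => t ^ 2) (𝓝[>] 0) (𝓝[≠] 0) := by
    refine tendsto_nhdsWithin_iff.2 ⟨?_, ?_⟩
    · have : Tendsto (fun t : ℝ => t ^ 2) (𝓝 0) (𝓝 (0 ^ 2)) := (continuous_pow 2).tendsto 0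
      simp only [ne_eq, OfNat.ofNat_ne_zero, not_false_eq_true, zero_pow] at this
      exact this.mono_left nhdsWithin_le_nhds
    · filter_upwards [self_mem_nhdsWithin] with t ht
      exact pow_ne_zero 2 (ne_of_gt ht)
  have h2 := (hasDerivAt_iff_tendsto_slope.1 hf).comp h1
  have h3 := h2.mul (tendsto_sq_div_rpow hσ)
  rw [mul_zero] at h3
  refine h3.congr' ?_
  filter_upwards [self_mem_nhdsWithin] with t ht
  have ht' : t ≠ 0 := ne_of_gt ht
  rw [hw t (le_of_lt ht), hw 0 le_rfl]
  simp [slope_def_field]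
  field_simp

lemma neu_sq (hσ : σ < 1) (x : EuclideanSpace ℝ (Fin n)) :
    Neu σ (fun Y : Pt n => Y.2 ^ 2) x 0 :=
  neu_of_hasDerivAt hσ (hasDerivAt_id 0) fun _ _ => rfl

lemma neu_nsq (hσ : σ < 1) {P : Pt n} (hP : P.2 = 0) (x : EuclideanSpace ℝ (Fin n)) :
    Neu σ (nsq P) x 0 := by
  refine ((neu_sq hσ x).add_const (‖x - P.1‖ ^ 2)).congr (fun t _ => ?_) rfl
  simp [nsq, hP, add_comm]

lemma neu_nsq_rpow (hσ : σ < 1) {P : Pt n} (hP : P.2 = 0) {x : EuclideanSpace ℝ (Fin n)}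
    (hx : x ≠ P.1) (γ : ℝ) : Neu σ (fun Y => nsq P Y ^ γ) x 0 := by
  have h0 : 0 < ‖x - P.1‖ := norm_pos_iff.2 (sub_ne_zero.2 hx)
  have h1 : HasDerivAt (fun s : ℝ => ‖x - P.1‖ ^ 2 + s) 1 0 := (hasDerivAt_id 0).const_add _
  refine neu_of_hasDerivAt hσ (h1.rpow_const (p := γ) (Or.inl ?_)) fun t _ => ?_
  · rw [add_zero]; positivity
  · simp [nsq, hP]

/-- At `X`, the function `w` on `K` cannot have a minimum. -/
def NoMinAt (σ : ℝ) (w : Pt n → ℝ) (K : Set (Pt n)) (X : Pt n) : Prop :=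
  (K ∈ 𝓝 X ∧ ∃ ℓ < 0, HasL σ w X ℓ) ∨
  (∃ x, X = (x, 0) ∧ (∀ᶠ s in 𝓝[>] (0 : ℝ), (x, s) ∈ K) ∧ ∃ g < 0, Neu σ w x g)

lemma NoMinAt.not_isMinOn {w : Pt n → ℝ} {K : Set (Pt n)} {X : Pt n} (h : NoMinAt σ w K X) :
    ¬ IsMinOn w K X := by
  intro hmin
  rcases h with ⟨hK, ℓ, hℓ, hL⟩ | ⟨x, rfl, hK, g, hg, hN⟩
  · exact absurd (hL.nonneg_of_isLocalMin (hmin.isLocalMin hK)) (not_le.2 hℓ)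
  · have h1 : ∀ᶠ s in 𝓝[>] (0 : ℝ), (w (x, s) - w (x, 0)) / s ^ (2 * σ) < 0 :=
      hN.eventually (gt_mem_nhds hg)
    obtain ⟨s, h1, h2, h3⟩ := (h1.and (hK.and self_mem_nhdsWithin)).exists
    have h4 : w (x, 0) ≤ w (x, s) := hmin h2
    have h5 : (0 : ℝ) < s ^ (2 * σ) := Real.rpow_pos_of_pos h3 _
    exact absurd (div_nonneg (sub_nonneg.2 h4) h5.le) (not_le.2 h1)

/-- The minimum principle. -/
lemma min_principle {w : Pt n → ℝ} {K : Set (Pt n)} (hK : IsCompact K) (hw : ContinuousOn w K)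
    (h : ∀ X ∈ K, w X < 0 → NoMinAt σ w K X) : ∀ X ∈ K, 0 ≤ w X := by
  intro X hX
  obtain ⟨Y, hY, hmin⟩ := hK.exists_isMinOn ⟨X, hX⟩ hw
  refine le_trans ?_ (hmin hX)
  by_contra! hneg
  exact (h Y hY hneg).not_isMinOn hmin

/-- The properties of a solution in the punctured half-ball of radius `2` used below. -/
structure PSol (σ p : ℝ) (U : Pt n → ℝ) : Prop where
  nonneg : ∀ X, nsq 0 X ≤ 4 → 0 ≤ X.2 → X ≠ 0 → 0 ≤ U X
  cont : ContinuousOn U {X | nsq 0 X ≤ 4 ∧ 0 ≤ X.2 ∧ X ≠ 0}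
  eq : ∀ X, nsq 0 X < 4 → 0 < X.2 → HasL σ U X 0
  neu : ∀ x, x ≠ 0 → ‖x‖ < 2 → Neu σ U x (-(U (x, 0) ^ p / (2 * σ)))

lemma enorm'_eq (X : Pt n) : enorm' X = Real.sqrt (nsq 0 X) := by simp [enorm', nsq]

lemma enorm'_le_iff {X : Pt n} {R : ℝ} (hR : 0 ≤ R) : enorm' X ≤ R ↔ nsq 0 X ≤ R ^ 2 := by
  rw [enorm'_eq, Real.sqrt_le_left hR]

lemma enorm'_lt_iff {X : Pt n} {R : ℝ} (hR : 0 < R) : enorm' X < R ↔ nsq 0 X < R ^ 2 := by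
  rw [enorm'_eq, Real.sqrt_lt' hR]

lemma psol_of_extSol (hσ : 0 < σ) {U : Pt n → ℝ} (h : ExtSol n σ 2 U) :
    PSol σ (((n : ℝ) + 2 * σ) / ((n : ℝ) - 2 * σ)) U := by
  obtain ⟨h1, h2, h3, h4, h5⟩ := h
  have hcont : ContinuousOn U {X | nsq 0 X ≤ 4 ∧ 0 ≤ X.2 ∧ X ≠ 0} := by
    refine h2.mono fun X hX => ⟨⟨?_, hX.2.1⟩, hX.2.2⟩
    rw [enorm'_le_iff (by norm_num)]; norm_num; exact hX.1
  have heq : ∀ X, nsq 0 X < 4 → 0 < X.2 → HasL σ U X 0 := by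
    intro X hX ht
    have hX' : enorm' X < 2 := by rw [enorm'_lt_iff (by norm_num)]; norm_num; exact hX
    refine ⟨h3.contDiffAt ?_, h4 X hX' ht⟩
    have ho : IsOpen {X : Pt n | nsq 0 X < 4 ∧ 0 < X.2} :=
      ((continuous_nsq 0).isOpen_preimage _ isOpen_Iio).inter
        (continuous_snd.isOpen_preimage _ isOpen_Ioi)
    refine mem_of_superset (ho.mem_nhds ⟨hX, ht⟩) fun Y hY => ⟨?_, hY.2⟩
    rw [enorm'_lt_iff (by norm_num)]; norm_num; exact hY.1
  refine ⟨?_, hcont, heq, ?_⟩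
  · intro X hX ht h0
    refine h1 X ?_ ht h0
    rw [enorm'_le_iff (by norm_num)]; norm_num; exact hX
  · intro x hx0 hx2
    have hne : ∀ t : ℝ, (x, t) ≠ (0 : Pt n) := fun t ht => hx0 (congrArg Prod.fst ht)
    have hsmall : ∀ᶠ t in 𝓝[>] (0 : ℝ), nsq (0 : Pt n) (x, t) < 4 := by
      have hc : Continuous fun t : ℝ => nsq (0 : Pt n) (x, t) :=
        (continuous_nsq 0).comp (by fun_prop)
      have : nsq (0 : Pt n) (x, 0) < 4 := by
        simp only [nsq, Prod.fst_zero, sub_zero, Prod.snd_zero]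
        nlinarith [norm_nonneg x]
      exact (hc.tendsto 0).mono_left nhdsWithin_le_nhds |>.eventually (gt_mem_nhds this)
    have hpos : ∀ᶠ t in 𝓝[>] (0 : ℝ), 0 < t := self_mem_nhdsWithin
    unfold Neu
    refine HasDerivAt.lhopital_zero_nhdsGT (f' := fun t => dt U (x, t))
      (g' := fun t => 2 * σ * t ^ (2 * σ - 1)) ?_ ?_ ?_ ?_ ?_ ?_
    · filter_upwards [hsmall, hpos] with t h1 h2
      have hd := ((heq (x, t) h1 h2).smooth.differentiableAt (by simp)).hasFDerivAt
      have hγ : HasDerivAt (fun s : ℝ => ((x, s) : Pt n)) (0, 1) t :=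
        (hasDerivAt_const t x).prodMk (hasDerivAt_id t)
      exact (hd.comp_hasDerivAt t hγ).sub_const _
    · filter_upwards [hpos] with t ht
      exact Real.hasDerivAt_rpow_const (Or.inl ht.ne')
    · filter_upwards [hpos] with t ht
      have := Real.rpow_pos_of_pos ht (2 * σ - 1)
      positivity
    · have hc : ContinuousWithinAt U {X | nsq 0 X ≤ 4 ∧ 0 ≤ X.2 ∧ X ≠ 0} (x, 0) := by
        refine hcont _ ⟨?_, le_rfl, hne 0⟩
        simp only [nsq, Prod.fst_zero, sub_zero, Prod.snd_zero]
        nlinarith [norm_nonneg x]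
      have hγ : Tendsto (fun s : ℝ => ((x, s) : Pt n)) (𝓝[>] 0)
          (𝓝[{X | nsq 0 X ≤ 4 ∧ 0 ≤ X.2 ∧ X ≠ 0}] (x, 0)) := by
        refine tendsto_nhdsWithin_iff.2 ⟨?_, ?_⟩
        · have : Continuous (fun s : ℝ => ((x, s) : Pt n)) := by fun_prop
          exact (this.tendsto 0).mono_left nhdsWithin_le_nhds
        · filter_upwards [hsmall, hpos] with t h1 h2 using ⟨h1.le, h2.le, hne t⟩
      have := (hc.tendsto.comp hγ).sub_const (U (x, 0))
      simpa using this
    · have := (Real.continuousAt_rpow_const 0 (2 * σ) (Or.inr (by linarith))).tendsto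
      rw [Real.zero_rpow (by linarith)] at this
      exact this.mono_left nhdsWithin_le_nhds
    · have := (h5 x hx2 hx0).div_const (2 * σ)
      rw [neg_div] at this
      refine this.congr' ?_
      filter_upwards [hpos] with t ht
      have e : t ^ (1 - 2 * σ) = (t ^ (2 * σ - 1))⁻¹ := by
        rw [← Real.rpow_neg ht.le]; ring_nf
      rw [e]
      have := Real.rpow_pos_of_pos ht (2 * σ - 1)
      field_simp

lemma isCompact_of_nsq_le {K : Set (Pt n)} (hK : IsClosed K) {P : Pt n} {C : ℝ}
    (h : ∀ X ∈ K, nsq P X ≤ C) : IsCompact K := by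
  refine Metric.isCompact_of_isClosed_isBounded hK ?_
  refine (Metric.isBounded_closedBall (x := P) (r := C + 1)).subset fun X hX => ?_
  have h0 := h X hX
  rw [Metric.mem_closedBall, Prod.dist_eq, dist_eq_norm, Real.dist_eq]
  unfold nsq at h0
  refine max_le ?_ (abs_le.2 ⟨?_, ?_⟩) <;>
    nlinarith [sq_nonneg (‖X.1 - P.1‖ - 1), sq_nonneg (X.2 - P.2 - 1), sq_nonneg (X.2 - P.2 + 1),
      sq_nonneg ‖X.1 - P.1‖, sq_nonneg (X.2 - P.2)]

lemma noMinAt_of_isOpen {w : Pt n → ℝ} {K O : Set (Pt n)} {X : Pt n} (hO : IsOpen O) (hX : X ∈ O)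
    (hOK : ∀ Y ∈ O, 0 ≤ Y.2 → Y ∈ K) (h0 : 0 ≤ X.2) (hEq : 0 < X.2 → ∃ ℓ < 0, HasL σ w X ℓ)
    (hbd : X.2 = 0 → ∃ g < 0, Neu σ w X.1 g) : NoMinAt σ w K X := by
  rcases h0.lt_or_eq with h | h
  · refine Or.inl ⟨?_, hEq h⟩
    filter_upwards [hO.mem_nhds hX, (continuous_snd.isOpen_preimage _ isOpen_Ioi).mem_nhds h]
      with Y h1 h2 using hOK Y h1 (le_of_lt h2)
  · refine Or.inr ⟨X.1, Prod.ext rfl h.symm, ?_, hbd h.symm⟩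
    have hc : Tendsto (fun s : ℝ => ((X.1, s) : Pt n)) (𝓝[>] 0) (𝓝 X) := by
      have : Continuous (fun s : ℝ => ((X.1, s) : Pt n)) := by fun_prop
      have := this.tendsto 0
      rw [show ((X.1, (0 : ℝ)) : Pt n) = X from Prod.ext rfl h] at this
      exact this.mono_left nhdsWithin_le_nhds
    filter_upwards [hc.eventually (hO.mem_nhds hX), self_mem_nhdsWithin] with s h1 h2
    exact hOK _ h1 (le_of_lt h2)

/-- The minimum principle with non-strict differential inequalities. -/
lemma min_principle_weak (hσ0 : 0 < σ) (hσ1 : σ < 1) {w : Pt n → ℝ} {K O : Set (Pt n)}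
    (hK : IsCompact K) (hw : ContinuousOn w K)
    (hKt : ∀ X ∈ K, 0 ≤ X.2) (hO : IsOpen O) (hOK : ∀ Y ∈ O, 0 ≤ Y.2 → Y ∈ K)
    (hbdry : ∀ X ∈ K, X ∉ O → 0 ≤ w X)
    (hEq : ∀ X ∈ K, X ∈ O → 0 < X.2 → w X < 0 → ∃ ℓ ≤ 0, HasL σ w X ℓ)
    (hneu : ∀ x, (x, (0 : ℝ)) ∈ K → (x, (0 : ℝ)) ∈ O → w (x, 0) < 0 → ∃ g ≤ 0, Neu σ w x g) :
    ∀ X ∈ K, 0 ≤ w X := by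
  obtain ⟨T, hT⟩ : ∃ T : ℝ, ∀ X ∈ K, X.2 ^ 2 + X.2 ^ (2 * σ) ≤ T := by
    have hc : Continuous fun X : Pt n => X.2 ^ 2 + X.2 ^ (2 * σ) :=
      (continuous_snd.pow 2).add (continuous_snd.rpow_const fun _ => Or.inr (by linarith))
    obtain ⟨T, hT⟩ := (hK.image hc).bddAbove
    exact ⟨T, fun X hX => hT ⟨X, hX, rfl⟩⟩
  have key : ∀ ε : ℝ, 0 < ε → ∀ X ∈ K,
      0 ≤ w X + (-ε) * (X.2 ^ 2 + X.2 ^ (2 * σ)) + ε * T := by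
    intro ε hε
    refine min_principle (σ := σ) hK ?_ fun X hX hneg => ?_
    · refine (hw.add (Continuous.continuousOn ?_)).add continuousOn_const
      exact continuous_const.mul ((continuous_snd.pow 2).add
        (continuous_snd.rpow_const fun _ => Or.inr (by linarith)))
    have hwneg : w X < 0 := by nlinarith [hT X hX]
    have hXO : X ∈ O := by
      by_contra h
      exact absurd (hbdry X hX h) (not_le.2 hwneg)
    refine noMinAt_of_isOpen hO hXO hOK (hKt X hX) (fun ht => ?_) (fun ht => ?_)
    · obtain ⟨ℓ, hℓ, hL⟩ := hEq X hX hXO ht hwneg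
      refine ⟨ℓ + (-ε) * (4 * (1 - σ) + 0), by nlinarith, ?_⟩
      exact (hL.add (((hasL_snd_sq ht).add (hasL_snd_rpow_two_mul ht)).const_mul _)).add_const _
    · obtain ⟨x, t⟩ := X
      simp only at ht
      subst ht
      obtain ⟨g, hg, hN⟩ := hneu x hX hXO hwneg
      refine ⟨g + (-ε) * (0 + 1), by linarith, ?_⟩
      exact (hN.add (((neu_sq hσ1 x).add (neu_rpow_two_mul hσ0 x)).const_mul _)).add_const _
  intro X hX
  have h1 : Tendsto (fun ε : ℝ => w X + (-ε) * (X.2 ^ 2 + X.2 ^ (2 * σ)) + ε * T) (𝓝[>] 0)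
      (𝓝 (w X)) := by
    have : Continuous fun ε : ℝ => w X + (-ε) * (X.2 ^ 2 + X.2 ^ (2 * σ)) + ε * T := by fun_prop
    have := this.tendsto 0
    simp only [neg_zero, zero_mul, add_zero] at this
    exact this.mono_left nhdsWithin_le_nhds
  refine ge_of_tendsto h1 ?_
  filter_upwards [self_mem_nhdsWithin] with ε hε using key ε hε X hX

lemma exists_forall_le_rpow_neg {κ : ℝ} (hκ : 0 < κ) (A : ℝ) :
    ∃ s₀ > 0, ∀ s, 0 < s → s ≤ s₀ → A ≤ s ^ (-κ) := by
  have hA : 0 < max A 1 := lt_max_of_lt_right one_pos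
  refine ⟨(max A 1) ^ (-κ⁻¹), Real.rpow_pos_of_pos hA _, fun s hs h => ?_⟩
  refine (le_max_left A 1).trans ?_
  have := Real.rpow_le_rpow_of_nonpos hs h (neg_nonpos.2 hκ.le)
  rwa [← Real.rpow_mul hA.le, neg_mul_neg, inv_mul_cancel₀ hκ.ne', Real.rpow_one] at this

/-- The minimum principle for functions bounded below away from two boundary points. -/
lemma min_principle_sing (hσ0 : 0 < σ) (hσ1 : σ < 1) (hq : 0 < (n : ℝ) - 2 * σ) {w : Pt n → ℝ}
    {K O : Set (Pt n)} {P Q : Pt n} (hP : P.2 = 0) (hQ : Q.2 = 0)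
    (hK : IsCompact K) (hw : ContinuousOn w {X ∈ K | X ≠ P ∧ X ≠ Q})
    (hKt : ∀ X ∈ K, 0 ≤ X.2) (hO : IsOpen O) (hOK : ∀ Y ∈ O, 0 ≤ Y.2 → Y ∈ K)
    (hB : ∃ B : ℝ, ∀ X ∈ K, X ≠ P → X ≠ Q → -B ≤ w X)
    (hbdry : ∀ X ∈ K, X ≠ P → X ≠ Q → X ∉ O → 0 ≤ w X)
    (hEq : ∀ X ∈ K, X ∈ O → 0 < X.2 → w X < 0 → ∃ ℓ ≤ 0, HasL σ w X ℓ)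
    (hneu : ∀ x, (x, (0 : ℝ)) ∈ K → (x, (0 : ℝ)) ∈ O → (x, (0 : ℝ)) ≠ P → (x, (0 : ℝ)) ≠ Q →
      w (x, 0) < 0 → ∃ g ≤ 0, Neu σ w x g) :
    ∀ X ∈ K, X ≠ P → X ≠ Q → 0 ≤ w X := by
  obtain ⟨B, hB⟩ := hB
  set κ : ℝ := ((n : ℝ) - 2 * σ) / 2 with hκ
  have hκ0 : 0 < κ := by positivity
  set H : Pt n → ℝ := fun X => nsq P X ^ (-κ) + nsq Q X ^ (-κ) with hH
  have hH0 : ∀ X, 0 ≤ H X := fun X =>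
    add_nonneg (Real.rpow_nonneg (nsq_nonneg _ _) _) (Real.rpow_nonneg (nsq_nonneg _ _) _)
  have key : ∀ ε : ℝ, 0 < ε → ∀ X ∈ K, X ≠ P → X ≠ Q → 0 ≤ w X + ε * H X := by
    intro ε hε
    obtain ⟨s₀, hs₀, hs⟩ := exists_forall_le_rpow_neg hκ0 (B / ε)
    have hnear : ∀ X ∈ K, X ≠ P → X ≠ Q → (nsq P X ≤ s₀ ∨ nsq Q X ≤ s₀) →
        0 ≤ w X + ε * H X := by
      intro X hX hXP hXQ h
      have h1 : B / ε ≤ H X := by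
        rcases h with h | h
        · exact (hs _ (nsq_pos hXP) h).trans
            (le_add_of_nonneg_right (Real.rpow_nonneg (nsq_nonneg _ _) _))
        · exact (hs _ (nsq_pos hXQ) h).trans
            (le_add_of_nonneg_left (Real.rpow_nonneg (nsq_nonneg _ _) _))
      rw [div_le_iff₀ hε] at h1
      linarith [hB X hX hXP hXQ]
    have hne : ∀ {R X : Pt n}, s₀ ≤ nsq R X → X ≠ R := fun {R X} h h' => by
      rw [h', nsq_self] at h; linarith
    set K' : Set (Pt n) := {X ∈ K | s₀ ≤ nsq P X ∧ s₀ ≤ nsq Q X} with hK'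
    set O' : Set (Pt n) := {X ∈ O | s₀ < nsq P X ∧ s₀ < nsq Q X} with hO'
    have hK'c : IsCompact K' := hK.inter_right
      ((isClosed_le continuous_const (continuous_nsq P)).inter
        (isClosed_le continuous_const (continuous_nsq Q)))
    have hO'o : IsOpen O' := hO.inter
      ((isOpen_lt continuous_const (continuous_nsq P)).inter
        (isOpen_lt continuous_const (continuous_nsq Q)))
    have hmain : ∀ X ∈ K', 0 ≤ w X + ε * H X := by
      refine min_principle_weak hσ0 hσ1 hK'c (O := O') ?_ (fun X hX => hKt X hX.1) hO'o
        (fun Y hY ht => ⟨hOK Y hY.1 ht, hY.2.1.le, hY.2.2.le⟩) ?_ ?_ ?_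
      · refine (hw.mono fun X hX => ⟨hX.1, hne hX.2.1, hne hX.2.2⟩).add (ContinuousOn.mul
          continuousOn_const (ContinuousOn.add ?_ ?_))
        · exact (continuous_nsq P).continuousOn.rpow_const fun X hX =>
            Or.inl (hs₀.trans_le hX.2.1).ne'
        · exact (continuous_nsq Q).continuousOn.rpow_const fun X hX =>
            Or.inl (hs₀.trans_le hX.2.2).ne'
      · intro X hX hXO
        by_cases h : nsq P X ≤ s₀ ∨ nsq Q X ≤ s₀
        · exact hnear X hX.1 (hne hX.2.1) (hne hX.2.2) h
        · push Not at h
          have : X ∉ O := fun h' => hXO ⟨h', h⟩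
          have := hbdry X hX.1 (hne hX.2.1) (hne hX.2.2) this
          have := hH0 X
          positivity
      · intro X hX hXO ht hneg
        have hwneg : w X < 0 := by nlinarith [hH0 X]
        obtain ⟨ℓ, hℓ, hL⟩ := hEq X hX.1 hXO.1 ht hwneg
        refine ⟨ℓ + ε * (0 + 0), by simpa using hℓ, hL.add (HasL.const_mul (HasL.add ?_ ?_) _)⟩
        · exact (hasL_nsq_rpow_bdry ht hP _).congr (fun _ => rfl) (by rw [hκ]; ring)
        · exact (hasL_nsq_rpow_bdry ht hQ _).congr (fun _ => rfl) (by rw [hκ]; ring)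
      · intro x hx hxO hneg
        have hwneg : w (x, 0) < 0 := by nlinarith [hH0 (x, 0)]
        obtain ⟨g, hg, hN⟩ := hneu x hx.1 hxO.1 (hne hx.2.1) (hne hx.2.2) hwneg
        refine ⟨g + ε * (0 + 0), by simpa using hg, hN.add (Neu.const_mul (Neu.add ?_ ?_) _)⟩
        · exact neu_nsq_rpow hσ1 hP (fun h => hne hx.2.1 (Prod.ext h hP.symm)) _
        · exact neu_nsq_rpow hσ1 hQ (fun h => hne hx.2.2 (Prod.ext h hQ.symm)) _
    intro X hX hXP hXQ
    by_cases h : nsq P X ≤ s₀ ∨ nsq Q X ≤ s₀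
    · exact hnear X hX hXP hXQ h
    · push Not at h
      exact hmain X ⟨hX, h.1.le, h.2.le⟩
  intro X hX hXP hXQ
  have h1 : Tendsto (fun ε : ℝ => w X + ε * H X) (𝓝[>] 0) (𝓝 (w X)) := by
    have : Continuous fun ε : ℝ => w X + ε * H X := by fun_prop
    have := this.tendsto 0
    simp only [zero_mul, add_zero] at this
    exact this.mono_left nhdsWithin_le_nhds
  refine ge_of_tendsto h1 ?_
  filter_upwards [self_mem_nhdsWithin] with ε hε using key ε hε X hX hXP hXQ

/-- Minimum principle in a punctured half-ball. -/
lemma min_principle_punctured (hσ0 : 0 < σ) (hσ1 : σ < 1) (hq : 0 < (n : ℝ) - 2 * σ)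
    {w : Pt n → ℝ} {δ c B : ℝ}
    (hw : ContinuousOn w {X | nsq 0 X ≤ δ ∧ 0 ≤ X.2 ∧ X ≠ 0})
    (hB : ∀ X, nsq 0 X ≤ δ → 0 ≤ X.2 → X ≠ 0 → -B ≤ w X)
    (hs : ∀ X, nsq 0 X = δ → 0 ≤ X.2 → c ≤ w X)
    (hEq : ∀ X, nsq 0 X < δ → 0 < X.2 → HasL σ w X 0)
    (hneu : ∀ x, nsq (0 : Pt n) (x, 0) < δ → x ≠ 0 → ∃ g ≤ 0, Neu σ w x g) :
    ∀ X, nsq 0 X ≤ δ → 0 ≤ X.2 → X ≠ 0 → c ≤ w X := by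
  have hKcl : IsClosed {X : Pt n | nsq 0 X ≤ δ ∧ 0 ≤ X.2} :=
    (isClosed_le (continuous_nsq 0) continuous_const).inter
      (isClosed_le continuous_const continuous_snd)
  have := min_principle_sing hσ0 hσ1 hq (w := fun X => w X - c) (P := 0) (Q := 0)
    (K := {X | nsq 0 X ≤ δ ∧ 0 ≤ X.2}) (O := {X | nsq 0 X < δ}) rfl rfl
    (isCompact_of_nsq_le hKcl fun X hX => hX.1)
    ((hw.sub continuousOn_const).mono fun X hX => ⟨hX.1.1, hX.1.2, hX.2.1⟩)
    (fun X hX => hX.2) (isOpen_lt (continuous_nsq 0) continuous_const)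
    (fun Y hY ht => ⟨le_of_lt hY, ht⟩)
    ⟨B + c, fun X hX h0 _ => by linarith [hB X hX.1 hX.2 h0]⟩
    (fun X hX h0 _ hXO => by
      have : nsq 0 X = δ := le_antisymm hX.1 (not_lt.1 hXO)
      linarith [hs X this hX.2])
    (fun X hX hXO ht _ => ⟨0, le_rfl, ((hEq X hXO ht).add_const (-c))⟩)
    (fun x hx hxO h0 _ _ => by
      obtain ⟨g, hg, hN⟩ := hneu x hxO (fun h => h0 (by rw [h]; rfl))
      exact ⟨g, hg, hN.add_const (-c)⟩)
  intro X h1 h2 h3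
  have := this X ⟨h1, h2⟩ h3 h3
  linarith

/-! ### Barriers in cylinders -/

/-- The cylinder `{|x - x₀|² ≤ ρ, 0 ≤ t ≤ τ}`. -/
def Cyl (x₀ : EuclideanSpace ℝ (Fin n)) (ρ τ : ℝ) : Set (Pt n) :=
  {X | ‖X.1 - x₀‖ ^ 2 ≤ ρ ∧ 0 ≤ X.2 ∧ X.2 ≤ τ}

lemma continuous_hsq (x₀ : EuclideanSpace ℝ (Fin n)) :
    Continuous fun X : Pt n => ‖X.1 - x₀‖ ^ 2 := by fun_prop

lemma isCompact_cyl (x₀ : EuclideanSpace ℝ (Fin n)) (ρ τ : ℝ) : IsCompact (Cyl x₀ ρ τ) := by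
  refine isCompact_of_nsq_le (P := (x₀, 0)) (C := ρ + τ ^ 2) ?_ fun X hX => ?_
  · refine (isClosed_le (continuous_hsq x₀) continuous_const).inter
      ((isClosed_le continuous_const continuous_snd).inter
        (isClosed_le continuous_snd continuous_const))
  · obtain ⟨h1, h2, h3⟩ := hX
    simp only [nsq, sub_zero]
    nlinarith

lemma cyl_principle (hσ0 : 0 < σ) (hσ1 : σ < 1) {w : Pt n → ℝ}
    {x₀ : EuclideanSpace ℝ (Fin n)} {ρ τ : ℝ} (hw : ContinuousOn w (Cyl x₀ ρ τ))
    (hlat : ∀ X ∈ Cyl x₀ ρ τ, ‖X.1 - x₀‖ ^ 2 = ρ → 0 ≤ w X)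
    (htop : ∀ X ∈ Cyl x₀ ρ τ, X.2 = τ → 0 ≤ w X)
    (hEq : ∀ X ∈ Cyl x₀ ρ τ, ‖X.1 - x₀‖ ^ 2 < ρ → 0 < X.2 → X.2 < τ → w X < 0 →
      ∃ ℓ ≤ 0, HasL σ w X ℓ)
    (hneu : ∀ x, ‖x - x₀‖ ^ 2 < ρ → w (x, 0) < 0 → ∃ g ≤ 0, Neu σ w x g) :
    ∀ X ∈ Cyl x₀ ρ τ, 0 ≤ w X := by
  refine min_principle_weak hσ0 hσ1 (isCompact_cyl x₀ ρ τ) hw (fun X hX => hX.2.1)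
    (O := {X | ‖X.1 - x₀‖ ^ 2 < ρ ∧ X.2 < τ})
    ((isOpen_lt (continuous_hsq x₀) continuous_const).inter (isOpen_lt continuous_snd continuous_const))
    (fun Y hY ht => ⟨hY.1.le, ht, hY.2.le⟩) ?_
    (fun X hX hXO ht hneg => hEq X hX hXO.1 ht hXO.2 hneg)
    (fun x hx hxO hneg => hneu x hxO.1 hneg)
  intro X hX hXO
  by_cases h : ‖X.1 - x₀‖ ^ 2 < ρ
  · have : ¬ X.2 < τ := fun h' => hXO ⟨h, h'⟩
    exact htop X hX (le_antisymm hX.2.2 (not_lt.1 this))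
  · exact hlat X hX (le_antisymm hX.1 (not_lt.1 h))

/-- The constant `κ` for which `κ t² - |x|²` solves the equation. -/
def kap (n : ℕ) (σ : ℝ) : ℝ := n / (2 * (1 - σ))

lemma kap_nonneg (hσ1 : σ < 1) : 0 ≤ kap n σ := by
  unfold kap
  have : 0 < 1 - σ := by linarith
  positivity

lemma hasL_kap (hσ1 : σ < 1) (x₀ : EuclideanSpace ℝ (Fin n)) {X : Pt n} (hX : 0 < X.2) :
    HasL σ (fun Y : Pt n => kap n σ * Y.2 ^ 2 - ‖Y.1 - x₀‖ ^ 2) X 0 := by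
  refine (((hasL_snd_sq hX).const_mul (kap n σ)).sub (hasL_normsq x₀ X)).congr (fun _ => rfl) ?_
  have : 1 - σ ≠ 0 := by linarith
  unfold kap
  field_simp
  ring

lemma neu_kap (hσ1 : σ < 1) (x₀ x : EuclideanSpace ℝ (Fin n)) :
    Neu σ (fun Y : Pt n => kap n σ * Y.2 ^ 2 - ‖Y.1 - x₀‖ ^ 2) x 0 := by
  have h : Neu σ (fun Y : Pt n => ‖Y.1 - x₀‖ ^ 2) x 0 := neu_of_forall_eq fun _ _ => rfl
  exact (((neu_sq hσ1 x).const_mul (kap n σ)).sub h).congr (fun _ _ => rfl) (by ring)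

/-- The barrier behind `up_barrier` and `gain`. -/
lemma bottom_barrier (hσ0 : 0 < σ) (hσ1 : σ < 1) {w : Pt n → ℝ}
    {x₀ : EuclideanSpace ℝ (Fin n)} {ρ A : ℝ} (hρ : 0 < ρ) (hA : 0 ≤ A)
    (hw : ContinuousOn w (Cyl x₀ (ρ ^ 2) ρ))
    (h0 : ∀ X ∈ Cyl x₀ (ρ ^ 2) ρ, 0 ≤ w X)
    (hEq : ∀ X ∈ Cyl x₀ (ρ ^ 2) ρ, 0 < X.2 → X.2 < ρ → HasL σ w X 0)
    (hbot : ∀ x, ‖x - x₀‖ ^ 2 < ρ ^ 2 → A ≤ w (x, 0) ∨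
      ∃ g ≤ -(A * (1 + kap n σ) * ρ ^ (-(2 * σ))), Neu σ w x g) :
    ∀ X ∈ Cyl x₀ (ρ ^ 2) ρ, A * (1 + (kap n σ * X.2 ^ 2 - ‖X.1 - x₀‖ ^ 2) / ρ ^ 2
      - (1 + kap n σ) * ρ ^ (-(2 * σ)) * X.2 ^ (2 * σ)) ≤ w X := by
  have hk := kap_nonneg (n := n) hσ1
  have hsc : ∀ t : ℝ, 0 ≤ t → t ≤ ρ → t ^ 2 / ρ ^ 2 ≤ ρ ^ (-(2 * σ)) * t ^ (2 * σ) := by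
    intro t ht htρ
    have h1 : ρ ^ (-(2 * σ)) * t ^ (2 * σ) = (t / ρ) ^ (2 * σ) := by
      rw [Real.div_rpow ht hρ.le, Real.rpow_neg hρ.le]; ring
    rw [h1, ← div_pow]
    have h2 : 0 ≤ t / ρ := by positivity
    have h3 : t / ρ ≤ 1 := (div_le_one hρ).2 htρ
    rcases h2.eq_or_lt with h4 | h4
    · rw [← h4, Real.zero_rpow (by linarith)]; simp
    · rw [← Real.rpow_two]
      exact Real.rpow_le_rpow_of_exponent_ge h4 h3 (by linarith)
  have hcontb : Continuous fun X : Pt n => A * (((1 / ρ ^ 2) * (kap n σ * X.2 ^ 2 -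
      ‖X.1 - x₀‖ ^ 2) + (-((1 + kap n σ) * ρ ^ (-(2 * σ)))) * X.2 ^ (2 * σ)) + 1) := by
    have : Continuous fun X : Pt n => X.2 ^ (2 * σ) :=
      continuous_snd.rpow_const fun _ => Or.inr (by linarith)
    fun_prop
  have := cyl_principle hσ0 hσ1 (x₀ := x₀) (ρ := ρ ^ 2) (τ := ρ)
    (w := fun X => w X - A * (((1 / ρ ^ 2) * (kap n σ * X.2 ^ 2 - ‖X.1 - x₀‖ ^ 2) +
      (-((1 + kap n σ) * ρ ^ (-(2 * σ)))) * X.2 ^ (2 * σ)) + 1))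
    (hw.sub hcontb.continuousOn) ?_ ?_ ?_ ?_
  · intro X hX
    have := this X hX
    refine le_trans (le_of_eq ?_) (sub_nonneg.1 this)
    ring
  · intro X hX h
    have h1 := h0 X hX
    have h2 := hsc X.2 hX.2.1 hX.2.2
    rw [h]
    have h4 : 0 ≤ ρ ^ (-(2 * σ)) * X.2 ^ (2 * σ) :=
      mul_nonneg (Real.rpow_nonneg hρ.le _) (Real.rpow_nonneg hX.2.1 _)
    have h3 : (1 / ρ ^ 2) * (kap n σ * X.2 ^ 2 - ρ ^ 2) +
      (-((1 + kap n σ) * ρ ^ (-(2 * σ)))) * X.2 ^ (2 * σ) + 1 ≤ 0 := by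
      have e : (1 / ρ ^ 2) * (kap n σ * X.2 ^ 2 - ρ ^ 2) = kap n σ * (X.2 ^ 2 / ρ ^ 2) - 1 := by
        field_simp
      rw [e]
      nlinarith [mul_le_mul_of_nonneg_left h2 hk]
    nlinarith
  · intro X hX h
    have h1 := h0 X hX
    have e : ρ ^ (-(2 * σ)) * ρ ^ (2 * σ) = 1 := by
      rw [← Real.rpow_add hρ]; simp
    have h3 : (1 / ρ ^ 2) * (kap n σ * X.2 ^ 2 - ‖X.1 - x₀‖ ^ 2) +
      (-((1 + kap n σ) * ρ ^ (-(2 * σ)))) * X.2 ^ (2 * σ) + 1 ≤ 0 := by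
      rw [h, neg_mul, mul_assoc, e]
      have e : (1 / ρ ^ 2) * (kap n σ * ρ ^ 2 - ‖X.1 - x₀‖ ^ 2) =
        kap n σ - ‖X.1 - x₀‖ ^ 2 / ρ ^ 2 := by field_simp
      rw [e]
      have : 0 ≤ ‖X.1 - x₀‖ ^ 2 / ρ ^ 2 := by positivity
      linarith
    nlinarith
  · intro X hX h1 h2 h3 _
    refine ⟨0 - A * ((1 / ρ ^ 2) * 0 + (-((1 + kap n σ) * ρ ^ (-(2 * σ)))) * 0), by simp, ?_⟩
    exact (hEq X hX h2 h3).sub (((((hasL_kap hσ1 x₀ h2).const_mul _).add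
      ((hasL_snd_rpow_two_mul h2).const_mul _)).add_const _).const_mul _)
  · intro x hx hneg
    rcases hbot x hx with h | ⟨g, hg, hN⟩
    · exfalso
      simp only [Real.zero_rpow (show 2 * σ ≠ 0 by linarith)] at hneg
      have : 0 ≤ A * ((1 / ρ ^ 2) * ‖x - x₀‖ ^ 2) := by positivity
      nlinarith
    · refine ⟨g - A * ((1 / ρ ^ 2) * 0 + (-((1 + kap n σ) * ρ ^ (-(2 * σ)))) * 1), ?_, ?_⟩
      · linarith
      exact hN.sub (((((neu_kap hσ1 x₀ x).const_mul _).add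
        ((neu_rpow_two_mul hσ0 x).const_mul _)).add_const _).const_mul _)

/-! ### Invariance of the equation: reflections and inversions -/

/-- The Euclidean inner product on `ℝ^{n+1}`, as a linear form in the second variable. -/
def ipl (D : Pt n) : Pt n →L[ℝ] ℝ := hlin D.1 + D.2 • ContinuousLinearMap.snd ℝ _ _

lemma ipl_apply (D v : Pt n) : ipl D v = ⟪D.1, v.1⟫ + D.2 * v.2 := by simp [ipl]

lemma ipl_ex (D : Pt n) (i : Fin n) : ipl D (ex i) = D.1 i := by
  simp [ipl_apply, ex, EuclideanSpace.inner_single_right]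

lemma ipl_et (D : Pt n) : ipl D (0, 1) = D.2 := by simp [ipl_apply]

lemma ipl_comm (D v : Pt n) : ipl D v = ipl v D := by
  rw [ipl_apply, ipl_apply, real_inner_comm, mul_comm]

lemma sum_coord_smul (D : Pt n) : ∑ i, D.1 i • ex i + D.2 • ((0, 1) : Pt n) = D := by
  refine Prod.ext ?_ ?_
  · ext j
    simp [ex, Prod.fst_sum, Pi.single_apply]
  · simp [ex, Prod.snd_sum]

lemma sum_coord_apply (D : Pt n) (l : Pt n →L[ℝ] ℝ) :
    ∑ i, D.1 i * l (ex i) + D.2 * l (0, 1) = l D := by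
  conv_rhs => rw [← sum_coord_smul D]
  simp only [map_add, map_sum, map_smul, smul_eq_mul]

lemma sum_coord_sq (D : Pt n) : ∑ i, D.1 i ^ 2 + D.2 ^ 2 = nsq 0 D := by
  simp [nsq, EuclideanSpace.norm_sq_eq]

lemma trace_rank_one (B : Pt n →L[ℝ] Pt n →L[ℝ] ℝ) (D : Pt n) (α β : ℝ) :
    ∑ i, B (α • ex i + (β * D.1 i) • D) (α • ex i + (β * D.1 i) • D) +
      B (α • (0, 1) + (β * D.2) • D) (α • (0, 1) + (β * D.2) • D) =
    α ^ 2 * (∑ i, B (ex i) (ex i) + B (0, 1) (0, 1)) +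
      (2 * α * β + β ^ 2 * nsq 0 D) * B D D := by
  have h1 : ∀ (v : Pt n) (c : ℝ), B (α • v + (β * c) • D) (α • v + (β * c) • D) =
      α ^ 2 * B v v + α * β * (c * B D v) + α * β * (c * B.flip D v) +
        β ^ 2 * B D D * c ^ 2 := by
    intro v c
    simp only [map_add, map_smul, add_apply, smul_apply, smul_eq_mul,
      ContinuousLinearMap.flip_apply]
    ring
  rw [Finset.sum_congr rfl fun i _ => h1 (ex i) (D.1 i), h1]
  simp only [Finset.sum_add_distrib, ← Finset.mul_sum]
  have e1 := sum_coord_apply D (B D)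
  have e2 := sum_coord_apply D (B.flip D)
  have e3 := sum_coord_sq D
  have e4 : B.flip D D = B D D := rfl
  rw [e4] at e2
  linear_combination α * β * e1 + α * β * e2 + β ^ 2 * B D D * e3

lemma Lop_eq {U : Pt n → ℝ} {X : Pt n} (h : ContDiffAt ℝ 2 U X) :
    Lop σ U X = (∑ i, fderiv ℝ (fderiv ℝ U) X (ex i) (ex i) +
      fderiv ℝ (fderiv ℝ U) X (0, 1) (0, 1)) + (1 - 2 * σ) / X.2 * fderiv ℝ U X (0, 1) := by
  simp only [Lop, lapl, d2_eq h, dt, ex]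

/-- Reflection of `x` across the hyperplane `⟪e, x - p⟫ = 0`. -/
def refl1 (e p : EuclideanSpace ℝ (Fin n)) (x : EuclideanSpace ℝ (Fin n)) :
    EuclideanSpace ℝ (Fin n) := x - (2 * ⟪e, x - p⟫) • e

/-- Horizontal reflection in `ℝ^{n+1}`. -/
def reflH (e p : EuclideanSpace ℝ (Fin n)) (X : Pt n) : Pt n := (refl1 e p X.1, X.2)

lemma HasL.comp_reflH {U : Pt n → ℝ} {e p : EuclideanSpace ℝ (Fin n)} (he : ‖e‖ = 1) {X : Pt n}
    {ℓ : ℝ} (h : HasL σ U (reflH e p X) ℓ) : HasL σ (fun Y => U (reflH e p Y)) X ℓ := by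
  set D : Pt n := (e, 0) with hD
  have hφ : reflH e p = fun Y => ((1 : ℝ) • ContinuousLinearMap.id ℝ (Pt n) +
      (-2 : ℝ) • (ipl D).smulRight D) Y + (2 * ⟪e, p⟫) • D := by
    funext Y
    refine Prod.ext ?_ ?_
    · simp only [reflH, refl1, hD, inner_sub_right, ipl_apply, add_apply, smul_apply,
        ContinuousLinearMap.smulRight_apply, ContinuousLinearMap.id_apply, Prod.fst_add,
        Prod.smul_fst]
      module
    · simp [reflH, hD]
  have hd : ∀ Y, HasFDerivAt (reflH e p) ((1 : ℝ) • ContinuousLinearMap.id ℝ (Pt n) +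
      (-2 : ℝ) • (ipl D).smulRight D) Y := by
    intro Y
    rw [hφ]
    exact (ContinuousLinearMap.hasFDerivAt _).add_const _
  have hs : ContDiffAt ℝ 2 (reflH e p) X := by
    rw [hφ]
    exact ((ContinuousLinearMap.contDiff _).add contDiff_const).contDiffAt
  have hn : nsq 0 D = 1 := by simp [nsq, hD, he]
  have h2 : ∀ v, d2 (fun Y => U (reflH e p Y)) X v =
      fderiv ℝ (fderiv ℝ U) (reflH e p X) ((1 : ℝ) • v + (-2 * ipl D v) • D)
        ((1 : ℝ) • v + (-2 * ipl D v) • D) := by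
    intro v
    have := d2_comp (v := v) (k := fun _ => (1 : ℝ) • v + (-2 * ipl D v) • D) (k' := 0) h.smooth hs
      (Eventually.of_forall fun Y => by
        rw [(hd Y).fderiv]
        simp [smul_smul]) (hasFDerivAt_const _ _)
    simpa using this
  have h1 : dt (fun Y => U (reflH e p Y)) X = fderiv ℝ U (reflH e p X) (0, 1) := by
    have := ((h.smooth.differentiableAt (by simp)).hasFDerivAt.comp X (hd X)).fderiv
    simp only [Function.comp_def] at this
    rw [dt, this]
    simp [ipl_apply, hD]
  refine ⟨h.smooth.comp X hs, ?_⟩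
  have := trace_rank_one (fderiv ℝ (fderiv ℝ U) (reflH e p X)) D 1 (-2)
  rw [hn] at this
  rw [← h.eq, Lop_eq h.smooth, Lop, lapl, h1]
  simp only [h2, ← ex.eq_1, ipl_ex, ipl_et]
  rw [this]
  have e5 : (reflH e p X).2 = X.2 := rfl
  rw [e5]
  ring

/-- Inversion in the sphere with centre `Z` and radius `l`. -/
def inv1 (Z : Pt n) (l : ℝ) (Y : Pt n) : Pt n := (l ^ 2 * (nsq Z Y)⁻¹) • (Y - Z) + Z

/-- The Kelvin transform. -/
def kelvin (σ : ℝ) (Z : Pt n) (l : ℝ) (U : Pt n → ℝ) (Y : Pt n) : ℝ :=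
  l ^ ((n : ℝ) - 2 * σ) * (nsq Z Y ^ (-(((n : ℝ) - 2 * σ) / 2)) * U (inv1 Z l Y))

lemma hasFDerivAt_nsq' (P X : Pt n) : HasFDerivAt (nsq P) ((2 : ℝ) • ipl (X - P)) X := by
  refine (hasFDerivAt_nsq P X).congr_fderiv ?_
  simp [ipl, smul_smul]

lemma HasL.comp_inv1 {U : Pt n → ℝ} {Z : Pt n} {l : ℝ} (hl : l ≠ 0) (hZ : Z.2 = 0) {Y : Pt n}
    (hY : 0 < Y.2) (h : HasL σ U (inv1 Z l Y) 0) :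
    HasL σ (fun X => U (inv1 Z l X)) Y (-2 * ((n : ℝ) - 2 * σ) * l ^ 2 * (nsq Z Y ^ 2)⁻¹ *
      fderiv ℝ U (inv1 Z l Y) (Y - Z)) ∧
    ∀ v, fderiv ℝ (fun X => U (inv1 Z l X)) Y v = l ^ 2 * (nsq Z Y)⁻¹ * fderiv ℝ U (inv1 Z l Y) v
      + (-2 * l ^ 2 * (nsq Z Y ^ 2)⁻¹) * ipl (Y - Z) v * fderiv ℝ U (inv1 Z l Y) (Y - Z) := by
  have hne : ∀ X : Pt n, 0 < X.2 → 0 < nsq Z X := fun X hX =>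
    nsq_pos fun hh => by rw [hh, hZ] at hX; exact lt_irrefl _ hX
  have hpos : ∀ᶠ X in 𝓝 Y, 0 < X.2 := (continuous_snd.isOpen_preimage _ isOpen_Ioi).mem_nhds hY
  have hsub : ∀ X : Pt n, HasFDerivAt (fun X : Pt n => X - Z) (ContinuousLinearMap.id ℝ _) X :=
    fun X => (hasFDerivAt_id X).sub_const Z
  have hinv : ∀ X : Pt n, 0 < X.2 → HasFDerivAt (fun X => (nsq Z X)⁻¹)
      ((-(nsq Z X ^ 2)⁻¹) • ((2 : ℝ) • ipl (X - Z))) X := fun X hX =>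
    (hasDerivAt_inv (hne X hX).ne').comp_hasFDerivAt X (hasFDerivAt_nsq' Z X)
  have hd : ∀ X : Pt n, 0 < X.2 → HasFDerivAt (inv1 Z l)
      ((l ^ 2 * (nsq Z X)⁻¹) • ContinuousLinearMap.id ℝ _ +
        ((l ^ 2) • ((-(nsq Z X ^ 2)⁻¹) • ((2 : ℝ) • ipl (X - Z)))).smulRight (X - Z)) X :=
    fun X hX => (((hinv X hX).const_mul (l ^ 2)).fun_smul (hsub X)).add_const Z
  have hk : ∀ v : Pt n, ∀ᶠ X in 𝓝 Y, fderiv ℝ (inv1 Z l) X v =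
      (l ^ 2 * (nsq Z X)⁻¹) • v + ((-2 * l ^ 2) * (((nsq Z X)⁻¹ * (nsq Z X)⁻¹) *
        ipl v (X - Z))) • (X - Z) := by
    intro v
    filter_upwards [hpos] with X hX
    rw [(hd X hX).fderiv]
    simp only [add_apply, smul_apply, ContinuousLinearMap.id_apply,
      ContinuousLinearMap.smulRight_apply, smul_eq_mul, ipl_comm v]
    congr 2
    have e5 : (nsq Z X ^ 2)⁻¹ = (nsq Z X)⁻¹ * (nsq Z X)⁻¹ := by rw [sq, mul_inv]
    rw [e5]
    ring
  have hs : ContDiffAt ℝ 2 (inv1 Z l) Y := by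
    have h1 : ContDiffAt ℝ 2 (nsq Z) Y := (hasL_nsq (σ := σ) Z Y).smooth
    exact ((contDiffAt_const.mul (h1.inv (hne Y hY).ne')).smul
      (contDiffAt_id.sub contDiffAt_const)).add contDiffAt_const
  set s := nsq Z Y with hs_def
  set D := Y - Z with hD
  set l₁ := fderiv ℝ U (inv1 Z l Y) with hl₁
  have hs0 : 0 < s := hne Y hY
  have hnD : nsq 0 D = s := by simp [nsq, hD, hs_def]
  have h2 : ∀ v, d2 (fun X => U (inv1 Z l X)) Y v =
      fderiv ℝ (fderiv ℝ U) (inv1 Z l Y)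
        ((l ^ 2 * s⁻¹) • v + ((-2 * l ^ 2 * (s ^ 2)⁻¹) * ipl D v) • D)
        ((l ^ 2 * s⁻¹) • v + ((-2 * l ^ 2 * (s ^ 2)⁻¹) * ipl D v) • D) +
      ((-4 * l ^ 2 * (s ^ 2)⁻¹) * (ipl D v * l₁ v) +
        l₁ D * (8 * l ^ 2 * (s ^ 3)⁻¹) * ipl D v ^ 2 -
        l₁ D * (2 * l ^ 2 * (s ^ 2)⁻¹) * ipl v v) := by
    intro v
    have hk' := (((hinv Y hY).const_mul (l ^ 2)).smul_const v).add
      (((((hinv Y hY).mul (hinv Y hY)).mul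
        ((ipl v).hasFDerivAt.comp Y (hsub Y))).const_mul (-2 * l ^ 2)).fun_smul (hsub Y))
    have := d2_comp h.smooth hs (hk v) hk'
    rw [this]
    have e1 : (l ^ 2 * (nsq Z Y)⁻¹) • v + ((-2 * l ^ 2) * (((nsq Z Y)⁻¹ * (nsq Z Y)⁻¹) *
        ipl v (Y - Z))) • (Y - Z) =
        (l ^ 2 * s⁻¹) • v + ((-2 * l ^ 2 * (s ^ 2)⁻¹) * ipl D v) • D := by
      rw [← hs_def, ← hD, ipl_comm v D]
      congr 2
      field_simp
    rw [e1]
    congr 1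
    simp only [← hs_def, ← hD, add_apply, smul_apply, ContinuousLinearMap.smulRight_apply,
      ContinuousLinearMap.comp_apply, ContinuousLinearMap.id_apply, map_add, map_smul,
      smul_eq_mul, Pi.mul_apply, Function.comp_apply, ipl_comm v D, ← hl₁]
    field_simp
    ring
  have h1 : ∀ v, fderiv ℝ (fun X => U (inv1 Z l X)) Y v =
      l ^ 2 * s⁻¹ * l₁ v + (-2 * l ^ 2 * (s ^ 2)⁻¹) * ipl D v * l₁ D := by
    intro v
    have := ((h.smooth.differentiableAt (by simp)).hasFDerivAt.comp Y (hd Y hY)).fderiv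
    simp only [Function.comp_def] at this
    rw [this]
    simp only [ContinuousLinearMap.comp_apply, add_apply, smul_apply, ContinuousLinearMap.id_apply,
      ContinuousLinearMap.smulRight_apply, smul_eq_mul, map_add, map_smul]
    ring
  refine ⟨⟨h.smooth.comp Y hs, ?_⟩, h1⟩
  have htr := trace_rank_one (fderiv ℝ (fderiv ℝ U) (inv1 Z l Y)) D (l ^ 2 * s⁻¹)
    (-2 * l ^ 2 * (s ^ 2)⁻¹)
  rw [hnD] at htr
  have he := h.eq
  rw [Lop_eq h.smooth] at he
  have e1 := sum_coord_apply D l₁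
  have e2 := sum_coord_sq D
  rw [hnD] at e2
  have hD2 : D.2 = Y.2 := by simp [hD, hZ]
  have hI2 : (inv1 Z l Y).2 = l ^ 2 * s⁻¹ * Y.2 := by simp [inv1, hZ, hs_def]
  have e3 : ∀ i, ipl (ex i) (ex i : Pt n) = 1 := fun i => by rw [ipl_ex]; simp [ex]
  have e4 : ipl ((0, 1) : Pt n) (0, 1) = 1 := by rw [ipl_et]
  have e5 : ipl D ((0, 1) : Pt n) = Y.2 := by rw [ipl_et, hD2]
  have hsum : ∑ i, d2 (fun X => U (inv1 Z l X)) Y (ex i) + d2 (fun X => U (inv1 Z l X)) Y (0, 1) =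
      (l ^ 2 * s⁻¹) ^ 2 * (∑ i, fderiv ℝ (fderiv ℝ U) (inv1 Z l Y) (ex i) (ex i) +
        fderiv ℝ (fderiv ℝ U) (inv1 Z l Y) (0, 1) (0, 1)) +
      (2 * (l ^ 2 * s⁻¹) * (-2 * l ^ 2 * (s ^ 2)⁻¹) + (-2 * l ^ 2 * (s ^ 2)⁻¹) ^ 2 * s) *
        fderiv ℝ (fderiv ℝ U) (inv1 Z l Y) D D +
      ((-4 * l ^ 2 * (s ^ 2)⁻¹) * l₁ D + l₁ D * (8 * l ^ 2 * (s ^ 3)⁻¹) * s -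
        l₁ D * (2 * l ^ 2 * (s ^ 2)⁻¹) * (n + 1)) := by
    rw [← htr]
    simp only [h2, ipl_ex, ipl_et, e3, e4, Finset.sum_add_distrib, Finset.sum_sub_distrib,
      ← Finset.mul_sum, Finset.sum_const, Finset.card_univ, Fintype.card_fin, nsmul_eq_mul]
    linear_combination (-4 * l ^ 2 * (s ^ 2)⁻¹) * e1 + l₁ D * (8 * l ^ 2 * (s ^ 3)⁻¹) * e2
  have hsum' : lapl (fun X => U (inv1 Z l X)) Y = _ := hsum
  rw [Lop, hsum', dt, h1, e5]
  rw [hI2] at he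
  have hY0 := hY.ne'
  have hs1 := hs0.ne'
  set T := ∑ i, fderiv ℝ (fderiv ℝ U) (inv1 Z l Y) (ex i) (ex i) +
        fderiv ℝ (fderiv ℝ U) (inv1 Z l Y) (0, 1) (0, 1)
  have he' : T = - ((1 - 2 * σ) / (l ^ 2 * s⁻¹ * Y.2) * l₁ (0, 1)) := by linear_combination he
  rw [he']
  field_simp
  ring

/-- The Kelvin transform preserves the equation. -/
lemma HasL.kelvin {U : Pt n → ℝ} {Z : Pt n} {l : ℝ} (hl : l ≠ 0) (hZ : Z.2 = 0) {Y : Pt n}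
    (hY : 0 < Y.2) (h : HasL σ U (inv1 Z l Y) 0) : HasL σ (kelvin σ Z l U) Y 0 := by
  obtain ⟨hg, hg'⟩ := h.comp_inv1 hl hZ hY
  have hne : Y ≠ Z := fun hh => by rw [hh, hZ] at hY; exact lt_irrefl _ hY
  have hs0 := nsq_pos hne
  set q := (n : ℝ) - 2 * σ with hq
  have hf := hasL_nsq_rpow_bdry (σ := σ) hY hZ (-(q / 2))
  have hf' : ∀ v, fderiv ℝ (fun X => nsq Z X ^ (-(q / 2))) Y v =
      (-(q / 2)) * nsq Z Y ^ (-(q / 2) - 1) * (2 * ipl (Y - Z) v) := by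
    intro v
    rw [((hasFDerivAt_nsq' Z Y).rpow_const (p := -(q / 2)) (Or.inl hs0.ne')).fderiv]
    simp
  refine ((hf.mul hg).const_mul (l ^ q)).congr (fun _ => rfl) ?_
  set l₁ := fderiv ℝ U (inv1 Z l Y)
  set D := Y - Z with hD
  set s := nsq Z Y with hs
  have hnD : nsq 0 D = s := by simp [nsq, hD, hs]
  have e1 := sum_coord_apply D l₁
  have e2 := sum_coord_sq D
  rw [hnD] at e2
  have hgd : gdot (fun X => nsq Z X ^ (-(q / 2))) (fun X => U (inv1 Z l X)) Y =
      q * s ^ (-(q / 2) - 1) * (l ^ 2 * s⁻¹) * l₁ D := by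
    rw [gdot, dt, dt]
    simp only [hf', hg', ipl_ex, ipl_et]
    have : ∀ i, -(q / 2) * s ^ (-(q / 2) - 1) * (2 * D.1 i) *
        (l ^ 2 * s⁻¹ * l₁ (ex i) + -2 * l ^ 2 * (s ^ 2)⁻¹ * D.1 i * l₁ D) =
        (-(q * s ^ (-(q / 2) - 1) * (l ^ 2 * s⁻¹))) * (D.1 i * l₁ (ex i)) +
        (2 * q * s ^ (-(q / 2) - 1) * l ^ 2 * (s ^ 2)⁻¹ * l₁ D) * D.1 i ^ 2 := fun i => by ring
    rw [Finset.sum_congr rfl fun i _ => this i, Finset.sum_add_distrib, ← Finset.mul_sum,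
      ← Finset.mul_sum]
    have e3 : (s ^ 2)⁻¹ * s = s⁻¹ := by field_simp
    linear_combination (-(q * s ^ (-(q / 2) - 1) * (l ^ 2 * s⁻¹))) * e1 +
      (2 * q * s ^ (-(q / 2) - 1) * l ^ 2 * (s ^ 2)⁻¹ * l₁ D) * e2 +
      (2 * q * s ^ (-(q / 2) - 1) * l ^ 2 * l₁ D) * e3
  rw [hgd]
  have e4 : s ^ (-(q / 2) - 1) = s ^ (-(q / 2)) * s⁻¹ := by
    rw [Real.rpow_sub_one hs0.ne']; rfl
  have e5 : 2 * (-(q / 2)) * (2 * (-(q / 2)) + q) = 0 := by ring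
  rw [e5, e4]
  ring

/-! ### The interior Harnack inequality -/

lemma nsq_comm (P X : Pt n) : nsq P X = nsq X P := by
  rw [nsq, nsq, norm_sub_rev]; ring

lemma nsq_triangle {P Q X : Pt n} {a b : ℝ} (ha : 0 ≤ a) (hb : 0 ≤ b) (h1 : nsq Q P ≤ a ^ 2)
    (h2 : nsq P X ≤ b ^ 2) : nsq Q X ≤ (a + b) ^ 2 := by
  have h3 : ‖X.1 - Q.1‖ ≤ ‖P.1 - Q.1‖ + ‖X.1 - P.1‖ := by
    have := norm_add_le (P.1 - Q.1) (X.1 - P.1)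
    rwa [sub_add_sub_cancel'] at this
  unfold nsq at *
  set u := ‖P.1 - Q.1‖
  set v := ‖X.1 - P.1‖
  set c := P.2 - Q.2 with hc
  set d := X.2 - P.2 with hd
  have hcd : X.2 - Q.2 = c + d := by rw [hc, hd]; ring
  rw [hcd]
  have h5 : u * v + c * d ≤ a * b := by
    refine le_of_abs_le (abs_le_of_sq_le_sq ?_ (by positivity))
    have := mul_le_mul h1 h2 (by positivity) (by positivity)
    nlinarith [sq_nonneg (u * d - v * c)]
  have h6 : ‖X.1 - Q.1‖ ^ 2 ≤ (u + v) ^ 2 := pow_le_pow_left₀ (norm_nonneg _) h3 2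
  nlinarith

lemma abs_snd_sub_le {P X : Pt n} {r : ℝ} (hr : 0 ≤ r) (h : nsq P X ≤ r ^ 2) : |X.2 - P.2| ≤ r :=
  abs_le_of_sq_le_sq (by unfold nsq at h; nlinarith [sq_nonneg ‖X.1 - P.1‖]) hr

lemma norm_fst_sub_le {P X : Pt n} {r : ℝ} (hr : 0 ≤ r) (h : nsq P X ≤ r ^ 2) : ‖X.1 - P.1‖ ≤ r :=
  le_of_abs_le (abs_le_of_sq_le_sq (by unfold nsq at h; nlinarith [sq_nonneg (X.2 - P.2)]) hr)

/-- Comparison with a negative power of the distance. -/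
lemma annular_barrier (hσ0 : 0 < σ) (hσ1 : σ < 1) {U : Pt n → ℝ} {P : Pt n} {r R μ : ℝ}
    (hr : 0 < r) (hR : 0 < R) (hμ : 0 ≤ μ) {K O : Set (Pt n)} (hK : IsCompact K)
    (hU : ContinuousOn U K) (hKt : ∀ X ∈ K, 0 < X.2 ∧ P.2 / 2 ≤ X.2 ∧ r ^ 2 ≤ nsq P X)
    (hP : 0 < P.2) (hO : IsOpen O) (hOK : O ⊆ K)
    (hbdry : ∀ X ∈ K, X ∉ O → (R ^ 2 ≤ nsq P X ∧ 0 ≤ U X) ∨ μ ≤ U X)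
    (hEq : ∀ X ∈ O, HasL σ U X 0) :
    ∀ X ∈ K, μ * r ^ (2 * (n + 1)) * ((nsq P X ^ (n + 1))⁻¹ - (R ^ (2 * (n + 1)))⁻¹) ≤ U X := by
  set γ : ℝ := -((n + 1 : ℕ) : ℝ) with hγ
  have hpw : ∀ s : ℝ, 0 < s → s ^ γ = (s ^ (n + 1))⁻¹ := fun s hs => by
    rw [hγ, Real.rpow_neg hs.le, Real.rpow_natCast]
  have hpos : ∀ X ∈ K, 0 < nsq P X := fun X hX => lt_of_lt_of_le (by positivity) (hKt X hX).2.2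
  set c := μ * r ^ (2 * (n + 1)) with hc
  have hc0 : 0 ≤ c := by positivity
  have := min_principle_weak hσ0 hσ1 (K := K) (O := O)
    (w := fun X => U X - c * (nsq P X ^ γ + -(R ^ (2 * (n + 1)))⁻¹)) hK ?_
    (fun X hX => (hKt X hX).1.le) hO (fun Y hY _ => hOK hY) ?_ ?_ ?_
  · intro X hX
    have h := this X hX
    rw [hpw _ (hpos X hX)] at h
    linarith
  · refine hU.sub (continuousOn_const.mul (ContinuousOn.add ?_ continuousOn_const))
    exact (continuous_nsq P).continuousOn.rpow_const fun X hX => Or.inl (hpos X hX).ne'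
  · intro X hX hXO
    have hp := hpos X hX
    rw [hpw _ hp]
    rcases hbdry X hX hXO with ⟨h1, h2⟩ | h1
    · have h3 : (nsq P X ^ (n + 1))⁻¹ ≤ (R ^ (2 * (n + 1)))⁻¹ := by
        rw [pow_mul]
        have : 0 < R ^ 2 := by positivity
        exact inv_anti₀ (by positivity) (pow_le_pow_left₀ this.le h1 _)
      nlinarith
    · have h3 : c * (nsq P X ^ (n + 1))⁻¹ ≤ μ := by
        rw [hc, pow_mul, mul_assoc, ← div_eq_mul_inv]
        refine mul_le_of_le_one_right hμ ((div_le_one (by positivity)).2 ?_)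
        exact pow_le_pow_left₀ (by positivity) (hKt X hX).2.2 _
      have h4 : 0 ≤ c * (R ^ (2 * (n + 1)))⁻¹ :=
        mul_nonneg hc0 (inv_nonneg.2 (by rw [pow_mul]; positivity))
      linarith
  · intro X hX hXO ht _
    have hne : X ≠ P := fun h => by
      have := hpos X hX
      rw [h, nsq_self] at this
      exact lt_irrefl _ this
    refine ⟨_, ?_, (hEq X hXO).sub (((hasL_nsq_rpow hne γ).add_const _).const_mul c)⟩
    have h1 : (X.2 - P.2) / X.2 ≤ 1 := (div_le_one ht).2 (by linarith)
    have h2 : -1 ≤ (X.2 - P.2) / X.2 := by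
      rw [le_div_iff₀ ht]
      linarith [(hKt X hX).2.1]
    have h3 : 2 * (n : ℝ) + 2 + 2 * (1 - 2 * σ) * (X.2 - P.2) / X.2 + 4 * (γ - 1) ≤ 0 := by
      rw [mul_div_assoc, hγ]
      push_cast
      have : (0 : ℝ) ≤ n := Nat.cast_nonneg n
      nlinarith
    have h4 : 0 ≤ nsq P X ^ (γ - 1) := Real.rpow_nonneg (nsq_nonneg _ _) _
    have h5 : γ ≤ 0 := by rw [hγ, neg_nonpos]; positivity
    have h6 := mul_nonneg_of_nonpos_of_nonpos (mul_nonpos_of_nonpos_of_nonneg h5 h4) h3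
    nlinarith
  · intro x hx _ _
    exact absurd (hKt _ hx).1 (lt_irrefl _)

lemma refl1_sub {e p x : EuclideanSpace ℝ (Fin n)} :
    refl1 e p x - p = (x - p) - (2 * ⟪e, x - p⟫) • e := by
  rw [refl1]; abel

lemma norm_refl1_sub {e p : EuclideanSpace ℝ (Fin n)} (he : ‖e‖ = 1)
    (x : EuclideanSpace ℝ (Fin n)) : ‖refl1 e p x - p‖ = ‖x - p‖ := by
  have : ‖refl1 e p x - p‖ ^ 2 = ‖x - p‖ ^ 2 := by
    rw [refl1_sub, norm_sub_sq_real, norm_smul, inner_smul_right, he, real_inner_comm,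
      Real.norm_eq_abs, mul_one, sq_abs]
    ring
  exact (sq_eq_sq₀ (norm_nonneg _) (norm_nonneg _)).1 this

lemma nsq_reflH {e : EuclideanSpace ℝ (Fin n)} {P : Pt n} (he : ‖e‖ = 1) (X : Pt n) :
    nsq P (reflH e P.1 X) = nsq P X := by
  simp only [nsq, reflH, norm_refl1_sub he]

lemma continuous_reflH (e p : EuclideanSpace ℝ (Fin n)) : Continuous (reflH e p) := by
  unfold reflH refl1
  fun_prop

lemma refl1_of_eq {e p x : EuclideanSpace ℝ (Fin n)} (h : ⟪e, x - p⟫ = 0) : refl1 e p x = x := by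
  simp [refl1, h]

/-- For distinct points there is a reflection exchanging them. -/
lemma exists_refl {x y : EuclideanSpace ℝ (Fin n)} (h : x ≠ y) :
    ∃ e : EuclideanSpace ℝ (Fin n), ‖e‖ = 1 ∧ ⟪e, x - midpoint ℝ x y⟫ = ‖x - y‖ / 2 ∧
      refl1 e (midpoint ℝ x y) x = y ∧ ‖x - midpoint ℝ x y‖ = ‖x - y‖ / 2 := by
  have h0 : 0 < ‖x - y‖ := norm_sub_pos_iff.2 h
  have hm : x - midpoint ℝ x y = (1 / 2 : ℝ) • (x - y) := by
    rw [midpoint_eq_smul_add]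
    simp only [invOf_eq_inv]
    module
  have h1 : ⟪(‖x - y‖⁻¹) • (x - y), x - midpoint ℝ x y⟫ = ‖x - y‖ / 2 := by
    rw [hm, inner_smul_left, inner_smul_right, real_inner_self_eq_norm_sq]
    simp
    field_simp
  refine ⟨(‖x - y‖⁻¹) • (x - y), ?_, h1, ?_, ?_⟩
  · rw [norm_smul, norm_inv, norm_norm, inv_mul_cancel₀ h0.ne']
  · rw [refl1, h1, smul_smul, show 2 * (‖x - y‖ / 2) * ‖x - y‖⁻¹ = 1 by field_simp]
    simp
  · rw [hm, norm_smul]; norm_num; ring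

/-- Horizontal Lipschitz-type estimate for bounded solutions in the interior. -/
lemma horizontal_lower (hσ0 : 0 < σ) (hσ1 : σ < 1) {U : Pt n → ℝ} {X₀ : Pt n} {D S : ℝ}
    (hD : 0 < D) (hDt : 4 * D ≤ X₀.2) (hS : 0 ≤ S)
    (hU : ∀ X, nsq X₀ X ≤ D ^ 2 → HasL σ U X 0 ∧ 0 ≤ U X ∧ U X ≤ S)
    {y : EuclideanSpace ℝ (Fin n)} (hy : ‖X₀.1 - y‖ ≤ D / 2) :
    U X₀ - S * (2 * (n + 3)) * ‖X₀.1 - y‖ / D ≤ U (y, X₀.2) := by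
  rcases eq_or_ne X₀.1 y with h | hne
  · subst h; simp
  obtain ⟨e, he, h1, h2, h3⟩ := exists_refl hne
  set s := ‖X₀.1 - y‖ with hs
  have hs0 : 0 < s := norm_sub_pos_iff.2 hne
  set P : Pt n := (midpoint ℝ X₀.1 y, X₀.2) with hP
  have hPX : nsq X₀ P ≤ (D / 4) ^ 2 := by
    rw [nsq_comm, nsq, h3]
    simp only [hP, sub_self]
    nlinarith
  have hball : ∀ X, nsq P X ≤ (D / 2) ^ 2 → nsq X₀ X ≤ D ^ 2 := fun X hX =>
    (nsq_triangle (by positivity) (by positivity) hPX hX).trans (by nlinarith)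
  have hball' : ∀ X, nsq P X ≤ (D / 2) ^ 2 → nsq X₀ (reflH e P.1 X) ≤ D ^ 2 := fun X hX =>
    hball _ (by rwa [nsq_reflH he])
  have hin : Continuous fun X : Pt n => ⟪e, X.1 - P.1⟫ := by fun_prop
  have hcU : ∀ X, nsq X₀ X ≤ D ^ 2 → ContinuousAt U X := fun X hX => (hU X hX).1.smooth.continuousAt
  have ht : ∀ X, nsq P X ≤ (D / 2) ^ 2 → 0 < X.2 ∧ |X.2 - P.2| ≤ X.2 := by
    intro X hX
    have := abs_snd_sub_le (by positivity) hX
    have h4 := abs_le.1 this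
    simp only [hP] at *
    constructor <;> linarith
  have key := min_principle_weak hσ0 hσ1
    (K := {X : Pt n | nsq P X ≤ (D / 2) ^ 2 ∧ 0 ≤ ⟪e, X.1 - P.1⟫})
    (O := {X : Pt n | nsq P X < (D / 2) ^ 2 ∧ 0 < ⟪e, X.1 - P.1⟫})
    (w := fun X => S / (D / 2) ^ 2 * (nsq P X + (n + 2) * (D / 2 * ⟪e, X.1 - P.1⟫ +
      (-1) * ⟪e, X.1 - P.1⟫ ^ 2)) - (U X - U (reflH e P.1 X)))
    (isCompact_of_nsq_le ((isClosed_le (continuous_nsq P) continuous_const).inter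
      (isClosed_le continuous_const hin)) fun X hX => hX.1) ?_ ?_
    ((isOpen_lt (continuous_nsq P) continuous_const).inter (isOpen_lt continuous_const hin))
    (fun Y hY _ => ⟨hY.1.le, hY.2.le⟩) ?_ ?_ ?_
  · have := key X₀ ⟨by rw [nsq_comm]; exact hPX.trans (by nlinarith), by rw [h1]; positivity⟩
    have e1 : reflH e P.1 X₀ = (y, X₀.2) := by simp only [reflH, hP, h2]
    have e2 : nsq P X₀ = s ^ 2 / 4 := by
      rw [nsq, h3]; simp only [hP, sub_self]; ring
    have e3 : ⟪e, X₀.1 - P.1⟫ = s / 2 := h1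
    rw [e1, e2, e3] at this
    have e4 : S / (D / 2) ^ 2 * (s ^ 2 / 4 + (n + 2) * (D / 2 * (s / 2) + (-1) * (s / 2) ^ 2)) ≤
        S * (2 * (n + 3)) * s / D := by
      have : S / (D / 2) ^ 2 * (s ^ 2 / 4 + (n + 2) * (D / 2 * (s / 2) + (-1) * (s / 2) ^ 2)) ≤
          S / (D / 2) ^ 2 * (D * s / 2 * (n + 3)) := by
        refine mul_le_mul_of_nonneg_left ?_ (by positivity)
        have : (0 : ℝ) ≤ n := Nat.cast_nonneg n
        nlinarith [mul_nonneg this (sq_nonneg s), mul_nonneg this (mul_pos hs0 hD).le]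
      refine this.trans (le_of_eq ?_)
      field_simp
    linarith
  · refine ContinuousOn.sub (Continuous.continuousOn ?_) (ContinuousOn.sub ?_ ?_)
    · exact continuous_const.mul ((continuous_nsq P).add (by fun_prop))
    · exact fun X hX => (hcU X (hball X hX.1)).continuousWithinAt
    · exact fun X hX => (ContinuousAt.comp (f := reflH e P.1) (hcU _ (hball' X hX.1))
        (continuous_reflH _ _).continuousAt).continuousWithinAt
  · exact fun X hX => (ht X hX.1).1.le
  · intro X hX hXO
    have hn : (0 : ℝ) ≤ n := Nat.cast_nonneg n
    have hy1 : ⟪e, X.1 - P.1⟫ ≤ D / 2 := by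
      refine (real_inner_le_norm _ _).trans ?_
      rw [he, one_mul]
      exact norm_fst_sub_le (by positivity) hX.1
    have hy2 : 0 ≤ D / 2 * ⟪e, X.1 - P.1⟫ + (-1) * ⟪e, X.1 - P.1⟫ ^ 2 := by nlinarith [hX.2]
    by_cases h4 : nsq P X < (D / 2) ^ 2
    · have h5 : ⟪e, X.1 - P.1⟫ = 0 := by
        by_contra h
        exact hXO ⟨h4, lt_of_le_of_ne hX.2 (Ne.symm h)⟩
      have h6 : reflH e P.1 X = X := by rw [reflH, refl1_of_eq h5]
      rw [h6, h5, sub_self, sub_zero]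
      have := nsq_nonneg P X
      refine mul_nonneg (by positivity) (add_nonneg this ?_)
      simp
    · have h5 : nsq P X = (D / 2) ^ 2 := le_antisymm hX.1 (not_lt.1 h4)
      have h6 := (hU X (hball X hX.1)).2.2
      have h7 := (hU _ (hball' X hX.1)).2.1
      have h8 : S ≤ S / (D / 2) ^ 2 * (nsq P X + (n + 2) * (D / 2 * ⟪e, X.1 - P.1⟫ +
          (-1) * ⟪e, X.1 - P.1⟫ ^ 2)) := by
        rw [h5]
        have : S / (D / 2) ^ 2 * (D / 2) ^ 2 = S := by field_simp
        have h9 : 0 ≤ S / (D / 2) ^ 2 * ((n + 2) * (D / 2 * ⟪e, X.1 - P.1⟫ +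
          (-1) * ⟪e, X.1 - P.1⟫ ^ 2)) := by positivity
        linarith
      linarith
  · intro X hX hXO h4 _
    have hA := (hU X (hball X hX.1)).1
    have hB := ((hU _ (hball' X hX.1)).1).comp_reflH he
    have hlin := hasL_hlin (σ := σ) e P.1 X
    have hsq := hasL_hlin_sq (σ := σ) e P.1 X
    refine ⟨_, ?_, (((hasL_nsq P X).add (((hlin.const_mul (D / 2)).add
      (hsq.const_mul (-1))).const_mul ((n : ℝ) + 2))).const_mul (S / (D / 2) ^ 2)).sub
        (hA.sub hB)⟩
    have h5 := abs_le.1 (ht X hX.1).2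
    have h6 : (X.2 - P.2) / X.2 ≤ 1 := (div_le_one h4).2 h5.2
    have h7 : -1 ≤ (X.2 - P.2) / X.2 := by rw [le_div_iff₀ h4]; linarith
    have h8 : 2 * (n : ℝ) + 2 + 2 * (1 - 2 * σ) * (X.2 - P.2) / X.2 +
        (n + 2) * (D / 2 * 0 + (-1) * (2 * ‖e‖ ^ 2)) ≤ 0 := by
      rw [mul_div_assoc, he]
      nlinarith
    have h9 : 0 ≤ S / (D / 2) ^ 2 := by positivity
    simp only [sub_zero]
    exact mul_nonpos_of_nonneg_of_nonpos h9 h8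
  · intro x hx _ _
    exact absurd (ht _ hx.1).1 (lt_irrefl _)

lemma lens_barrier (hσ0 : 0 < σ) (hσ1 : σ < 1) {U : Pt n → ℝ} {X₀ : Pt n} {s μ : ℝ} (hs : 0 < s)
    (hst : 2 * s ≤ X₀.2) (hμ : 0 ≤ μ) (hU : ∀ X, nsq X₀ X ≤ (3 * s) ^ 2 → HasL σ U X 0 ∧ 0 ≤ U X)
    (hdisc : ∀ y, ‖y - X₀.1‖ ≤ s → μ ≤ U (y, X₀.2)) :
    ∀ X, nsq (X₀.1, X₀.2 + s / 8) X ≤ (s / 8) ^ 2 →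
      μ * ((16 / 25) ^ (n + 1) - (25 / 49) ^ (n + 1)) ≤ U X := by
  set P : Pt n := (X₀.1, X₀.2 - s) with hP
  have hPX : nsq X₀ P ≤ s ^ 2 := by simp [nsq, hP]
  have hball : ∀ X, nsq P X ≤ (7 / 5 * s) ^ 2 → nsq X₀ X ≤ (3 * s) ^ 2 := fun X hX =>
    (nsq_triangle hs.le (by positivity) hPX hX).trans (by nlinarith)
  have key := annular_barrier hσ0 hσ1 (U := U) (P := P) (r := s) (R := 7 / 5 * s) (μ := μ)
    (K := {X : Pt n | nsq P X ≤ (7 / 5 * s) ^ 2 ∧ X₀.2 ≤ X.2})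
    (O := {X : Pt n | nsq P X < (7 / 5 * s) ^ 2 ∧ X₀.2 < X.2}) hs (by positivity) hμ
    (isCompact_of_nsq_le ((isClosed_le (continuous_nsq P) continuous_const).inter
      (isClosed_le continuous_const continuous_snd)) fun X hX => hX.1)
    (fun X hX => (hU X (hball X hX.1)).1.smooth.continuousAt.continuousWithinAt) ?_
    (by simp only [hP]; linarith)
    ((isOpen_lt (continuous_nsq P) continuous_const).inter (isOpen_lt continuous_const
      continuous_snd)) (fun X hX => ⟨hX.1.le, hX.2.le⟩) ?_
    (fun X hX => (hU X (hball X hX.1.le)).1)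
  · intro X hX
    have h1 := abs_le.1 (abs_snd_sub_le (by positivity) hX)
    have hPX1 : nsq P (X₀.1, X₀.2 + s / 8) ≤ (9 / 8 * s) ^ 2 := by
      simp only [nsq, hP, sub_self, norm_zero]; nlinarith
    have h2 := nsq_triangle (by positivity) (by positivity) hPX1 hX
    have h3 : nsq P X ≤ 25 / 16 * s ^ 2 := h2.trans (by nlinarith)
    refine le_trans ?_ (key X ⟨h3.trans (by nlinarith), by simp only at h1; linarith⟩)
    have h4 : 0 < nsq P X := nsq_pos fun h => by
      rw [h] at h1; simp only [hP] at h1; linarith [h1.1]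
    have h5 : ((25 / 16 * s ^ 2) ^ (n + 1))⁻¹ ≤ (nsq P X ^ (n + 1))⁻¹ :=
      inv_anti₀ (by positivity) (pow_le_pow_left₀ h4.le h3 _)
    have h6 : s ^ (2 * (n + 1)) * ((25 / 16 * s ^ 2) ^ (n + 1))⁻¹ = (16 / 25) ^ (n + 1) := by
      rw [pow_mul, ← inv_pow, ← mul_pow]; congr 1; field_simp
    have h7 : s ^ (2 * (n + 1)) * ((7 / 5 * s) ^ (2 * (n + 1)))⁻¹ = (25 / 49) ^ (n + 1) := by
      rw [pow_mul, pow_mul, ← inv_pow, ← mul_pow]; congr 1; field_simp; norm_num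
    rw [← h6, ← h7, ← mul_sub, ← mul_assoc]
    exact mul_le_mul_of_nonneg_left (by linarith) (by positivity)
  · intro X hX
    have h2 := hX.2
    refine ⟨by linarith, by simp only [hP]; linarith, ?_⟩
    unfold nsq
    simp only [hP]
    nlinarith [sq_nonneg ‖X.1 - X₀.1‖]
  · intro X hX hXO
    by_cases h1 : X₀.2 < X.2
    · left
      refine ⟨?_, (hU X (hball X hX.1)).2⟩
      by_contra h
      exact hXO ⟨not_le.1 h, h1⟩
    · right
      have h2 : X.2 = X₀.2 := le_antisymm (not_lt.1 h1) hX.2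
      have h3 : ‖X.1 - X₀.1‖ ≤ s := by
        refine le_of_abs_le (abs_le_of_sq_le_sq ?_ hs.le)
        have := hX.1
        simp only [nsq, hP, h2] at this
        nlinarith
      have := hdisc X.1 h3
      rwa [← h2] at this

lemma far_barrier (hσ0 : 0 < σ) (hσ1 : σ < 1) {U : Pt n → ℝ} {P : Pt n} {δ R μ : ℝ} (hδ : 0 < δ)
    (hδR : δ ≤ R) (hRt : 4 * R ≤ P.2) (hμ : 0 ≤ μ)
    (hU : ∀ X, nsq P X ≤ (2 * R) ^ 2 → HasL σ U X 0 ∧ 0 ≤ U X)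
    (hin : ∀ X, nsq P X ≤ δ ^ 2 → μ ≤ U X) :
    ∀ X, nsq P X ≤ (3 / 2 * R) ^ 2 →
      μ * (δ / R) ^ (2 * (n + 1)) * ((4 / 9) ^ (n + 1) - (1 / 4) ^ (n + 1)) ≤ U X := by
  have hR : 0 < R := hδ.trans_le hδR
  have key := annular_barrier hσ0 hσ1 (U := U) (P := P) (r := δ) (R := 2 * R) (μ := μ)
    (K := {X : Pt n | nsq P X ≤ (2 * R) ^ 2 ∧ δ ^ 2 ≤ nsq P X})
    (O := {X : Pt n | nsq P X < (2 * R) ^ 2 ∧ δ ^ 2 < nsq P X}) hδ (by positivity) hμ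
    (isCompact_of_nsq_le ((isClosed_le (continuous_nsq P) continuous_const).inter
      (isClosed_le continuous_const (continuous_nsq P))) fun X hX => hX.1)
    (fun X hX => (hU X hX.1).1.smooth.continuousAt.continuousWithinAt) ?_ (by linarith)
    ((isOpen_lt (continuous_nsq P) continuous_const).inter (isOpen_lt continuous_const
      (continuous_nsq P))) (fun X hX => ⟨hX.1.le, hX.2.le⟩) ?_
    (fun X hX => (hU X hX.1.le).1)
  · intro X hX
    have h8 : (1 / 4 : ℝ) ^ (n + 1) ≤ (4 / 9) ^ (n + 1) :=
      pow_le_pow_left₀ (by norm_num) (by norm_num) _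
    by_cases h1 : nsq P X ≤ δ ^ 2
    · refine le_trans ?_ (hin X h1)
      have h2 : (δ / R) ^ (2 * (n + 1)) ≤ 1 :=
        pow_le_one₀ (by positivity) ((div_le_one hR).2 hδR)
      have h3 : (4 / 9 : ℝ) ^ (n + 1) ≤ 1 := pow_le_one₀ (by norm_num) (by norm_num)
      have h4 : (0 : ℝ) ≤ (1 / 4) ^ (n + 1) := by positivity
      rw [mul_assoc]
      exact mul_le_of_le_one_right hμ (mul_le_one₀ h2 (by linarith) (by linarith))
    · have h2 := not_le.1 h1
      have h4 : 0 < nsq P X := lt_trans (by positivity) h2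
      refine le_trans ?_ (key X ⟨hX.trans (by nlinarith), h2.le⟩)
      have h5 : ((9 / 4 * R ^ 2) ^ (n + 1))⁻¹ ≤ (nsq P X ^ (n + 1))⁻¹ :=
        inv_anti₀ (by positivity) (pow_le_pow_left₀ h4.le (hX.trans (by nlinarith)) _)
      have h6 : δ ^ (2 * (n + 1)) * ((9 / 4 * R ^ 2) ^ (n + 1))⁻¹ =
          (δ / R) ^ (2 * (n + 1)) * (4 / 9) ^ (n + 1) := by
        rw [pow_mul, pow_mul, ← inv_pow, ← mul_pow, ← mul_pow]; congr 1; field_simp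
      have h7 : δ ^ (2 * (n + 1)) * ((2 * R) ^ (2 * (n + 1)))⁻¹ =
          (δ / R) ^ (2 * (n + 1)) * (1 / 4) ^ (n + 1) := by
        rw [pow_mul, pow_mul, pow_mul, ← inv_pow, ← mul_pow, ← mul_pow]; congr 1
        field_simp; norm_num
      rw [mul_assoc, mul_sub, ← h6, ← h7, ← mul_sub, ← mul_assoc]
      exact mul_le_mul_of_nonneg_left (by linarith) (by positivity)
  · intro X hX
    have h1 := abs_le.1 (abs_snd_sub_le (by positivity) hX.1)
    exact ⟨by linarith, by linarith, hX.2⟩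
  · intro X hX hXO
    by_cases h1 : nsq P X < (2 * R) ^ 2
    · right
      refine hin X ?_
      by_contra h
      exact hXO ⟨h1, not_le.1 h⟩
    · exact Or.inl ⟨not_lt.1 h1, (hU X hX.1).2⟩

set_option maxHeartbeats 1000000 in
/-- The interior Harnack inequality. -/
lemma harnack (n : ℕ) (hσ0 : 0 < σ) (hσ1 : σ < 1) : ∃ C : ℝ, 0 < C ∧
    ∀ (U : Pt n → ℝ) (A : Pt n) (R : ℝ), 0 < R → 8 * R ≤ A.2 →
      (∀ X, nsq A X ≤ (4 * R) ^ 2 → HasL σ U X 0 ∧ 0 ≤ U X) →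
      ∀ X, nsq A X ≤ (R / 2) ^ 2 → U X ≤ C * U A := by
  set N := n + 1 with hN
  set c₁ : ℝ := (16 / 25) ^ N - (25 / 49) ^ N with hc₁
  set c₂ : ℝ := (4 / 9) ^ N - (1 / 4) ^ N with hc₂
  have hc₁0 : 0 < c₁ := sub_pos.2 (pow_lt_pow_left₀ (by norm_num) (by norm_num) (by simp [hN]))
  have hc₂0 : 0 < c₂ := sub_pos.2 (pow_lt_pow_left₀ (by norm_num) (by norm_num) (by simp [hN]))
  set c₃ : ℝ := 1 / (8 * 4 ^ N * (n + 3)) with hc₃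
  have hc₃0 : 0 < c₃ := by positivity
  have hc₃1 : c₃ ≤ 1 / 24 := by
    refine one_div_le_one_div_of_le (by norm_num) ?_
    have h1 : (1 : ℝ) ≤ 4 ^ N := one_le_pow₀ (by norm_num)
    have h2 : (0 : ℝ) ≤ n := Nat.cast_nonneg n
    nlinarith
  set c : ℝ := 3 / 4 * c₁ * c₂ * (c₃ / 16) ^ (2 * N) * (1 / 2) ^ (2 * N) with hc
  have hc0 : 0 < c := by positivity
  refine ⟨c⁻¹, by positivity, fun U A R hR hA hU X hX => ?_⟩
  rw [inv_mul_eq_div, le_div_iff₀ hc0, mul_comm]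
  have hsq : Continuous fun Y : Pt n => R - Real.sqrt (nsq A Y) :=
    continuous_const.sub (continuous_nsq A).sqrt
  have hXR : nsq A X ≤ R ^ 2 := hX.trans (by nlinarith)
  have hsub : ∀ Y, nsq A Y ≤ R ^ 2 → nsq A Y ≤ (4 * R) ^ 2 := fun Y hY => hY.trans (by nlinarith)
  have hcp : IsCompact {Y : Pt n | nsq A Y ≤ R ^ 2} :=
    isCompact_of_nsq_le (isClosed_le (continuous_nsq A) continuous_const) fun Y hY => hY
  obtain ⟨X₀, hX₀, hmax⟩ := hcp.exists_isMaxOn ⟨X, hXR⟩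
    (f := fun Y => U Y * (R - Real.sqrt (nsq A Y)) ^ (2 * N))
    (ContinuousOn.mul (fun Y hY => (hU Y (hsub Y hY)).1.smooth.continuousAt.continuousWithinAt)
      (hsq.pow _).continuousOn)
  have hUA : 0 ≤ U A := (hU A (by rw [nsq_self]; positivity)).2
  set M := U X₀ with hM
  set ρ := Real.sqrt (nsq A X₀) with hρ
  have hρR : ρ ≤ R := Real.sqrt_le_iff.2 ⟨hR.le, hX₀⟩
  have hρ0 : 0 ≤ ρ := Real.sqrt_nonneg _
  have hρsq : nsq A X₀ ≤ ρ ^ 2 := (Real.sq_sqrt (nsq_nonneg _ _)).ge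
  set d := R - ρ with hd
  have hM0 : 0 ≤ M := (hU X₀ (hsub _ hX₀)).2
  have h1 : U X * (R / 2) ^ (2 * N) ≤ M * d ^ (2 * N) := by
    refine le_trans ?_ (hmax hXR)
    refine mul_le_mul_of_nonneg_left (pow_le_pow_left₀ (by positivity) ?_ _) (hU X (hsub X hXR)).2
    have : Real.sqrt (nsq A X) ≤ R / 2 := Real.sqrt_le_iff.2 ⟨by positivity, hX⟩
    linarith
  rcases (show 0 ≤ d by linarith).eq_or_lt with hd0 | hd0
  · rw [← hd0, zero_pow (by simp [hN]), mul_zero] at h1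
    have : U X ≤ 0 := le_of_not_gt fun h => absurd h1 (not_le.2 (by positivity))
    nlinarith
  set D := d / 2 with hD
  have hD0 : 0 < D := by positivity
  have hX₀t := abs_le.1 (abs_snd_sub_le hρ0 hρsq)
  have hballD : ∀ Y, nsq X₀ Y ≤ D ^ 2 → nsq A Y ≤ (R - D) ^ 2 := fun Y hY =>
    (nsq_triangle hρ0 hD0.le hρsq hY).trans (le_of_eq (by rw [hD, hd]; ring))
  have hballD' : ∀ Y, nsq X₀ Y ≤ D ^ 2 → nsq A Y ≤ R ^ 2 := fun Y hY =>
    (hballD Y hY).trans (pow_le_pow_left₀ (by linarith) (by linarith) 2)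
  have hbd : ∀ Y, nsq X₀ Y ≤ D ^ 2 → HasL σ U Y 0 ∧ 0 ≤ U Y ∧ U Y ≤ 4 ^ N * M := by
    intro Y hY
    have h2 := hU Y (hsub Y (hballD' Y hY))
    refine ⟨h2.1, h2.2, ?_⟩
    have h3 : Real.sqrt (nsq A Y) ≤ R - D :=
      Real.sqrt_le_iff.2 ⟨by linarith, hballD Y hY⟩
    have h4 : U Y * D ^ (2 * N) ≤ M * d ^ (2 * N) := by
      refine le_trans ?_ (hmax (hballD' Y hY))
      exact mul_le_mul_of_nonneg_left (pow_le_pow_left₀ hD0.le (by linarith) _) h2.2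
    have h5 : d ^ (2 * N) = 4 ^ N * D ^ (2 * N) := by
      rw [pow_mul, pow_mul, ← mul_pow]; congr 1; rw [hD]; ring
    rw [h5, ← mul_assoc] at h4
    have := le_of_mul_le_mul_right h4 (by positivity)
    linarith
  set s := c₃ * D with hs
  have hs0 : 0 < s := by positivity
  have hsD : s ≤ D / 24 := by rw [hs]; nlinarith
  have hdisc : ∀ y, ‖y - X₀.1‖ ≤ s → 3 / 4 * M ≤ U (y, X₀.2) := by
    intro y hy
    rw [norm_sub_rev] at hy
    refine le_trans ?_ (horizontal_lower hσ0 hσ1 hD0 (by linarith) (by positivity) hbd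
      (hy.trans (by linarith)))
    have h2 : 4 ^ N * M * (2 * (n + 3)) * ‖X₀.1 - y‖ / D ≤ 4 ^ N * M * (2 * (n + 3)) * s / D := by
      gcongr
    have h3 : 4 ^ N * M * (2 * (n + 3)) * s / D = M / 4 := by
      rw [hs, hc₃]; field_simp; ring
    linarith
  have hlens := lens_barrier hσ0 hσ1 hs0 (by linarith) (by positivity)
    (fun Y hY => ⟨(hbd Y (hY.trans (by nlinarith))).1, (hbd Y (hY.trans (by nlinarith))).2.1⟩) hdisc
  set X₁ : Pt n := (X₀.1, X₀.2 + s / 8) with hX₁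
  have hAX₁ : nsq A X₁ ≤ (ρ + s / 8) ^ 2 := nsq_triangle hρ0 (by positivity) hρsq (by
    simp [nsq, hX₁])
  have hfar := far_barrier hσ0 hσ1 (P := X₁) (δ := s / 8) (R := R) (μ := 3 / 4 * M * c₁)
    (by positivity) (by linarith) (by simp only [hX₁]; linarith) (by positivity)
    (fun Y hY => hU Y ((nsq_triangle (by positivity) (by positivity) hAX₁ hY).trans
      (pow_le_pow_left₀ (by positivity) (by linarith) 2))) hlens A
    (by rw [nsq_comm]; exact hAX₁.trans (pow_le_pow_left₀ (by positivity) (by linarith) 2))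
  refine le_trans ?_ hfar
  have e1 : s / 8 / R = c₃ / 16 * (d / R) := by rw [hs, hD]; ring
  have e2 : U X * (1 / 2) ^ (2 * N) ≤ M * (d ^ (2 * N) / R ^ (2 * N)) := by
    rw [mul_div_assoc', le_div_iff₀ (by positivity), mul_assoc, ← mul_pow]
    refine le_trans (le_of_eq ?_) h1
    congr 2
    ring
  have e3 : (s / 8 / R) ^ (2 * N) = (c₃ / 16) ^ (2 * N) * (d ^ (2 * N) / R ^ (2 * N)) := by
    rw [e1, mul_pow, div_pow d R]
  calc c * U X = 3 / 4 * c₁ * c₂ * (c₃ / 16) ^ (2 * N) * (U X * (1 / 2) ^ (2 * N)) := by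
        rw [hc]; ring
    _ ≤ 3 / 4 * c₁ * c₂ * (c₃ / 16) ^ (2 * N) * (M * (d ^ (2 * N) / R ^ (2 * N))) :=
        mul_le_mul_of_nonneg_left e2 (by positivity)
    _ = 3 / 4 * M * c₁ * (s / 8 / R) ^ (2 * N) * c₂ := by rw [e3]; ring

/-! ### Comparing interior values with boundary values -/

lemma gdot_snd_fst {f g : Pt n → ℝ} {X : Pt n} {a : ℝ} {l : EuclideanSpace ℝ (Fin n) →L[ℝ] ℝ}
    (hf : HasFDerivAt f (a • ContinuousLinearMap.snd ℝ _ _) X)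
    (hg : HasFDerivAt g (l.comp (ContinuousLinearMap.fst ℝ _ _)) X) : gdot f g X = 0 := by
  simp [gdot, dt, hf.fderiv, hg.fderiv, ex]

lemma hasFDerivAt_snd_sq_add (c : ℝ) (X : Pt n) : HasFDerivAt (fun Y : Pt n => Y.2 ^ 2 + c)
    ((2 * X.2) • ContinuousLinearMap.snd ℝ (EuclideanSpace ℝ (Fin n)) ℝ) X := by
  have h2 : HasFDerivAt (fun Y : Pt n => Y.2) (ContinuousLinearMap.snd ℝ _ _) X := hasFDerivAt_snd
  refine ((h2.pow 2).add_const c).congr_fderiv ?_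
  ext v <;> simp

lemma hasFDerivAt_sub_normsq (c : ℝ) (p : EuclideanSpace ℝ (Fin n)) (X : Pt n) :
    HasFDerivAt (fun Y : Pt n => c - ‖Y.1 - p‖ ^ 2)
      (((-2 : ℝ) • innerSL ℝ (X.1 - p)).comp (ContinuousLinearMap.fst ℝ _ _)) X := by
  have h1 : HasFDerivAt (fun Y : Pt n => Y.1 - p) (ContinuousLinearMap.fst ℝ _ _) X :=
    hasFDerivAt_fst.sub_const _
  refine (h1.norm_sq.const_sub c).congr_fderiv ?_
  ext v <;> simp

lemma gdot_sub_normsq (c : ℝ) (p : EuclideanSpace ℝ (Fin n)) (X : Pt n) :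
    gdot (fun Y : Pt n => c - ‖Y.1 - p‖ ^ 2) (fun Y : Pt n => c - ‖Y.1 - p‖ ^ 2) X =
      4 * ‖X.1 - p‖ ^ 2 := by
  rw [← sum_inner_single, Finset.mul_sum]
  simp only [gdot, dt, (hasFDerivAt_sub_normsq c p X).fderiv, ex]
  simp only [ContinuousLinearMap.comp_apply, smul_apply, ContinuousLinearMap.coe_fst',
    innerSL_apply_apply, smul_eq_mul, inner_zero_right, mul_zero, add_zero]
  exact Finset.sum_congr rfl fun i _ => by ring

lemma column_barrier (hσ0 : 0 < σ) (hσ1 : σ < 1) {U : Pt n → ℝ}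
    {x₀ : EuclideanSpace ℝ (Fin n)} {w τ μ : ℝ} (hw : 0 < w) (hwτ : w ≤ τ) (hμ : 0 ≤ μ)
    (hc : ContinuousOn U (Cyl x₀ (w ^ 2) τ)) (h0 : ∀ X ∈ Cyl x₀ (w ^ 2) τ, 0 ≤ U X)
    (htop : ∀ X ∈ Cyl x₀ (w ^ 2) τ, X.2 = τ → μ ≤ U X)
    (hEq : ∀ X ∈ Cyl x₀ (w ^ 2) τ, 0 < X.2 → X.2 < τ → HasL σ U X 0)
    (hneu : ∀ x, ‖x - x₀‖ ^ 2 < w ^ 2 → ∃ g ≤ 0, Neu σ U x g) :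
    μ * (1 / 2) ^ (((n : ℝ) + 2) ^ 2 * (τ / w) ^ 2 / (4 * (1 - σ))) ≤ U (x₀, 0) := by
  have hτ : 0 < τ := hw.trans_le hwτ
  have hs1 : 0 < 1 - σ := by linarith
  set m : ℝ := ((n : ℝ) + 2) ^ 2 * (τ / w) ^ 2 / (4 * (1 - σ)) with hm
  have hm1 : 1 ≤ m := by
    rw [hm, le_div_iff₀ (by positivity)]
    have h1 : 1 ≤ (τ / w) ^ 2 := one_le_pow₀ ((one_le_div hw).2 hwτ)
    have h2 : (4 : ℝ) ≤ ((n : ℝ) + 2) ^ 2 := by nlinarith [Nat.cast_nonneg (α := ℝ) n]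
    nlinarith
  have hmτ : 4 * m * (1 - σ) / (2 * τ ^ 2) = ((n : ℝ) + 2) ^ 2 / (2 * w ^ 2) := by
    rw [hm]; field_simp
  set c : ℝ := μ / ((2 * τ ^ 2) ^ m * (w ^ 2) ^ 2) with hcdef
  have hc0 : 0 ≤ c := by positivity
  have hcm : c * ((2 * τ ^ 2) ^ m * (w ^ 2) ^ 2) = μ := by rw [hcdef]; field_simp
  have hfc : Continuous fun X : Pt n => (X.2 ^ 2 + τ ^ 2) ^ m :=
    Continuous.rpow_const (by fun_prop) fun _ => Or.inr (by linarith)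
  have := cyl_principle hσ0 hσ1 (x₀ := x₀) (ρ := w ^ 2) (τ := τ)
    (w := fun X => U X - c * ((X.2 ^ 2 + τ ^ 2) ^ m *
      ((w ^ 2 - ‖X.1 - x₀‖ ^ 2) * (w ^ 2 - ‖X.1 - x₀‖ ^ 2))))
    (hc.sub (Continuous.continuousOn (by fun_prop))) ?_ ?_ ?_ ?_ (x₀, 0)
    ⟨by simp; positivity, le_rfl, hτ.le⟩
  · refine le_trans (le_of_eq ?_) (sub_nonneg.1 this)
    have e : ((2 : ℝ) * τ ^ 2) ^ m * (1 / 2) ^ m = (τ ^ 2) ^ m := by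
      rw [← Real.mul_rpow (by positivity) (by positivity)]; congr 1; ring
    rw [← hcm]
    simp only [sub_self, norm_zero]
    rw [show (0 : ℝ) ^ 2 + τ ^ 2 = τ ^ 2 by ring, ← e]
    ring
  · intro X hX h
    have := h0 X hX
    simp [h, this]
  · intro X hX h
    have h1 := htop X hX h
    have h2 : (w ^ 2 - ‖X.1 - x₀‖ ^ 2) * (w ^ 2 - ‖X.1 - x₀‖ ^ 2) ≤ (w ^ 2) ^ 2 := by
      have := hX.1
      nlinarith [sq_nonneg ‖X.1 - x₀‖]
    have h3 : c * ((2 * τ ^ 2) ^ m * ((w ^ 2 - ‖X.1 - x₀‖ ^ 2) * (w ^ 2 - ‖X.1 - x₀‖ ^ 2))) ≤ μ := by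
      rw [← hcm]; gcongr
    rw [h, ← two_mul]
    linarith
  · intro X hX h1 h2 h3 _
    have hf0 : 0 < X.2 ^ 2 + τ ^ 2 := by positivity
    have Lf : HasL σ (fun Y : Pt n => Y.2 ^ 2 + τ ^ 2) X (4 * (1 - σ)) := (hasL_snd_sq h2).add_const _
    have Lv : HasL σ (fun Y : Pt n => w ^ 2 - ‖Y.1 - x₀‖ ^ 2) X (-(2 * n)) :=
      ((hasL_const (w ^ 2) X).sub (hasL_normsq x₀ X)).congr (fun _ => rfl) (by ring)
    have dv := hasFDerivAt_sub_normsq (w ^ 2) x₀ X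
    have df := hasFDerivAt_snd_sq_add (τ ^ 2) X
    have dv2 : HasFDerivAt (fun Y : Pt n => (w ^ 2 - ‖Y.1 - x₀‖ ^ 2) * (w ^ 2 - ‖Y.1 - x₀‖ ^ 2))
        (((-4 * (w ^ 2 - ‖X.1 - x₀‖ ^ 2)) • innerSL ℝ (X.1 - x₀)).comp
          (ContinuousLinearMap.fst ℝ _ _)) X := by
      refine (dv.mul dv).congr_fderiv ?_
      ext v <;> simp; ring
    have dfm : HasFDerivAt (fun Y : Pt n => (Y.2 ^ 2 + τ ^ 2) ^ m)
        ((m * (X.2 ^ 2 + τ ^ 2) ^ (m - 1) * (2 * X.2)) • ContinuousLinearMap.snd ℝ _ _) X := by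
      refine (df.rpow_const (Or.inl hf0.ne')).congr_fderiv ?_
      rw [smul_smul]
    have gf : gdot (fun Y : Pt n => Y.2 ^ 2 + τ ^ 2) (fun Y : Pt n => Y.2 ^ 2 + τ ^ 2) X =
        4 * X.2 ^ 2 := by
      simp [gdot, dt, df.fderiv, ex]; ring
    have L := (hEq X hX h2 h3).sub (((Lf.rpow hf0 m).mul (Lv.mul Lv)).const_mul c)
    refine ⟨_, ?_, L⟩
    rw [gdot_snd_fst dfm dv2, gf, gdot_sub_normsq]
    rw [zero_sub, neg_nonpos]
    refine mul_nonneg hc0 ?_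
    set F := (X.2 ^ 2 + τ ^ 2) ^ m with hF
    set v := w ^ 2 - ‖X.1 - x₀‖ ^ 2 with hv
    have hF0 : 0 ≤ F := by positivity
    have e1 : (X.2 ^ 2 + τ ^ 2) ^ (m - 1) = F / (X.2 ^ 2 + τ ^ 2) := by
      rw [Real.rpow_sub_one hf0.ne']
    have h4 : F * (((n : ℝ) + 2) ^ 2 / (2 * w ^ 2)) ≤ m * (X.2 ^ 2 + τ ^ 2) ^ (m - 1) * (4 * (1 - σ)) := by
      rw [← hmτ, e1]
      have : F * (1 / (2 * τ ^ 2)) ≤ F / (X.2 ^ 2 + τ ^ 2) := by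
        rw [mul_one_div]
        gcongr
        nlinarith
      calc F * (4 * m * (1 - σ) / (2 * τ ^ 2)) = (4 * m * (1 - σ)) * (F * (1 / (2 * τ ^ 2))) := by ring
        _ ≤ (4 * m * (1 - σ)) * (F / (X.2 ^ 2 + τ ^ 2)) :=
          mul_le_mul_of_nonneg_left this (by positivity)
        _ = _ := by ring
    have h5 : 0 ≤ m * (m - 1) * (X.2 ^ 2 + τ ^ 2) ^ (m - 2) * (4 * X.2 ^ 2) := by
      have : 0 ≤ m - 1 := by linarith
      positivity
    have h6 : 0 ≤ F * ((((n : ℝ) + 2) * v - 4 * w ^ 2) ^ 2 / (2 * w ^ 2)) := by positivity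
    have e2 : (((n : ℝ) + 2) * v - 4 * w ^ 2) ^ 2 / (2 * w ^ 2) =
        ((n : ℝ) + 2) ^ 2 / (2 * w ^ 2) * (v * v) - 4 * ((n : ℝ) + 2) * v + 8 * w ^ 2 := by
      field_simp; ring
    have h7 := mul_nonneg (sub_nonneg.2 h4) (mul_self_nonneg v)
    have h8 := mul_nonneg h5 (mul_self_nonneg v)
    rw [e2] at h6
    have e3 : ‖X.1 - x₀‖ ^ 2 = w ^ 2 - v := by rw [hv]; ring
    rw [e3]
    refine le_trans (add_nonneg (add_nonneg h6 h7) h8) (le_of_eq ?_)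
    ring
  · intro x hx _
    obtain ⟨g, hg, hN⟩ := hneu x hx
    have h1 : HasDerivAt (fun s : ℝ => (s + τ ^ 2) ^ m) (1 * m * (0 + τ ^ 2) ^ (m - 1)) 0 :=
      ((hasDerivAt_id 0).add_const (τ ^ 2)).rpow_const (Or.inl (by simp; positivity))
    have h2 := h1.mul_const ((w ^ 2 - ‖x - x₀‖ ^ 2) * (w ^ 2 - ‖x - x₀‖ ^ 2))
    have h3 : Neu σ (fun X : Pt n => (X.2 ^ 2 + τ ^ 2) ^ m *
      ((w ^ 2 - ‖X.1 - x₀‖ ^ 2) * (w ^ 2 - ‖X.1 - x₀‖ ^ 2))) x 0 :=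
      neu_of_hasDerivAt hσ1 h2 fun t _ => rfl
    exact ⟨g - c * 0, by simpa using hg, hN.sub (h3.const_mul c)⟩

lemma PSol.neu_nonpos (hσ0 : 0 < σ) {p : ℝ} {U : Pt n → ℝ} (h : PSol σ p U)
    {x : EuclideanSpace ℝ (Fin n)} (hx : x ≠ 0) (hx2 : ‖x‖ < 2) : ∃ g ≤ 0, Neu σ U x g := by
  refine ⟨_, ?_, h.neu x hx hx2⟩
  have h0 : 0 ≤ U (x, 0) := h.nonneg _ (by simp [nsq]; nlinarith [norm_nonneg x]) le_rfl
    fun h' => hx (congrArg Prod.fst h')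
  have := Real.rpow_nonneg h0 p
  rw [neg_nonpos]
  positivity

lemma interior_le_bdry (n : ℕ) (hσ0 : 0 < σ) (hσ1 : σ < 1) : ∃ C : ℝ, 0 < C ∧
    ∀ (p : ℝ) (U : Pt n → ℝ), PSol σ p U → ∀ X : Pt n, nsq 0 X ≤ 1 → 0 < X.2 →
      ∀ x : EuclideanSpace ℝ (Fin n), ‖x - X.1‖ ≤ X.2 / 32 → X.2 / 64 < ‖x‖ →
        U X ≤ C * U (x, 0) := by
  obtain ⟨C, hC, hH⟩ := harnack n hσ0 hσ1
  set a : ℝ := (1 / 2) ^ (((n : ℝ) + 2) ^ 2 * 64 ^ 2 / (4 * (1 - σ))) with ha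
  have ha0 : 0 < a := by positivity
  refine ⟨C / a, by positivity, fun p U hU X hX ht x hx hx0 => ?_⟩
  set t := X.2 with htdef
  have hX1 : ‖X.1‖ ≤ 1 := by
    have : ‖X.1‖ ^ 2 ≤ 1 ^ 2 := by
      simp only [nsq, Prod.fst_zero, sub_zero, Prod.snd_zero] at hX; nlinarith [sq_nonneg X.2]
    exact le_of_abs_le (abs_le_of_sq_le_sq this (by norm_num))
  have ht1 : t ≤ 1 := by
    have : t ^ 2 ≤ 1 ^ 2 := by
      simp only [nsq, Prod.fst_zero, sub_zero, Prod.snd_zero] at hX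
      nlinarith [sq_nonneg ‖X.1‖]
    exact le_of_abs_le (abs_le_of_sq_le_sq this (by norm_num))
  have hcyl : ∀ Y ∈ Cyl x ((t / 64) ^ 2) t, nsq 0 Y < 4 ∧ Y ≠ 0 := by
    intro Y hY
    have h1 : ‖Y.1 - x‖ ≤ t / 64 :=
      le_of_abs_le (abs_le_of_sq_le_sq hY.1 (by positivity))
    have h2 : ‖Y.1‖ ≤ 67 / 64 := by
      calc ‖Y.1‖ = ‖(Y.1 - x) + (x - X.1) + X.1‖ := by congr 1; abel
        _ ≤ ‖Y.1 - x‖ + ‖x - X.1‖ + ‖X.1‖ := norm_add₃_le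
        _ ≤ _ := by linarith
    constructor
    · simp only [nsq, Prod.fst_zero, sub_zero, Prod.snd_zero]
      have := hY.2.1
      have := hY.2.2
      nlinarith [norm_nonneg Y.1]
    · rintro rfl
      simp only [Prod.fst_zero, zero_sub, norm_neg] at h1
      linarith
  have htop : ∀ y : EuclideanSpace ℝ (Fin n), ‖y - x‖ ≤ t / 64 → U X ≤ C * U (y, t) := by
    intro y hy
    have hyX : ‖X.1 - y‖ ≤ 3 * t / 64 := by
      calc ‖X.1 - y‖ = ‖-((y - x) + (x - X.1))‖ := by congr 1; abel
        _ ≤ ‖y - x‖ + ‖x - X.1‖ := by rw [norm_neg]; exact norm_add_le _ _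
        _ ≤ _ := by linarith
    have hXy : nsq X (y, t) ≤ (3 * t / 64) ^ 2 := by
      rw [nsq_comm]
      simp only [nsq, ← htdef, sub_self]
      nlinarith [norm_nonneg (X.1 - y)]
    refine hH U (y, t) (t / 8) (by positivity) (by simp; linarith) (fun Z hZ => ?_) X ?_
    · have h1 : nsq 0 Z ≤ (1 + 3 * t / 64 + 4 * (t / 8)) ^ 2 :=
        nsq_triangle (by positivity) (by positivity)
          (nsq_triangle (by norm_num) (by positivity) (by simpa using hX) hXy) hZ
      have h2 : nsq 0 Z < 4 := h1.trans_lt (by nlinarith)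
      have h3 := abs_le.1 (abs_snd_sub_le (by positivity) hZ)
      have h4 : 0 < Z.2 := by simp only at h3; linarith
      exact ⟨hU.eq Z h2 h4, hU.nonneg Z h2.le h4.le fun h => by simp [h] at h4⟩
    · rw [nsq_comm]
      exact hXy.trans (by nlinarith)
  have := column_barrier hσ0 hσ1 (U := U) (x₀ := x) (w := t / 64) (τ := t) (μ := U X / C)
    (by positivity) (by linarith)
    (div_nonneg (hU.nonneg X (by linarith) ht.le fun h => by simp [htdef, h] at ht) hC.le)
    (hU.cont.mono fun Y hY => ⟨(hcyl Y hY).1.le, hY.2.1, (hcyl Y hY).2⟩)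
    (fun Y hY => hU.nonneg Y (hcyl Y hY).1.le hY.2.1 (hcyl Y hY).2)
    (fun Y hY h => by
      rw [div_le_iff₀' hC]
      have := htop Y.1 (le_of_abs_le (abs_le_of_sq_le_sq hY.1 (by positivity)))
      rwa [← h] at this)
    (fun Y hY h _ => hU.eq Y (hcyl Y hY).1 h)
    (fun y hy => by
      obtain ⟨h1, h2⟩ := hcyl (y, 0) ⟨hy.le, le_rfl, ht.le⟩
      refine hU.neu_nonpos hσ0 (fun h => h2 (by rw [h]; rfl)) ?_
      simp only [nsq, Prod.fst_zero, sub_zero, Prod.snd_zero] at h1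
      nlinarith [norm_nonneg y])
  rw [show t / (t / 64) = 64 by field_simp, ← ha, div_mul_eq_mul_div, div_le_iff₀ hC] at this
  rw [div_mul_eq_mul_div, le_div_iff₀ ha0]
  linarith

lemma exists_unit_add (hn : 0 < n) (x : EuclideanSpace ℝ (Fin n)) {s : ℝ} (hs : 0 ≤ s) :
    ∃ y, ‖y - x‖ = s ∧ ‖y‖ = ‖x‖ + s := by
  by_cases h : x = 0
  · refine ⟨EuclideanSpace.single ⟨0, hn⟩ s, ?_, ?_⟩ <;> simp [h, abs_of_nonneg hs]
  · have h0 : ‖x‖ ≠ 0 := norm_ne_zero_iff.2 h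
    refine ⟨x + (s / ‖x‖) • x, ?_, ?_⟩
    · rw [add_sub_cancel_left, norm_smul, Real.norm_of_nonneg (by positivity)]
      field_simp
    · rw [show x + (s / ‖x‖) • x = (1 + s / ‖x‖) • x by rw [add_smul, one_smul], norm_smul,
        Real.norm_of_nonneg (by positivity)]
      field_simp

/-- Every interior value is controlled by a boundary value at a comparable height. -/
lemma exists_interior_le_bdry (hn : 0 < n) (hσ0 : 0 < σ) (hσ1 : σ < 1) : ∃ C : ℝ, 0 < C ∧
    ∀ (p : ℝ) (U : Pt n → ℝ), PSol σ p U → ∀ X : Pt n, nsq 0 X ≤ 1 → 0 < X.2 →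
      ∃ x : EuclideanSpace ℝ (Fin n), ‖x - X.1‖ = X.2 / 32 ∧ ‖x‖ = ‖X.1‖ + X.2 / 32 ∧
        U X ≤ C * U (x, 0) := by
  obtain ⟨C, hC, h⟩ := interior_le_bdry n hσ0 hσ1
  refine ⟨C, hC, fun p U hU X hX ht => ?_⟩
  obtain ⟨y, h1, h2⟩ := exists_unit_add hn X.1 (s := X.2 / 32) (by positivity)
  exact ⟨y, h1, h2, h p U hU X hX ht y h1.le (by rw [h2]; have := norm_nonneg X.1; linarith)⟩

/-! ### Hölder continuity up to the boundary -/

lemma refl1_refl1 {e p : EuclideanSpace ℝ (Fin n)} (he : ‖e‖ = 1) (x : EuclideanSpace ℝ (Fin n)) :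
    refl1 e p (refl1 e p x) = x := by
  have h : ⟪e, refl1 e p x - p⟫ = -⟪e, x - p⟫ := by
    rw [refl1_sub, inner_sub_right, inner_smul_right, real_inner_self_eq_norm_sq, he]; ring
  rw [refl1, h, refl1, mul_neg, neg_smul]
  abel

lemma reflH_reflH {e p : EuclideanSpace ℝ (Fin n)} (he : ‖e‖ = 1) (X : Pt n) :
    reflH e p (reflH e p X) = X := by simp only [reflH, refl1_refl1 he]

lemma neu_hlin_snd_rpow (hσ1 : σ < 1) {e p x : EuclideanSpace ℝ (Fin n)} (h : 0 < ⟪e, x - p⟫) :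
    Neu σ (fun Y : Pt n => (⟪e, Y.1 - p⟫ ^ 2 + Y.2 ^ 2) ^ σ) x 0 := by
  have h1 : HasDerivAt (fun s : ℝ => ⟪e, x - p⟫ ^ 2 + s) 1 0 := (hasDerivAt_id 0).const_add _
  exact neu_of_hasDerivAt hσ1 (h1.rpow_const (p := σ) (Or.inl (by positivity))) fun _ _ => rfl

lemma refl_holder (hσ0 : 0 < σ) (hσ1 : σ < 1) (hq : 0 < (n : ℝ) - 2 * σ) {α M G ρ : ℝ}
    (hα0 : 0 < α) (hα1 : α < 1) (hασ : α < 2 * σ) (hM : 0 ≤ M) (hG : 0 ≤ G) (hρ : 0 < ρ)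
    (hρ1 : ρ ≤ 1) : ∃ D : ℝ, 0 ≤ D ∧ ∀ (U : Pt n → ℝ) (e p : EuclideanSpace ℝ (Fin n)), ‖e‖ = 1 →
      ContinuousOn U {X | nsq (p, 0) X ≤ ρ ^ 2 ∧ 0 ≤ X.2 ∧ X ≠ 0} →
      (∀ X, nsq (p, 0) X ≤ ρ ^ 2 → 0 ≤ X.2 → X ≠ 0 → |U X| ≤ M) →
      (∀ X, nsq (p, 0) X < ρ ^ 2 → 0 < X.2 → HasL σ U X 0) →
      (∀ x, nsq (p, 0) (x, 0) < ρ ^ 2 → x ≠ 0 → ∃ g, |g| ≤ G ∧ Neu σ U x g) →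
      ∀ X, nsq (p, 0) X ≤ ρ ^ 2 → 0 ≤ X.2 → 0 ≤ ⟪e, X.1 - p⟫ → X ≠ 0 → reflH e p X ≠ 0 →
        U X - U (reflH e p X) ≤ D * (nsq (p, 0) X + ⟪e, X.1 - p⟫ ^ α +
          ((⟪e, X.1 - p⟫ ^ 2 + X.2 ^ 2) ^ σ - X.2 ^ (2 * σ))) := by
  set c₁ : ℝ := 2 * M / ρ ^ 2 with hc₁
  set d : ℝ := (c₁ * (2 * n + 4) + 4 * σ * G) / (α * (1 - α)) with hd
  have hα1' : 0 < 1 - α := by linarith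
  have hc₁0 : 0 ≤ c₁ := by positivity
  have hd0 : 0 ≤ d := by positivity
  refine ⟨c₁ + d + 2 * G, by positivity, fun U e p he hUc hUM hUL hUN => ?_⟩
  set P : Pt n := (p, 0) with hP
  have hyc : Continuous fun X : Pt n => ⟪e, X.1 - p⟫ := by fun_prop
  have hφc : Continuous fun X : Pt n => c₁ * nsq P X + d * ⟪e, X.1 - p⟫ ^ α +
      2 * G * ((⟪e, X.1 - p⟫ ^ 2 + X.2 ^ 2) ^ σ - X.2 ^ (2 * σ)) := by
    have h1 : Continuous fun X : Pt n => ⟪e, X.1 - p⟫ ^ α := hyc.rpow_const fun _ => Or.inr hα0.le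
    have h2 : Continuous fun X : Pt n => (⟪e, X.1 - p⟫ ^ 2 + X.2 ^ 2) ^ σ :=
      Continuous.rpow_const (by fun_prop) fun _ => Or.inr hσ0.le
    have h3 : Continuous fun X : Pt n => X.2 ^ (2 * σ) :=
      continuous_snd.rpow_const fun _ => Or.inr (by positivity)
    have h4 := continuous_nsq P
    fun_prop
  have hT : ∀ X : Pt n, 0 ≤ X.2 → 0 ≤ (⟪e, X.1 - p⟫ ^ 2 + X.2 ^ 2) ^ σ - X.2 ^ (2 * σ) := by
    intro X hX
    rw [Real.rpow_mul hX, Real.rpow_two, sub_nonneg]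
    exact Real.rpow_le_rpow (by positivity) (by nlinarith [sq_nonneg ⟪e, X.1 - p⟫]) hσ0.le
  have hφ0 : ∀ X : Pt n, 0 ≤ X.2 → 0 ≤ ⟪e, X.1 - p⟫ → c₁ * nsq P X ≤ c₁ * nsq P X +
      d * ⟪e, X.1 - p⟫ ^ α + 2 * G * ((⟪e, X.1 - p⟫ ^ 2 + X.2 ^ 2) ^ σ - X.2 ^ (2 * σ)) := by
    intro X h1 h2
    have h3 := hT X h1
    have h4 := Real.rpow_nonneg h2 α
    have h5 : 0 ≤ d * ⟪e, X.1 - p⟫ ^ α := by positivity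
    have h6 := mul_nonneg (mul_nonneg zero_le_two hG) h3
    linarith
  have hR : ∀ X, reflH e p X = 0 ↔ X = reflH e p 0 := fun X =>
    ⟨fun h => by rw [← h, reflH_reflH he], fun h => by rw [h, reflH_reflH he]⟩
  have hnR : ∀ X, nsq P (reflH e p X) = nsq P X := fun X => nsq_reflH (P := P) he X
  have hdiff : ∀ X, nsq P X ≤ ρ ^ 2 → 0 ≤ X.2 → X ≠ 0 → X ≠ reflH e p 0 →
      U X - U (reflH e p X) ≤ 2 * M := by
    intro X h1 h2 h3 h4
    have h5 := abs_le.1 (hUM X h1 h2 h3)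
    have h6 := abs_le.1 (hUM (reflH e p X) (by rwa [hnR]) h2 (by rwa [Ne, hR]))
    linarith
  have hlt : ∀ X, nsq P X ≤ ρ ^ 2 → ⟪e, X.1 - p⟫ ≤ 1 := by
    intro X hX
    have h1 : ‖X.1 - p‖ ≤ ρ := by
      refine le_of_abs_le (abs_le_of_sq_le_sq ?_ hρ.le)
      simp only [nsq, hP, sub_zero] at hX
      nlinarith [sq_nonneg X.2]
    have h2 := real_inner_le_norm e (X.1 - p)
    rw [he, one_mul] at h2
    linarith
  have key := min_principle_sing hσ0 hσ1 hq
    (w := fun X => (c₁ * nsq P X + d * ⟪e, X.1 - p⟫ ^ α +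
      2 * G * ((⟪e, X.1 - p⟫ ^ 2 + X.2 ^ 2) ^ σ - X.2 ^ (2 * σ))) - (U X - U (reflH e p X)))
    (P := 0) (Q := reflH e p 0) (K := {X | nsq P X ≤ ρ ^ 2 ∧ 0 ≤ X.2 ∧ 0 ≤ ⟪e, X.1 - p⟫})
    (O := {X | nsq P X < ρ ^ 2 ∧ 0 < ⟪e, X.1 - p⟫}) rfl rfl ?_ ?_
    (fun X hX => hX.2.1)
    ((isOpen_lt (continuous_nsq P) continuous_const).inter (isOpen_lt continuous_const hyc))
    (fun Y hY ht => ⟨hY.1.le, ht, hY.2.le⟩) ⟨2 * M, ?_⟩ ?_ ?_ ?_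
  · intro X h1 h2 h3 h4 h5
    have h6 := key X ⟨h1, h2, h3⟩ h4 (by rwa [Ne, ← hR])
    have h7 := hT X h2
    have h8 := Real.rpow_nonneg h3 α
    have h9 := nsq_nonneg P X
    refine (sub_nonneg.1 h6).trans ?_
    rw [add_mul, add_mul, mul_add, mul_add, mul_add d, mul_add d, mul_add (2 * G), mul_add (2 * G)]
    have := mul_nonneg hc₁0 h7
    have := mul_nonneg hc₁0 h8
    have := mul_nonneg hd0 h7
    have := mul_nonneg hd0 h9
    have := mul_nonneg (mul_nonneg zero_le_two hG) h8
    have := mul_nonneg (mul_nonneg zero_le_two hG) h9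
    linarith
  · refine isCompact_of_nsq_le ?_ fun X hX => hX.1
    exact (isClosed_le (continuous_nsq P) continuous_const).inter
      ((isClosed_le continuous_const continuous_snd).inter (isClosed_le continuous_const hyc))
  · refine hφc.continuousOn.sub (ContinuousOn.sub ?_ ?_)
    · exact hUc.mono fun X hX => ⟨hX.1.1, hX.1.2.1, hX.2.1⟩
    · refine hUc.comp (continuous_reflH e p).continuousOn fun X hX => ⟨?_, hX.1.2.1, ?_⟩
      · rw [hnR]; exact hX.1.1
      · rw [Ne, hR]; exact hX.2.2
  · intro X hX h1 h2
    have h3 := hdiff X hX.1 hX.2.1 h1 h2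
    have h4 := hφ0 X hX.2.1 hX.2.2
    have h5 := mul_nonneg hc₁0 (nsq_nonneg P X)
    linarith
  · intro X hX h1 h2 hXO
    have h4 := hφ0 X hX.2.1 hX.2.2
    by_cases h : nsq P X < ρ ^ 2
    · have h5 : ⟪e, X.1 - p⟫ = 0 := le_antisymm (not_lt.1 fun h' => hXO ⟨h, h'⟩) hX.2.2
      have h6 : reflH e p X = X := by rw [reflH, refl1_of_eq h5]
      have h7 := mul_nonneg hc₁0 (nsq_nonneg P X)
      rw [h6]
      linarith
    · have h5 : nsq P X = ρ ^ 2 := le_antisymm hX.1 (not_lt.1 h)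
      have h3 := hdiff X hX.1 hX.2.1 h1 h2
      have h6 : c₁ * nsq P X = 2 * M := by rw [h5, hc₁]; field_simp
      linarith
  · rintro X hX ⟨hX1, hy⟩ ht _
    have L1 := hasL_nsq (σ := σ) P X
    have L2 := hasL_hlin_rpow (σ := σ) he hy α
    have L3 := hasL_hlin_snd_rpow (σ := σ) (p := p) he ht
    have L4 := (hUL (reflH e p X) (by rwa [hnR]) ht).comp_reflH he
    refine ⟨_, ?_, (((L1.const_mul c₁).add (L2.const_mul d)).add
      ((L3.sub (hasL_snd_rpow_two_mul ht)).const_mul (2 * G))).sub ((hUL X hX1 ht).sub L4)⟩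
    set y := ⟪e, X.1 - p⟫ with hydef
    have hy1 : y ≤ 1 := hlt X hX.1
    have h1 : (y ^ 2 + X.2 ^ 2) ^ (σ - 1) ≤ y ^ (α - 2) := by
      calc (y ^ 2 + X.2 ^ 2) ^ (σ - 1) ≤ (y ^ 2) ^ (σ - 1) :=
            Real.rpow_le_rpow_of_nonpos (by positivity) (by nlinarith) (by linarith)
        _ = y ^ (2 * (σ - 1)) := by rw [Real.rpow_mul hy.le, Real.rpow_two]
        _ ≤ y ^ (α - 2) := Real.rpow_le_rpow_of_exponent_ge hy hy1 (by linarith)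
    have h2 : 1 ≤ y ^ (α - 2) := Real.one_le_rpow_of_pos_of_le_one_of_nonpos hy hy1 (by linarith)
    have h3 : d * (α * (α - 1) * y ^ (α - 2)) = -((c₁ * (2 * n + 4) + 4 * σ * G) * y ^ (α - 2)) := by
      rw [hd]; field_simp; ring
    have h4 : c₁ * (2 * n + 2 + 2 * (1 - 2 * σ) * (X.2 - P.2) / X.2) ≤ c₁ * (2 * n + 4) := by
      refine mul_le_mul_of_nonneg_left ?_ hc₁0
      rw [hP, sub_zero, mul_div_cancel_right₀ _ ht.ne']
      linarith
    have h5 := mul_le_mul_of_nonneg_left h1 (by positivity : 0 ≤ 4 * σ * G)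
    have h6 := mul_le_mul_of_nonneg_left h2 (by positivity : 0 ≤ c₁ * (2 * (n : ℝ) + 4))
    rw [h3]
    linarith
  · intro x hx hxO hx1 hx2 _
    obtain ⟨hxρ, hy⟩ := hxO
    obtain ⟨g₁, hg₁, hN₁⟩ := hUN x hxρ fun h => hx1 (by rw [h]; rfl)
    obtain ⟨g₂, hg₂, hN₂⟩ := hUN (refl1 e p x)
      (by rw [show ((refl1 e p x, (0 : ℝ)) : Pt n) = reflH e p (x, 0) from rfl, hnR]; exact hxρ)
      fun h => hx2 ((hR _).1 (by rw [reflH, h]; rfl))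
    have N1 := neu_nsq hσ1 (P := P) rfl x
    have N2 : Neu σ (fun Y : Pt n => ⟪e, Y.1 - p⟫ ^ α) x 0 := neu_of_forall_eq fun _ _ => rfl
    have N3 := neu_hlin_snd_rpow hσ1 hy
    have N4 : Neu σ (fun Y => U (reflH e p Y)) x g₂ := hN₂
    refine ⟨_, ?_, (((N1.const_mul c₁).add (N2.const_mul d)).add
      ((N3.sub (neu_rpow_two_mul hσ0 x)).const_mul (2 * G))).sub (hN₁.sub N4)⟩
    have h1 := abs_le.1 hg₁
    have h2 := abs_le.1 hg₂
    linarith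

lemma PSol.holder (hσ0 : 0 < σ) (hσ1 : σ < 1) (hq : 0 < (n : ℝ) - 2 * σ) {p α M ρ : ℝ}
    (hp : 0 ≤ p) (hα0 : 0 < α) (hα1 : α < 1) (hασ : α < 2 * σ) (hM : 0 ≤ M) (hρ : 0 < ρ)
    (hρ1 : ρ ≤ 1) {U : Pt n → ℝ} (hU : PSol σ p U) : ∃ D : ℝ, 0 ≤ D ∧
      ∀ (x x' : EuclideanSpace ℝ (Fin n)) (t : ℝ), 0 ≤ t → (‖x - x'‖ / 2) ^ 2 + t ^ 2 ≤ ρ ^ 2 →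
      (∀ X, nsq (midpoint ℝ x x', 0) X ≤ ρ ^ 2 → 0 ≤ X.2 → X ≠ 0 → nsq 0 X < 4 ∧ U X ≤ M) →
      (x, t) ≠ (0 : Pt n) → (x', t) ≠ (0 : Pt n) →
      |U (x, t) - U (x', t)| ≤ D * ((‖x - x'‖ / 2) ^ 2 + t ^ 2 + (‖x - x'‖ / 2) ^ α +
        (‖x - x'‖ / 2) ^ (2 * σ)) := by
  obtain ⟨D, hD, H⟩ := refl_holder hσ0 hσ1 hq hα0 hα1 hασ hM
    (by positivity : 0 ≤ M ^ p / (2 * σ)) hρ hρ1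
  have one : ∀ (x x' : EuclideanSpace ℝ (Fin n)) (t : ℝ), 0 ≤ t →
      (‖x - x'‖ / 2) ^ 2 + t ^ 2 ≤ ρ ^ 2 →
      (∀ X, nsq (midpoint ℝ x x', 0) X ≤ ρ ^ 2 → 0 ≤ X.2 → X ≠ 0 → nsq 0 X < 4 ∧ U X ≤ M) →
      (x, t) ≠ (0 : Pt n) → (x', t) ≠ (0 : Pt n) →
      U (x, t) - U (x', t) ≤ D * ((‖x - x'‖ / 2) ^ 2 + t ^ 2 + (‖x - x'‖ / 2) ^ α +
        (‖x - x'‖ / 2) ^ (2 * σ)) := by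
    intro x x' t ht hd hb hx hx'
    by_cases hxx : x = x'
    · subst hxx
      rw [sub_self]
      positivity
    obtain ⟨e, he, h1, h2, h3⟩ := exists_refl hxx
    have e1 : nsq (midpoint ℝ x x', 0) (x, t) = (‖x - x'‖ / 2) ^ 2 + t ^ 2 := by
      simp only [nsq, h3, sub_zero]
    have e2 : reflH e (midpoint ℝ x x') (x, t) = (x', t) := by rw [reflH, h2]
    have := H U e (midpoint ℝ x x') he (hU.cont.mono fun X hX =>
        ⟨(hb X hX.1 hX.2.1 hX.2.2).1.le, hX.2.1, hX.2.2⟩)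
      (fun X a b c => by
        have h := hb X a b c
        rw [abs_of_nonneg (hU.nonneg X h.1.le b c)]
        exact h.2)
      (fun X a b => hU.eq X (hb X a.le b.le fun h => by simp [h] at b).1 b)
      (fun y a b => by
        have hy : ((y, 0) : Pt n) ≠ 0 := fun h => b (congrArg Prod.fst h)
        have h := hb (y, 0) a.le le_rfl hy
        have h0 := hU.nonneg (y, 0) h.1.le le_rfl hy
        refine ⟨_, ?_, hU.neu y b ?_⟩
        · rw [abs_neg, abs_of_nonneg (by positivity)]
          gcongr
          exact h.2
        · have h4 := h.1
          simp only [nsq, Prod.fst_zero, sub_zero, Prod.snd_zero] at h4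
          nlinarith [norm_nonneg y])
      (x, t) (by rw [e1]; exact hd) ht (by rw [h1]; positivity) hx (by rw [e2]; exact hx')
    rw [e1, e2, h1] at this
    refine this.trans (mul_le_mul_of_nonneg_left ?_ hD)
    have h5 : ((‖x - x'‖ / 2) ^ 2 + t ^ 2) ^ σ ≤ (‖x - x'‖ / 2) ^ (2 * σ) + t ^ (2 * σ) := by
      rw [Real.rpow_mul (by positivity), Real.rpow_mul ht, Real.rpow_two, Real.rpow_two]
      exact Real.rpow_add_le_add_rpow (by positivity) (by positivity) hσ0.le hσ1.le
    simp only
    linarith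
  refine ⟨D, hD, fun x x' t ht hd hb hx hx' => abs_le.2 ⟨?_, one x x' t ht hd hb hx hx'⟩⟩
  have := one x' x t ht (by rwa [norm_sub_rev]) (by rwa [midpoint_comm]) hx' hx
  rw [norm_sub_rev] at this
  linarith

lemma nsq_zero (X : Pt n) : nsq 0 X = ‖X.1‖ ^ 2 + X.2 ^ 2 := by simp [nsq]

/-- The trace of a solution that is bounded near the origin extends continuously. -/
lemma PSol.exists_tendsto (hσ0 : 0 < σ) (hσ1 : σ < 1) (hq : 0 < (n : ℝ) - 2 * σ) {p M r : ℝ}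
    (hp : 0 ≤ p) (hr : 0 < r) (hr1 : r ≤ 1) {U : Pt n → ℝ} (hU : PSol σ p U)
    (hb : ∀ X, nsq 0 X ≤ r ^ 2 → 0 ≤ X.2 → X ≠ 0 → U X ≤ M) :
    ∃ L, Tendsto (fun x => U (x, 0)) (𝓝[≠] 0) (𝓝 L) := by
  rcases eq_or_neBot (𝓝[≠] (0 : EuclideanSpace ℝ (Fin n))) with hbot | hne
  · exact ⟨0, by rw [hbot]; exact tendsto_bot⟩
  obtain ⟨D, hD, H⟩ := hU.holder hσ0 hσ1 hq (α := σ) (M := max M 0) (ρ := r / 2) hp hσ0 hσ1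
    (by linarith) (le_max_right _ _) (by positivity) (by linarith)
  have hlim : Tendsto (fun h : ℝ => D * (h ^ 2 + h ^ σ + h ^ (2 * σ))) (𝓝 0) (𝓝 0) := by
    have hc : Continuous fun h : ℝ => D * (h ^ 2 + h ^ σ + h ^ (2 * σ)) := by
      have h1 : Continuous fun h : ℝ => h ^ σ := continuous_id.rpow_const fun _ => Or.inr hσ0.le
      have h2 : Continuous fun h : ℝ => h ^ (2 * σ) :=
        continuous_id.rpow_const fun _ => Or.inr (by positivity)
      fun_prop
    have := hc.tendsto 0
    rwa [Real.zero_rpow hσ0.ne', Real.zero_rpow (by positivity), zero_pow (by norm_num), add_zero,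
      add_zero, mul_zero] at this
  refine cauchy_map_iff_exists_tendsto.1 (Metric.cauchy_iff.2 ⟨inferInstance, fun ε hε => ?_⟩)
  obtain ⟨δ, hδ, hδε⟩ := Metric.eventually_nhds_iff.1 (hlim.eventually (gt_mem_nhds hε))
  set d := min δ (r / 4) with hd
  have hd0 : 0 < d := by positivity
  refine ⟨(fun x => U (x, 0)) '' (Metric.ball 0 d ∩ {0}ᶜ), image_mem_map
    (inter_mem (mem_nhdsWithin_of_mem_nhds (Metric.ball_mem_nhds 0 hd0)) self_mem_nhdsWithin), ?_⟩
  rintro _ ⟨x, ⟨hx, hx0⟩, rfl⟩ _ ⟨y, ⟨hy, hy0⟩, rfl⟩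
  rw [mem_ball_zero_iff] at hx hy
  have hxy : ‖x - y‖ / 2 < d := by linarith [norm_sub_le x y]
  have h0 : 0 ≤ ‖x - y‖ / 2 := by positivity
  have hdr : d ≤ r / 4 := min_le_right _ _
  have := H x y 0 le_rfl (by nlinarith) (fun X hX ht hX0 => ?_)
    (fun h => hx0 (congrArg Prod.fst h)) (fun h => hy0 (congrArg Prod.fst h))
  · rw [Real.dist_eq]
    refine this.trans_lt ?_
    have h1 := hδε (y := ‖x - y‖ / 2) (by
      rw [Real.dist_eq, sub_zero, abs_of_nonneg h0]; exact hxy.trans_le (min_le_left _ _))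
    simpa using h1
  · have hm : nsq (0 : Pt n) (midpoint ℝ x y, 0) ≤ (r / 4) ^ 2 := by
      rw [nsq_zero]
      have : ‖midpoint ℝ x y‖ ≤ r / 4 := by
        rw [midpoint_eq_smul_add, norm_smul]
        have := norm_add_le x y
        norm_num
        linarith
      simp only [ne_eq, OfNat.ofNat_ne_zero, not_false_eq_true, zero_pow, add_zero]
      exact pow_le_pow_left₀ (norm_nonneg _) this 2
    have h1 : nsq 0 X ≤ r ^ 2 := (nsq_triangle (by positivity) (by positivity) hm hX).trans
      (by nlinarith)
    exact ⟨by nlinarith, (hb X h1 ht hX0).trans (le_max_left _ _)⟩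

/-! ### The Neumann condition for the Kelvin transform -/

lemma tendsto_rpow_div_rpow {β : ℝ} (h : 2 * σ < β) :
    Tendsto (fun t : ℝ => t ^ β / t ^ (2 * σ)) (𝓝[>] 0) (𝓝 0) := by
  have h1 : Tendsto (fun t : ℝ => t ^ (β - 2 * σ)) (𝓝[>] 0) (𝓝 0) := by
    have := (Real.continuousAt_rpow_const 0 (β - 2 * σ) (Or.inr (by linarith))).tendsto
    rw [Real.zero_rpow (by linarith)] at this
    exact this.mono_left nhdsWithin_le_nhds
  refine h1.congr' ?_
  filter_upwards [self_mem_nhdsWithin] with t ht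
  rw [Real.rpow_sub ht]

lemma tendsto_of_quadratic_tangential (hσ0 : 0 < σ) (hσ1 : σ < 1) (hq : 0 < (n : ℝ) - 2 * σ)
    {p : ℝ} (hp : 0 ≤ p) {U : Pt n → ℝ} (hU : PSol σ p U) {x : EuclideanSpace ℝ (Fin n)}
    (hx : x ≠ 0) (hx2 : ‖x‖ < 2) {ξ : ℝ → EuclideanSpace ℝ (Fin n)} {s : ℝ → ℝ} {K : ℝ}
    (hK : 0 ≤ K) (hξ : ∀ t, 0 < t → ‖ξ t - x‖ / 2 ≤ K * t ^ 2)
    (hs : ∀ t, 0 < t → 0 < s t ∧ s t ≤ K * t) :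
    Tendsto (fun t => (U (ξ t, s t) - U (x, s t)) / t ^ (2 * σ)) (𝓝[>] 0) (𝓝 0) := by
  obtain ⟨ρ, hρ0, hρ1, hρ⟩ : ∃ ρ : ℝ, 0 < ρ ∧ ρ ≤ 1 ∧ ∀ X : Pt n, nsq (x, 0) X ≤ (2 * ρ) ^ 2 →
      nsq 0 X < 4 ∧ X ≠ 0 := by
    have hx0 : 0 < ‖x‖ := norm_pos_iff.2 hx
    refine ⟨min (min (‖x‖ / 4) ((2 - ‖x‖) / 4)) 1, by
      have : 0 < 2 - ‖x‖ := by linarith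
      positivity, min_le_right _ _, fun X hX => ?_⟩
    set ρ := min (min (‖x‖ / 4) ((2 - ‖x‖) / 4)) 1
    have h1 : ρ ≤ ‖x‖ / 4 := (min_le_left _ _).trans (min_le_left _ _)
    have h2 : ρ ≤ (2 - ‖x‖) / 4 := (min_le_left _ _).trans (min_le_right _ _)
    have hρ0 : 0 < ρ := by
      have : 0 < 2 - ‖x‖ := by linarith
      positivity
    have h3 : nsq (0 : Pt n) (x, 0) ≤ ‖x‖ ^ 2 := by rw [nsq_zero]; simp
    refine ⟨(nsq_triangle (norm_nonneg x) (by positivity) h3 hX).trans_lt (by nlinarith), ?_⟩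
    rintro rfl
    rw [nsq_comm, nsq_zero] at hX
    simp only at hX
    nlinarith
  have hcpt : IsCompact {X : Pt n | nsq (x, 0) X ≤ (2 * ρ) ^ 2 ∧ 0 ≤ X.2} :=
    isCompact_of_nsq_le ((isClosed_le (continuous_nsq _) continuous_const).inter
      (isClosed_le continuous_const continuous_snd)) fun X hX => hX.1
  obtain ⟨M, hM⟩ := (hcpt.image_of_continuousOn (hU.cont.mono fun X hX =>
    ⟨(hρ X hX.1).1.le, hX.2, (hρ X hX.1).2⟩)).bddAbove
  obtain ⟨α, hα1, hα2, hα3⟩ : ∃ α : ℝ, σ < α ∧ α < 1 ∧ α < 2 * σ := by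
    obtain ⟨α, h1, h2⟩ := exists_between (show σ < min 1 (2 * σ) from lt_min hσ1 (by linarith))
    exact ⟨α, h1, h2.trans_le (min_le_left _ _), h2.trans_le (min_le_right _ _)⟩
  obtain ⟨D, hD, H⟩ := hU.holder hσ0 hσ1 hq (α := α) (M := max M 0) (ρ := ρ) hp
    (by linarith) hα2 hα3 (le_max_right _ _) hρ0 hρ1
  have hlim : Tendsto (fun t : ℝ => D * (K ^ 2 * (t ^ (4 : ℝ) / t ^ (2 * σ)) +
      K ^ 2 * (t ^ (2 : ℝ) / t ^ (2 * σ)) + K ^ α * (t ^ (2 * α) / t ^ (2 * σ)) +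
      K ^ (2 * σ) * (t ^ (4 * σ) / t ^ (2 * σ)))) (𝓝[>] 0) (𝓝 0) := by
    have h4 := (tendsto_rpow_div_rpow (σ := σ) (β := 4) (by linarith)).const_mul (K ^ 2)
    have h2 := (tendsto_rpow_div_rpow (σ := σ) (β := 2) (by linarith)).const_mul (K ^ 2)
    have ha := (tendsto_rpow_div_rpow (σ := σ) (β := 2 * α) (by linarith)).const_mul (K ^ α)
    have hb := (tendsto_rpow_div_rpow (σ := σ) (β := 4 * σ) (by linarith)).const_mul (K ^ (2 * σ))
    have := (((h4.add h2).add ha).add hb).const_mul D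
    simpa only [mul_zero, add_zero] using this
  refine squeeze_zero_norm' ?_ hlim
  have hev : ∀ᶠ t : ℝ in 𝓝[>] 0, (K * t ^ 2) ^ 2 + (K * t) ^ 2 ≤ ρ ^ 2 := by
    have hc : Continuous fun t : ℝ => (K * t ^ 2) ^ 2 + (K * t) ^ 2 := by fun_prop
    have := hc.tendsto 0
    simp only [ne_eq, OfNat.ofNat_ne_zero, not_false_eq_true, zero_pow, mul_zero, add_zero] at this
    filter_upwards [(this.eventually (gt_mem_nhds (show (0 : ℝ) < ρ ^ 2 by positivity))).filter_mono
      nhdsWithin_le_nhds] with t ht using ht.le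
  filter_upwards [hev, self_mem_nhdsWithin] with t hρt ht
  have ht0 : 0 < t := ht
  obtain ⟨hs0, hsK⟩ := hs t ht
  have hξt := hξ t ht
  have hh0 : 0 ≤ ‖ξ t - x‖ / 2 := by positivity
  set h := ‖ξ t - x‖ / 2 with hh
  have hh2 : h ^ 2 ≤ (K * t ^ 2) ^ 2 := pow_le_pow_left₀ hh0 hξt 2
  have hs2 : s t ^ 2 ≤ (K * t) ^ 2 := pow_le_pow_left₀ hs0.le hsK 2
  have hne : ∀ y : EuclideanSpace ℝ (Fin n), (y, s t) ≠ (0 : Pt n) := fun y h' =>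
    hs0.ne' (congrArg Prod.snd h')
  have key := H (ξ t) x (s t) hs0.le (by
    rw [← hh]; linarith) (fun X hX hX0 hX1 => by
    have h1 : nsq (x, (0 : ℝ)) (midpoint ℝ (ξ t) x, 0) ≤ ρ ^ 2 := by
      have : ‖midpoint ℝ (ξ t) x - x‖ = h := by
        rw [← dist_eq_norm, dist_midpoint_right, dist_eq_norm, hh]; norm_num; ring
      simp only [nsq, this]
      nlinarith [sq_nonneg (K * t)]
    have h2 : nsq (x, 0) X ≤ (2 * ρ) ^ 2 := (nsq_triangle hρ0.le hρ0.le h1 hX).trans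
      (le_of_eq (by ring))
    exact ⟨(hρ X h2).1, (hM ⟨X, ⟨h2, hX0⟩, rfl⟩).trans (le_max_left _ _)⟩) (hne _) (hne _)
  have ha : h ^ α ≤ K ^ α * t ^ (2 * α) := by
    rw [Real.rpow_mul ht0.le, Real.rpow_two, ← Real.mul_rpow hK (by positivity)]
    exact Real.rpow_le_rpow hh0 hξt (by linarith)
  have hb : h ^ (2 * σ) ≤ K ^ (2 * σ) * t ^ (4 * σ) := by
    rw [show 4 * σ = 2 * (2 * σ) by ring, Real.rpow_mul ht0.le 2, Real.rpow_two,
      ← Real.mul_rpow hK (by positivity)]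
    exact Real.rpow_le_rpow hh0 hξt (by linarith)
  have e4 : t ^ (4 : ℝ) = t ^ 4 := by norm_cast
  rw [norm_div, Real.norm_eq_abs, Real.norm_of_nonneg (Real.rpow_nonneg ht0.le _),
    div_le_iff₀ (Real.rpow_pos_of_pos ht0 _)]
  refine key.trans (le_trans (mul_le_mul_of_nonneg_left (b := h ^ 2 + s t ^ 2 + h ^ α + h ^ (2 * σ))
    (c := K ^ 2 * t ^ (4 : ℝ) + K ^ 2 * t ^ (2 : ℝ) + K ^ α * t ^ (2 * α) + K ^ (2 * σ) * t ^ (4 * σ))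
    ?_ hD) (le_of_eq ?_))
  · rw [e4, Real.rpow_two]
    nlinarith
  · have := (Real.rpow_pos_of_pos ht0 (2 * σ)).ne'
    field_simp

lemma inv1_bdry (z y : EuclideanSpace ℝ (Fin n)) (l t : ℝ) : inv1 (z, 0) l (y, t) =
    ((l ^ 2 * (‖y - z‖ ^ 2 + t ^ 2)⁻¹) • (y - z) + z, l ^ 2 * (‖y - z‖ ^ 2 + t ^ 2)⁻¹ * t) := by
  simp [inv1, nsq]

lemma PSol.neu_kelvin (hσ0 : 0 < σ) (hσ1 : σ < 1) (hq : 0 < (n : ℝ) - 2 * σ) {U : Pt n → ℝ}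
    (hU : PSol σ (((n : ℝ) + 2 * σ) / ((n : ℝ) - 2 * σ)) U) {l : ℝ} (hl : 0 < l)
    {z y : EuclideanSpace ℝ (Fin n)} (hyz : y ≠ z) (hx : inv1 (z, 0) l (y, 0) ≠ 0)
    (hx2 : nsq 0 (inv1 (z, 0) l (y, 0)) < 4) : Neu σ (kelvin σ (z, 0) l U) y
      (-(kelvin σ (z, 0) l U (y, 0) ^ (((n : ℝ) + 2 * σ) / ((n : ℝ) - 2 * σ)) / (2 * σ))) := by
  set p : ℝ := ((n : ℝ) + 2 * σ) / ((n : ℝ) - 2 * σ) with hp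
  set q : ℝ := (n : ℝ) - 2 * σ with hqd
  have hp0 : 0 ≤ p := by positivity
  have hyz0 : 0 < ‖y - z‖ := norm_pos_iff.2 (sub_ne_zero.2 hyz)
  set N₀ := ‖y - z‖ ^ 2 with hN₀
  have hN0 : 0 < N₀ := by positivity
  set N : ℝ → ℝ := fun t => N₀ + t ^ 2 with hN
  have hNt : ∀ t, N₀ ≤ N t := fun t => by simp only [hN]; nlinarith [sq_nonneg t]
  have hNp : ∀ t, 0 < N t := fun t => hN0.trans_le (hNt t)
  set ξ : ℝ → EuclideanSpace ℝ (Fin n) := fun t => (l ^ 2 * (N t)⁻¹) • (y - z) + z with hξ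
  set s : ℝ → ℝ := fun t => l ^ 2 * (N t)⁻¹ * t with hs
  set x := (l ^ 2 * N₀⁻¹) • (y - z) + z with hxd
  have hinv : ∀ t, inv1 (z, 0) l (y, t) = (ξ t, s t) := fun t => inv1_bdry z y l t
  have hinv0 : inv1 (z, 0) l (y, 0) = (x, 0) := by
    rw [inv1_bdry, mul_zero, show (0 : ℝ) ^ 2 = 0 by norm_num, add_zero]
  have hnsq : ∀ t, nsq (z, 0) (y, t) = N t := fun t => by simp [nsq, hN, hN₀]
  rw [hinv0] at hx hx2
  have hx' : x ≠ 0 := fun h => hx (by rw [h]; rfl)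
  have hx2' : ‖x‖ < 2 := by
    rw [nsq_zero] at hx2
    nlinarith [norm_nonneg x]
  set K : ℝ := l ^ 2 / N₀ ^ 2 * ‖y - z‖ + l ^ 2 / N₀ with hK
  have hK0 : 0 ≤ K := by positivity
  have hsp : ∀ t, 0 < t → 0 < s t := fun t ht =>
    mul_pos (mul_pos (by positivity) (inv_pos.2 (hNp t))) ht
  have hT1 := tendsto_of_quadratic_tangential hσ0 hσ1 hq hp0 hU hx' hx2' (ξ := ξ) (s := s) hK0
    (fun t ht => by
      have e1 : ξ t - x = (l ^ 2 * ((N t)⁻¹ - N₀⁻¹)) • (y - z) := by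
        simp only [hξ, hxd]
        rw [add_sub_add_right_eq_sub, ← sub_smul, mul_sub]
      have e2 : |l ^ 2 * ((N t)⁻¹ - N₀⁻¹)| ≤ l ^ 2 / N₀ ^ 2 * t ^ 2 := by
        have e3 : l ^ 2 * ((N t)⁻¹ - N₀⁻¹) = -(l ^ 2 * t ^ 2 / (N t * N₀)) := by
          have := (hNp t).ne'
          field_simp
          simp only [hN]; ring
        have hNN : 0 < N t * N₀ := mul_pos (hNp t) hN0
        rw [e3, abs_neg, abs_of_nonneg (by positivity), div_mul_eq_mul_div]
        refine div_le_div_of_nonneg_left (by positivity) (by positivity) ?_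
        rw [sq]
        exact mul_le_mul_of_nonneg_right (hNt t) hN0.le
      rw [e1, norm_smul, Real.norm_eq_abs]
      have h1 : |l ^ 2 * ((N t)⁻¹ - N₀⁻¹)| * ‖y - z‖ ≤ l ^ 2 / N₀ ^ 2 * t ^ 2 * ‖y - z‖ :=
        mul_le_mul_of_nonneg_right e2 hyz0.le
      have h2 : 0 ≤ l ^ 2 / N₀ * t ^ 2 := by positivity
      have h3 : 0 ≤ l ^ 2 / N₀ ^ 2 * t ^ 2 * ‖y - z‖ := by positivity
      rw [hK, add_mul]
      linarith)
    (fun t ht => by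
      refine ⟨hsp t ht, mul_le_mul_of_nonneg_right ?_ ht.le⟩
      have h1 : l ^ 2 * (N t)⁻¹ ≤ l ^ 2 / N₀ := by
        rw [div_eq_mul_inv]
        exact mul_le_mul_of_nonneg_left (inv_anti₀ hN0 (hNt t)) (by positivity)
      have h2 : 0 ≤ l ^ 2 / N₀ ^ 2 * ‖y - z‖ := by positivity
      linarith)
  have hNc : Continuous N := by fun_prop
  have hN00 : N 0 = N₀ := by simp [hN]
  have hNlim : Tendsto N (𝓝[>] 0) (𝓝 N₀) := by
    have := hNc.tendsto 0
    rw [hN00] at this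
    exact this.mono_left nhdsWithin_le_nhds
  have hratio : Tendsto (fun t => (l ^ 2 * (N t)⁻¹) ^ (2 * σ)) (𝓝[>] 0)
      (𝓝 ((l ^ 2 * N₀⁻¹) ^ (2 * σ))) :=
    ((hNlim.inv₀ hN0.ne').const_mul (l ^ 2)).rpow_const (Or.inr (by positivity))
  have hslim : Tendsto s (𝓝[>] 0) (𝓝[>] 0) := by
    refine tendsto_nhdsWithin_iff.2 ⟨?_, ?_⟩
    · have := ((hNlim.inv₀ hN0.ne').const_mul (l ^ 2)).mul
        (tendsto_id.mono_left nhdsWithin_le_nhds : Tendsto (fun t : ℝ => t) (𝓝[>] 0) (𝓝 0))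
      rwa [mul_zero] at this
    · filter_upwards [self_mem_nhdsWithin] with t ht using hsp t ht
  have hT2 := ((hU.neu x hx' hx2').comp hslim).mul hratio
  have hT3 : Tendsto (fun t => (U (ξ t, s t) - U (x, 0)) / t ^ (2 * σ)) (𝓝[>] 0)
      (𝓝 (-(U (x, 0) ^ p / (2 * σ)) * (l ^ 2 * N₀⁻¹) ^ (2 * σ))) := by
    have := hT1.add hT2
    rw [zero_add] at this
    refine this.congr' ?_
    filter_upwards [self_mem_nhdsWithin] with t ht
    have ht0 : (0 : ℝ) < t := ht
    have hc : 0 < l ^ 2 * (N t)⁻¹ := mul_pos (by positivity) (inv_pos.2 (hNp t))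
    have e : s t ^ (2 * σ) = (l ^ 2 * (N t)⁻¹) ^ (2 * σ) * t ^ (2 * σ) :=
      Real.mul_rpow hc.le ht0.le
    have h1 := (Real.rpow_pos_of_pos hc (2 * σ)).ne'
    have h2 := (Real.rpow_pos_of_pos ht0 (2 * σ)).ne'
    simp only [Function.comp_apply, e]
    generalize (l ^ 2 * (N t)⁻¹) ^ (2 * σ) = r at h1 ⊢
    generalize t ^ (2 * σ) = τ at h2 ⊢
    rw [mul_comm r τ, ← div_div, div_mul_cancel₀ _ h1, ← add_div]
    congr 1
    ring
  have hNr : Tendsto (fun t => N t ^ (-(q / 2))) (𝓝[>] 0) (𝓝 (N₀ ^ (-(q / 2)))) :=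
    hNlim.rpow_const (Or.inl hN0.ne')
  have hT4 := neu_nsq_rpow hσ1 (P := (z, 0)) rfl hyz (-(q / 2))
  have hT5 := ((hNr.mul hT3).add (hT4.const_mul (U (x, 0)))).const_mul (l ^ q)
  unfold Neu
  have e0 : kelvin σ (z, 0) l U (y, 0) = l ^ q * (N₀ ^ (-(q / 2)) * U (x, 0)) := by
    rw [kelvin, hinv0, hnsq, hN00]
  refine (hT5.congr' ?_).trans (le_of_eq ?_)
  · filter_upwards [self_mem_nhdsWithin] with t ht
    rw [e0]
    simp only [kelvin, hinv, hnsq, hN00]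
    ring
  · congr 1
    rw [e0]
    have hUx : 0 ≤ U (x, 0) := hU.nonneg _ hx2.le le_rfl hx
    have hpq : q * p = q + 4 * σ := by
      rw [hp, mul_div_cancel₀ _ hq.ne']
      rw [hqd]; ring
    have hA : (l ^ q * (N₀ ^ (-(q / 2)) * U (x, 0))) ^ p =
        l ^ q * l ^ (4 * σ) * (N₀ ^ (-(q / 2)) * N₀ ^ (-(2 * σ)) * U (x, 0) ^ p) := by
      rw [Real.mul_rpow (by positivity) (by positivity), Real.mul_rpow (by positivity) hUx,
        ← Real.rpow_mul hl.le, ← Real.rpow_mul hN0.le, hpq,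
        show -(q / 2) * p = -(q / 2) + -(2 * σ) by
          have : -(q / 2) * p = -((q * p) / 2) := by ring
          rw [this, hpq]; ring,
        Real.rpow_add hl, Real.rpow_add hN0]
    have hB : (l ^ 2 * N₀⁻¹) ^ (2 * σ) = l ^ (4 * σ) * N₀ ^ (-(2 * σ)) := by
      rw [Real.mul_rpow (by positivity) (by positivity), Real.inv_rpow hN0.le,
        ← Real.rpow_neg hN0.le, ← Real.rpow_two, ← Real.rpow_mul hl.le,
        show 2 * (2 * σ) = 4 * σ by ring]
    rw [hA, hB]
    ring

lemma dist_le_of_nsq_le {A X : Pt n} {r : ℝ} (hr : 0 ≤ r) (h : nsq A X ≤ r ^ 2) : dist X A ≤ r := by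
  rw [Prod.dist_eq, max_le_iff, dist_eq_norm, dist_eq_norm, Real.norm_eq_abs]
  exact ⟨norm_fst_sub_le hr h, abs_snd_sub_le hr h⟩

lemma eventually_eq_zero (hσ0 : 0 < σ) (hσ1 : σ < 1) {w : Pt n → ℝ} {Ω : Set (Pt n)}
    (hΩ : IsOpen Ω) (h : ∀ X ∈ Ω, 0 < X.2 ∧ HasL σ w X 0 ∧ 0 ≤ w X) {A : Pt n} (hA : A ∈ Ω)
    (hw : w A = 0) : ∀ᶠ X in 𝓝 A, w X = 0 := by
  obtain ⟨C, -, hC⟩ := harnack n hσ0 hσ1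
  obtain ⟨ε, hε, hb⟩ := Metric.isOpen_iff.1 hΩ A hA
  have hA2 := (h A hA).1
  set R := min (ε / 8) (A.2 / 8) with hR
  have hR0 : 0 < R := lt_min (by positivity) (by positivity)
  have hR1 : R ≤ ε / 8 := min_le_left _ _
  have hR2 : R ≤ A.2 / 8 := min_le_right _ _
  have hsub : ∀ X, nsq A X ≤ (4 * R) ^ 2 → X ∈ Ω := fun X hX => hb (by
    rw [Metric.mem_ball]
    exact (dist_le_of_nsq_le (by positivity) hX).trans_lt (by linarith))
  have hbd := hC w A R hR0 (by linarith) fun X hX => ⟨(h X (hsub X hX)).2.1, (h X (hsub X hX)).2.2⟩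
  have ho : {X : Pt n | nsq A X < (R / 2) ^ 2} ∈ 𝓝 A := by
    refine (isOpen_lt (continuous_nsq A) continuous_const).mem_nhds ?_
    simp only [Set.mem_ofPred_eq, nsq_self]
    positivity
  filter_upwards [ho] with X hX
  have hX' : nsq A X < (R / 2) ^ 2 := hX
  have h1 := hbd X hX'.le
  rw [hw, mul_zero] at h1
  exact le_antisymm h1 (h X (hsub X (hX'.le.trans (by
    apply pow_le_pow_left₀ (by positivity); linarith)))).2.2

/-- The strong maximum principle along a connected set. -/
lemma pos_of_isPreconnected (hσ0 : 0 < σ) (hσ1 : σ < 1) {w : Pt n → ℝ} {Ω S : Set (Pt n)}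
    (hΩ : IsOpen Ω) (h : ∀ X ∈ Ω, 0 < X.2 ∧ HasL σ w X 0 ∧ 0 ≤ w X) (hS : IsPreconnected S)
    (hSΩ : S ⊆ Ω) (hB : ∃ B ∈ S, 0 < w B) : ∀ A ∈ S, 0 < w A := by
  intro A hA
  by_contra hA0
  have hA0 : w A = 0 := le_antisymm (not_lt.1 hA0) (h A (hSΩ hA)).2.2
  have hc : ∀ X ∈ Ω, ContinuousAt w X := fun X hX => (h X hX).2.1.smooth.continuousAt
  obtain ⟨B, hB, hBp⟩ := hB
  have ho1 : IsOpen {X | ∀ᶠ Y in 𝓝 X, w Y = 0} := isOpen_setOfPred_eventually_nhds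
  have ho2 : IsOpen {X | ∀ᶠ Y in 𝓝 X, 0 < w Y} := isOpen_setOfPred_eventually_nhds
  obtain ⟨X, -, hX1, hX2⟩ := hS _ _ ho1 ho2 (fun X hX => by
      rcases (h X (hSΩ hX)).2.2.eq_or_lt with h0 | h0
      · exact Or.inl (eventually_eq_zero hσ0 hσ1 hΩ h (hSΩ hX) h0.symm)
      · exact Or.inr ((hc X (hSΩ hX)).eventually_const_lt h0))
    ⟨A, hA, eventually_eq_zero hσ0 hσ1 hΩ h (hSΩ hA) hA0⟩
    ⟨B, hB, (hc B (hSΩ hB)).eventually_const_lt hBp⟩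
  exact (hX2.self_of_nhds.ne') hX1.self_of_nhds

lemma convex_nsq_lt (c : ℝ) : Convex ℝ {X : Pt n | nsq 0 X < c} := by
  have h1 : ConvexOn ℝ Set.univ fun X : Pt n => ‖X.1‖ ^ 2 :=
    ((convexOn_univ_norm (E := EuclideanSpace ℝ (Fin n))).pow (fun _ _ => norm_nonneg _) 2).comp_linearMap
      (LinearMap.fst ℝ (EuclideanSpace ℝ (Fin n)) ℝ)
  have h2 : ConvexOn ℝ Set.univ fun X : Pt n => X.2 ^ 2 :=
    (even_two.convexOn_pow (𝕜 := ℝ)).comp_linearMap (LinearMap.snd ℝ (EuclideanSpace ℝ (Fin n)) ℝ)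
  have h3 := (h1.add h2).convex_lt c
  have e : {X : Pt n | nsq 0 X < c} =
      {X : Pt n | X ∈ Set.univ ∧ ‖X.1‖ ^ 2 + X.2 ^ 2 < c} := by
    ext X
    simp [nsq_zero]
  rw [e]
  exact h3

lemma cyl_subset {x₀ : EuclideanSpace ℝ (Fin n)} {w τ c r : ℝ} (hw : 0 ≤ w)
    (hx : ‖x₀‖ ≤ r) (h : (r + w) ^ 2 + τ ^ 2 ≤ c) :
    ∀ X ∈ Cyl x₀ (w ^ 2) τ, nsq 0 X ≤ c := by
  rintro X ⟨h1, h2, h3⟩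
  have h1' := le_of_abs_le (abs_le_of_sq_le_sq h1 hw)
  have h4 : ‖X.1‖ ≤ r + w := by
    have := norm_le_norm_add_norm_sub' X.1 x₀
    linarith
  rw [nsq_zero]
  have h5 : ‖X.1‖ ^ 2 ≤ (r + w) ^ 2 := pow_le_pow_left₀ (norm_nonneg _) h4 2
  have h6 : X.2 ^ 2 ≤ τ ^ 2 := pow_le_pow_left₀ h2 h3 2
  linarith

/-- Positivity at a boundary point from positivity above it. -/
lemma pos_bdry (hσ0 : 0 < σ) (hσ1 : σ < 1) {U : Pt n → ℝ}
    {x₀ : EuclideanSpace ℝ (Fin n)} {r : ℝ} (hr : 0 < r)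
    (hc : ContinuousOn U (Cyl x₀ (r ^ 2) r)) (h0 : ∀ X ∈ Cyl x₀ (r ^ 2) r, 0 ≤ U X)
    (hpos : ∀ X ∈ Cyl x₀ (r ^ 2) r, 0 < X.2 → 0 < U X)
    (hEq : ∀ X ∈ Cyl x₀ (r ^ 2) r, 0 < X.2 → X.2 < r → HasL σ U X 0)
    (hneu : ∀ x, ‖x - x₀‖ ^ 2 < r ^ 2 → ∃ g ≤ 0, Neu σ U x g) : 0 < U (x₀, 0) := by
  have hK : IsCompact (Cyl x₀ (r ^ 2) r ∩ {X : Pt n | X.2 = r}) :=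
    (isCompact_cyl x₀ (r ^ 2) r).inter_right (isClosed_eq continuous_snd continuous_const)
  have hne : (x₀, r) ∈ Cyl x₀ (r ^ 2) r ∩ {X : Pt n | X.2 = r} := by
    refine ⟨⟨?_, hr.le, le_rfl⟩, rfl⟩
    rw [sub_self, norm_zero]
    exact pow_le_pow_left₀ le_rfl hr.le 2
  obtain ⟨Z, hZ, hmin⟩ := hK.exists_isMinOn ⟨_, hne⟩ (hc.mono Set.inter_subset_left)
  have hZ0 : 0 < U Z := hpos Z hZ.1 (by rw [show Z.2 = r from hZ.2]; exact hr)
  have := column_barrier hσ0 hσ1 hr le_rfl hZ0.le hc h0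
    (fun X hX hX2 => isMinOn_iff.1 hmin X ⟨hX, hX2⟩) hEq hneu
  exact (mul_pos hZ0 (Real.rpow_pos_of_pos (by norm_num) _)).trans_le this

lemma PSol.pos (hσ0 : 0 < σ) (hσ1 : σ < 1) {p : ℝ} {U : Pt n → ℝ} (hU : PSol σ p U)
    (hne : ∃ B, nsq 0 B < 4 ∧ 0 < B.2 ∧ U B ≠ 0) :
    ∀ X, nsq 0 X < 4 → 0 ≤ X.2 → X ≠ 0 → 0 < U X := by
  have hEq : ∀ X, nsq 0 X < 4 → 0 < X.2 → 0 < U X := by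
    intro X h1 h2
    have hne0 : ∀ Y : Pt n, 0 < Y.2 → Y ≠ 0 := fun Y hY h => by simp [h] at hY
    set Ω : Set (Pt n) := {X | nsq 0 X < 4} ∩ {X | 0 < X.2}
    have hΩ : IsOpen Ω := (isOpen_lt (continuous_nsq 0) continuous_const).inter
      (isOpen_lt continuous_const continuous_snd)
    have hconv : Convex ℝ Ω := (convex_nsq_lt 4).inter
      (convex_halfSpace_gt (LinearMap.snd ℝ (EuclideanSpace ℝ (Fin n)) ℝ).isLinear 0)
    obtain ⟨B, hB1, hB2, hB3⟩ := hne
    have hn : ∀ X ∈ Ω, 0 ≤ U X := fun X hX => hU.nonneg X (le_of_lt hX.1) (le_of_lt hX.2) (hne0 X hX.2)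
    exact pos_of_isPreconnected hσ0 hσ1 hΩ (fun X hX => ⟨hX.2, hU.eq X hX.1 hX.2, hn X hX⟩)
      hconv.isPreconnected le_rfl ⟨B, ⟨hB1, hB2⟩, (hn B ⟨hB1, hB2⟩).lt_of_ne hB3.symm⟩ X ⟨h1, h2⟩
  intro X h1 h2 h3
  rcases h2.lt_or_eq with h2 | h2
  · exact hEq X h1 h2
  obtain ⟨x, t⟩ := X
  simp only at h2
  subst h2
  have hx : x ≠ 0 := fun h => h3 (by rw [h]; rfl)
  have hx0 : 0 < ‖x‖ := norm_pos_iff.2 hx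
  have hx2 : ‖x‖ < 2 := by
    rw [nsq_zero] at h1
    nlinarith
  set r := min (‖x‖ / 2) ((2 - ‖x‖) / 3) with hr
  have hr0 : 0 < r := lt_min (by positivity) (by linarith)
  have hr1 : r ≤ ‖x‖ / 2 := min_le_left _ _
  have hr2 : r ≤ (2 - ‖x‖) / 3 := min_le_right _ _
  have hsub : ∀ X ∈ Cyl x (r ^ 2) r, nsq 0 X < 4 := by
    intro X hX
    refine (cyl_subset hr0.le (r := ‖x‖) le_rfl le_rfl X hX).trans_lt ?_
    nlinarith
  have hn0 : ∀ X ∈ Cyl x (r ^ 2) r, X.1 ≠ 0 := by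
    rintro X ⟨hX, -⟩ h
    rw [h, zero_sub, norm_neg] at hX
    nlinarith
  have hn0' : ∀ X ∈ Cyl x (r ^ 2) r, X ≠ 0 := fun X hX h => hn0 X hX (by rw [h]; rfl)
  refine pos_bdry hσ0 hσ1 hr0 (hU.cont.mono fun X hX => ⟨(hsub X hX).le, hX.2.1, hn0' X hX⟩)
    (fun X hX => hU.nonneg X (hsub X hX).le hX.2.1 (hn0' X hX))
    (fun X hX h => hEq X (hsub X hX) h) (fun X hX h _ => hU.eq X (hsub X hX) h) fun y hy => ?_
  have hyC : (y, (0 : ℝ)) ∈ Cyl x (r ^ 2) r := ⟨hy.le, le_rfl, hr0.le⟩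
  refine hU.neu_nonpos hσ0 (hn0 _ hyC) ?_
  have := hsub _ hyC
  rw [nsq_zero] at this
  simp only at this
  nlinarith [norm_nonneg y]

lemma isClosed_half_sphere (c : ℝ) : IsCompact {X : Pt n | nsq 0 X = c ∧ 0 ≤ X.2} :=
  isCompact_of_nsq_le (P := 0) (C := c) ((isClosed_eq (continuous_nsq 0) continuous_const).inter
    (isClosed_le continuous_const continuous_snd)) fun _ hX => hX.1.le

lemma PSol.exists_lower_bound (hσ0 : 0 < σ) (hσ1 : σ < 1) (hq : 0 < (n : ℝ) - 2 * σ) {p : ℝ}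
    {U : Pt n → ℝ} (hU : PSol σ p U) (hpos : ∀ X, nsq 0 X < 4 → 0 ≤ X.2 → X ≠ 0 → 0 < U X) :
    ∃ m > 0, ∀ X, nsq 0 X ≤ 1 → 0 ≤ X.2 → X ≠ 0 → m ≤ U X := by
  have hK := isClosed_half_sphere (n := n) 1
  have hn0 : ∀ X : Pt n, nsq 0 X = 1 → X ≠ 0 := fun X h1 h => by simp [h, nsq_self] at h1
  obtain ⟨Z, hZ, hmin⟩ := hK.exists_isMinOn ⟨((0 : EuclideanSpace ℝ (Fin n)), (1 : ℝ)), by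
      simp [nsq_zero]⟩
    (hU.cont.mono fun X hX => ⟨hX.1.le.trans (by norm_num), hX.2, hn0 X hX.1⟩)
  refine ⟨U Z, hpos Z (hZ.1.trans_lt (by norm_num)) hZ.2 (hn0 Z hZ.1), ?_⟩
  refine min_principle_punctured hσ0 hσ1 hq (B := 0)
    (hU.cont.mono fun X hX => ⟨hX.1.trans (by norm_num), hX.2.1, hX.2.2⟩)
    (fun X h1 h2 h3 => by rw [neg_zero]; exact hU.nonneg X (h1.trans (by norm_num)) h2 h3)
    (fun X h1 h2 => isMinOn_iff.1 hmin X ⟨h1, h2⟩)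
    (fun X h1 h2 => hU.eq X (h1.trans (by norm_num)) h2) fun x h1 h2 => hU.neu_nonpos hσ0 h2 ?_
  rw [nsq_zero] at h1
  simp only at h1
  nlinarith [norm_nonneg x]

lemma exists_rpow_le_half_add_sq (hσ0 : 0 < σ) (hσ1 : σ < 1) {K : ℝ} (hK : 0 < K) :
    ∃ B : ℝ, 0 ≤ B ∧ ∀ t : ℝ, 0 ≤ t → K * t ^ (2 * σ) ≤ 1 / 2 + B * t ^ 2 := by
  set t₀ : ℝ := (1 / (2 * K)) ^ (1 / (2 * σ)) with ht₀
  have ht0 : 0 < t₀ := by positivity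
  have hpow : t₀ ^ (2 * σ) = 1 / (2 * K) := by
    rw [ht₀, ← Real.rpow_mul (by positivity), one_div_mul_cancel (by positivity), Real.rpow_one]
  refine ⟨K * t₀ ^ (2 * σ - 2), by positivity, fun t ht => ?_⟩
  rcases le_total t t₀ with h | h
  · have h1 : t ^ (2 * σ) ≤ 1 / (2 * K) := hpow ▸ Real.rpow_le_rpow ht h (by positivity)
    have h2 : K * t ^ (2 * σ) ≤ K * (1 / (2 * K)) := mul_le_mul_of_nonneg_left h1 hK.le
    have h3 : K * (1 / (2 * K)) = 1 / 2 := by field_simp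
    have : 0 ≤ K * t₀ ^ (2 * σ - 2) * t ^ 2 := by positivity
    linarith
  · have htp : 0 < t := ht0.trans_le h
    have h1 : t ^ (2 * σ) = t ^ (2 * σ - 2) * t ^ 2 := by
      rw [← Real.rpow_two, ← Real.rpow_add htp]; congr 1; ring
    have h2 : t ^ (2 * σ - 2) ≤ t₀ ^ (2 * σ - 2) :=
      Real.rpow_le_rpow_of_nonpos ht0 h (by linarith)
    rw [h1]
    have : K * (t ^ (2 * σ - 2) * t ^ 2) ≤ K * (t₀ ^ (2 * σ - 2) * t ^ 2) := by gcongr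
    linarith

/-- Comparison in a thin half-annulus, with a linear Neumann condition. -/
lemma narrow_principle (hσ0 : 0 < σ) (hσ1 : σ < 1) (hq : 0 < (n : ℝ) - 2 * σ) {C : ℝ}
    (hC : 0 ≤ C) : ∃ ε > 0, ∀ (Z : Pt n) (a b : ℝ) (w : Pt n → ℝ), Z.2 = 0 → b ≤ a + ε →
      ContinuousOn w {X | a ≤ nsq Z X ∧ nsq Z X ≤ b ∧ 0 ≤ X.2} →
      (∀ X, nsq Z X = a → 0 ≤ X.2 → 0 ≤ w X) → (∀ X, nsq Z X = b → 0 ≤ X.2 → 0 ≤ w X) →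
      (∀ X, a < nsq Z X → nsq Z X < b → 0 < X.2 → HasL σ w X 0) →
      (∀ x, a < nsq Z (x, 0) → nsq Z (x, 0) < b → w (x, 0) < 0 → ∃ g ≤ -C * w (x, 0), Neu σ w x g) →
      ∀ X, a ≤ nsq Z X → nsq Z X ≤ b → 0 ≤ X.2 → 0 ≤ w X := by
  obtain ⟨B, hB, hBt⟩ := exists_rpow_le_half_add_sq hσ0 hσ1 (K := C + 1) (by positivity)
  have hd : (0 : ℝ) < 2 * n + 4 - 4 * σ := by linarith
  set B' : ℝ := (4 * B * (1 - σ) + 1) / (2 * n + 4 - 4 * σ) with hB'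
  have hσ1' : 0 < 1 - σ := by linarith
  have hB'0 : 0 < B' := by positivity
  refine ⟨1 / (4 * B'), by positivity, fun Z a b w hZ hb hw hin hout hEq hneu => ?_⟩
  set φ : Pt n → ℝ := fun X => (B * X.2 ^ 2 - (C + 1) * X.2 ^ (2 * σ) - B' * nsq Z X) + (1 + B' * a)
    with hφ
  have hφpos : ∀ X : Pt n, nsq Z X ≤ b → 0 ≤ X.2 → 0 < φ X := by
    intro X h1 h2
    have h3 := hBt X.2 h2
    have h4 : B' * (nsq Z X - a) ≤ B' * (1 / (4 * B')) :=
      mul_le_mul_of_nonneg_left (by linarith) hB'0.le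
    have h5 : B' * (1 / (4 * B')) = 1 / 4 := by field_simp
    simp only [hφ]
    linarith
  have hφL : ∀ X : Pt n, 0 < X.2 → HasL σ φ X (-1) := by
    intro X hX
    refine ((((hasL_snd_sq hX).const_mul B).sub ((hasL_snd_rpow_two_mul hX).const_mul (C + 1))).sub
      ((hasL_nsq Z X).const_mul B')).add_const (1 + B' * a) |>.congr (fun _ => rfl) ?_
    rw [hZ, sub_zero, mul_div_cancel_right₀ _ hX.ne', hB']
    field_simp
    ring
  have hφN : ∀ x, Neu σ φ x (-(C + 1)) := by
    intro x
    refine ((((neu_sq hσ1 x).const_mul B).sub ((neu_rpow_two_mul hσ0 x).const_mul (C + 1))).sub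
      ((neu_nsq hσ1 hZ x).const_mul B')).add_const (1 + B' * a) |>.congr (fun _ _ => rfl) ?_
    ring
  have hφ1 : ∀ x, a < nsq Z (x, 0) → φ (x, 0) ≤ 1 := by
    intro x hx
    simp only [hφ]
    rw [Real.zero_rpow (by positivity)]
    have : B' * a ≤ B' * nsq Z (x, 0) := mul_le_mul_of_nonneg_left hx.le hB'0.le
    linarith [sq_nonneg (0 : ℝ)]
  have hφc : Continuous φ := by
    have h1 : Continuous fun X : Pt n => X.2 ^ (2 * σ) :=
      continuous_snd.rpow_const fun _ => Or.inr (by positivity)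
    have h2 := continuous_nsq Z
    simp only [hφ]
    fun_prop
  intro X hXa hXb hXt
  by_contra hneg
  set K : Set (Pt n) := {X | a ≤ nsq Z X ∧ nsq Z X ≤ b ∧ 0 ≤ X.2} with hK
  have hKc : IsCompact K := isCompact_of_nsq_le (P := Z) (C := b)
    ((isClosed_le continuous_const (continuous_nsq Z)).inter
      ((isClosed_le (continuous_nsq Z) continuous_const).inter
        (isClosed_le continuous_const continuous_snd))) fun X hX => hX.2.1
  have hφK : ∀ X ∈ K, 0 < φ X := fun X hX => hφpos X hX.2.1 hX.2.2
  obtain ⟨A, hA, hmin⟩ := hKc.exists_isMinOn ⟨X, hXa, hXb, hXt⟩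
    (hw.div hφc.continuousOn fun X hX => (hφK X hX).ne')
  have hmin : ∀ Y ∈ K, w A / φ A ≤ w Y / φ Y := isMinOn_iff.1 hmin
  set η : ℝ := -(w A / φ A) with hη
  have hη0 : 0 < η := by
    have h1 := hmin X ⟨hXa, hXb, hXt⟩
    have h2 : w X / φ X < 0 := div_neg_of_neg_of_pos (not_le.1 hneg) (hφK X ⟨hXa, hXb, hXt⟩)
    linarith
  have hA0 : w A = -(η * φ A) := by
    rw [hη]
    have := (hφK A hA).ne'
    field_simp
  have hAneg : w A < 0 := by
    rw [hA0]
    have := mul_pos hη0 (hφK A hA)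
    linarith
  have hisMin : IsMinOn (fun Y => w Y + η * φ Y) K A := by
    refine isMinOn_iff.2 fun Y hY => ?_
    have h1 := hmin Y hY
    rw [show w A / φ A = -η by rw [hη, neg_neg], le_div_iff₀ (hφK Y hY)] at h1
    simp only [hA0]
    linarith
  have hAa : a < nsq Z A := hA.1.lt_of_ne fun h => absurd (hin A h.symm hA.2.2) (not_le.2 hAneg)
  have hAb : nsq Z A < b := hA.2.1.lt_of_ne fun h => absurd (hout A h hA.2.2) (not_le.2 hAneg)
  have hO : IsOpen {Y : Pt n | a < nsq Z Y ∧ nsq Z Y < b} :=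
    (isOpen_lt continuous_const (continuous_nsq Z)).inter
      (isOpen_lt (continuous_nsq Z) continuous_const)
  refine NoMinAt.not_isMinOn (σ := σ) (w := fun Y => w Y + η * φ Y) (K := K) (X := A) ?_ hisMin
  rcases hA.2.2.lt_or_eq with hAt | hAt
  · refine Or.inl ⟨?_, -η, by linarith, ((hEq A hAa hAb hAt).add
      ((hφL A hAt).const_mul η)).congr (fun _ => rfl) (by ring)⟩
    filter_upwards [hO.mem_nhds ⟨hAa, hAb⟩,
      (isOpen_lt continuous_const continuous_snd).mem_nhds hAt] with Y hY hYt
    exact ⟨hY.1.le, hY.2.le, le_of_lt hYt⟩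
  · obtain ⟨x, t⟩ := A
    simp only at hAt
    subst hAt
    obtain ⟨g, hg, hgN⟩ := hneu x hAa hAb hAneg
    refine Or.inr ⟨x, rfl, ?_, g + η * -(C + 1), ?_, hgN.add ((hφN x).const_mul η)⟩
    · have h1 : Tendsto (fun s : ℝ => (x, s)) (𝓝[>] 0) (𝓝 (x, (0 : ℝ))) :=
        ((Continuous.prodMk_right x).tendsto 0).mono_left nhdsWithin_le_nhds
      filter_upwards [h1 (hO.mem_nhds ⟨hAa, hAb⟩), self_mem_nhdsWithin] with s hs hs0
      exact ⟨hs.1.le, hs.2.le, le_of_lt hs0⟩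
    · rw [hA0] at hg
      have h1 := hφ1 x hAa
      have h2 : C * (η * φ (x, 0)) ≤ C * (η * 1) := by gcongr
      linarith

lemma rpow_sub_rpow_le {u v M p : ℝ} (hp : 1 ≤ p) (hu : 0 ≤ u) (huv : u ≤ v) (hv : v ≤ M) :
    v ^ p - u ^ p ≤ p * M ^ (p - 1) * (v - u) := by
  rcases hu.eq_or_lt with h0 | h0
  · rcases (h0 ▸ huv).eq_or_lt with h1 | h1
    · simp [← h0, ← h1]
    have h2 : v ^ p = v ^ (p - 1) * v := by
      rw [← Real.rpow_add_one h1.ne']; congr 1; ring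
    have h3 : v ^ (p - 1) ≤ M ^ (p - 1) := Real.rpow_le_rpow h1.le hv (by linarith)
    rw [← h0, Real.zero_rpow (by linarith), sub_zero, sub_zero, h2]
    have h4 : 0 ≤ M ^ (p - 1) := Real.rpow_nonneg (h1.le.trans hv) _
    nlinarith [mul_nonneg h4 h1.le, mul_nonneg (sub_nonneg.2 hp) (mul_nonneg h4 h1.le)]
  have hv0 : 0 < v := h0.trans_le huv
  have h1 := one_add_mul_self_le_rpow_one_add (s := u / v - 1) (by
    have : 0 ≤ u / v := by positivity
    linarith) hp
  rw [add_sub_cancel, Real.div_rpow hu hv0.le, le_div_iff₀ (Real.rpow_pos_of_pos hv0 p)] at h1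
  have h2 : v ^ p = v ^ (p - 1) * v := by
    rw [← Real.rpow_add_one hv0.ne']; congr 1; ring
  have h3 : v ^ p - u ^ p ≤ p * v ^ (p - 1) * (v - u) := by
    have : (1 + p * (u / v - 1)) * v ^ p = v ^ p - p * v ^ (p - 1) * (v - u) := by
      rw [h2]; field_simp; ring
    linarith
  refine h3.trans ?_
  have h4 : v ^ (p - 1) ≤ M ^ (p - 1) := Real.rpow_le_rpow hv0.le hv (by linarith)
  have h5 : 0 ≤ v - u := by linarith
  gcongr

lemma nsq_inv1 {Z Y : Pt n} (hY : Y ≠ Z) (l : ℝ) : nsq Z (inv1 Z l Y) = l ^ 4 / nsq Z Y := by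
  have h0 := (nsq_pos hY).ne'
  have h1 : nsq Z (inv1 Z l Y) = (l ^ 2 * (nsq Z Y)⁻¹) ^ 2 * nsq Z Y := by
    have e : ∀ W : Pt n, nsq Z W = ‖W.1 - Z.1‖ ^ 2 + (W.2 - Z.2) ^ 2 := fun W => rfl
    rw [inv1]
    generalize l ^ 2 * (nsq Z Y)⁻¹ = c
    rw [e, e]
    simp only [Prod.fst_add, Prod.smul_fst, Prod.fst_sub, Prod.snd_add, Prod.smul_snd,
      Prod.snd_sub, add_sub_cancel_right, norm_smul, smul_eq_mul, Real.norm_eq_abs]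
    rw [mul_pow, sq_abs]
    ring
  rw [h1]
  field_simp

lemma inv1_snd {Z : Pt n} (hZ : Z.2 = 0) (l : ℝ) (Y : Pt n) :
    (inv1 Z l Y).2 = l ^ 2 * (nsq Z Y)⁻¹ * Y.2 := by simp [inv1, hZ]

lemma inv1_of_nsq_eq {Z Y : Pt n} {l : ℝ} (hl : l ≠ 0) (h : nsq Z Y = l ^ 2) :
    inv1 Z l Y = Y := by
  rw [inv1, h, mul_inv_cancel₀ (by positivity), one_smul, sub_add_cancel]

lemma kelvin_of_nsq_eq {Z Y : Pt n} {l : ℝ} (hl : 0 < l) (h : nsq Z Y = l ^ 2) (U : Pt n → ℝ) :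
    kelvin σ Z l U Y = U Y := by
  rw [kelvin, inv1_of_nsq_eq hl.ne' h, h, ← Real.rpow_two, ← Real.rpow_mul hl.le, ← mul_assoc,
    ← Real.rpow_add hl]
  ring_nf
  simp

lemma kelvin_le (hq : 0 < (n : ℝ) - 2 * σ) {Z Y : Pt n} {l a M : ℝ} (hl : 0 < l) (ha : 0 < a)
    (h : a ^ 2 ≤ nsq Z Y) {U : Pt n → ℝ} (hM : 0 ≤ M) (hU : U (inv1 Z l Y) ≤ M) :
    kelvin σ Z l U Y ≤ (l / a) ^ ((n : ℝ) - 2 * σ) * M := by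
  have h1 : nsq Z Y ^ (-(((n : ℝ) - 2 * σ) / 2)) ≤ a ^ (-((n : ℝ) - 2 * σ)) := by
    have h2 : (a ^ 2) ^ (-(((n : ℝ) - 2 * σ) / 2)) = a ^ (-((n : ℝ) - 2 * σ)) := by
      rw [← Real.rpow_two, ← Real.rpow_mul ha.le]; congr 1; ring
    rw [← h2]
    exact Real.rpow_le_rpow_of_nonpos (by positivity) h (by linarith)
  rw [kelvin, Real.div_rpow hl.le ha.le, div_eq_mul_inv (l ^ _), ← Real.rpow_neg ha.le, mul_assoc]
  have h3 : 0 ≤ nsq Z Y ^ (-(((n : ℝ) - 2 * σ) / 2)) := Real.rpow_nonneg (nsq_nonneg _ _) _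
  exact mul_le_mul_of_nonneg_left ((mul_le_mul_of_nonneg_left hU h3).trans
    (mul_le_mul_of_nonneg_right h1 hM)) (by positivity)

lemma kelvin_nonneg {Z Y : Pt n} {l : ℝ} (hl : 0 < l) {U : Pt n → ℝ} (h : 0 ≤ U (inv1 Z l Y)) :
    0 ≤ kelvin σ Z l U Y :=
  mul_nonneg (by positivity) (mul_nonneg (Real.rpow_nonneg (nsq_nonneg _ _) _) h)

lemma ne_of_le_nsq {Z Y : Pt n} {l : ℝ} (hl : 0 < l) (h : l ^ 2 ≤ nsq Z Y) : Y ≠ Z := by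
  rintro rfl
  rw [nsq_self] at h
  have : 0 < l ^ 2 := by positivity
  linarith

lemma nsq_inv1_le {Z Y : Pt n} {l a : ℝ} (hl : 0 < l) (ha : 0 < a) (h : a ^ 2 ≤ nsq Z Y) :
    nsq Z (inv1 Z l Y) ≤ (l ^ 2 / a) ^ 2 := by
  rw [nsq_inv1 (ne_of_le_nsq ha h), div_pow, ← pow_mul]
  exact div_le_div_of_nonneg_left (by positivity) (by positivity) h

lemma nsq_zero_bdry (z : EuclideanSpace ℝ (Fin n)) : nsq 0 (z, 0) = ‖z‖ ^ 2 := by simp [nsq_zero]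

lemma mem_of_nsq_le {z : EuclideanSpace ℝ (Fin n)} {r : ℝ} (hr : 0 ≤ r) (hrz : r < ‖z‖)
    (hz : ‖z‖ ≤ 1 / 2) {X : Pt n} (hX : nsq (z, 0) X ≤ r ^ 2) : nsq 0 X < 1 ∧ X ≠ 0 := by
  constructor
  · refine (nsq_triangle (norm_nonneg z) hr (nsq_zero_bdry z).le hX).trans_lt ?_
    nlinarith [norm_nonneg z]
  · rintro rfl
    rw [nsq_comm, nsq_zero_bdry] at hX
    have := pow_lt_pow_left₀ hrz hr two_ne_zero
    linarith

lemma inv1_mem {z : EuclideanSpace ℝ (Fin n)} {l : ℝ} (hl : 0 < l) (hlz : l < ‖z‖)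
    (hz : ‖z‖ ≤ 1 / 2) {Y : Pt n} (h : l ^ 2 ≤ nsq (z, 0) Y) (hY : 0 ≤ Y.2) :
    nsq 0 (inv1 (z, 0) l Y) < 1 ∧ inv1 (z, 0) l Y ≠ 0 ∧ 0 ≤ (inv1 (z, 0) l Y).2 := by
  have h1 := nsq_inv1_le hl hl h
  rw [show l ^ 2 / l = l by field_simp] at h1
  obtain ⟨h2, h3⟩ := mem_of_nsq_le hl.le hlz hz h1
  refine ⟨h2, h3, ?_⟩
  rw [inv1_snd rfl]
  exact mul_nonneg (mul_nonneg (by positivity) (inv_nonneg.2 (nsq_nonneg _ _))) hY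

/-- The reflected function lies below `U` outside the sphere of radius `l` about `(z, 0)`. -/
def Below (σ : ℝ) (U : Pt n → ℝ) (z : EuclideanSpace ℝ (Fin n)) (l : ℝ) : Prop :=
  ∀ Y : Pt n, l ^ 2 ≤ nsq (z, 0) Y → nsq 0 Y ≤ 1 → 0 ≤ Y.2 → Y ≠ 0 → kelvin σ (z, 0) l U Y ≤ U Y

lemma PSol.hasL_diff {p : ℝ} {U : Pt n → ℝ} (hU : PSol σ p U) {z : EuclideanSpace ℝ (Fin n)} {l : ℝ}
    (hl : 0 < l) (hlz : l < ‖z‖) (hz : ‖z‖ ≤ 1 / 2) {Y : Pt n} (h : l ^ 2 ≤ nsq (z, 0) Y)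
    (hY : 0 < Y.2) (hY4 : nsq 0 Y < 4) : HasL σ (fun Y => U Y - kelvin σ (z, 0) l U Y) Y 0 := by
  obtain ⟨h1, h2, h3⟩ := inv1_mem hl hlz hz h hY.le
  have h4 : 0 < (inv1 (z, 0) l Y).2 := by
    rw [inv1_snd rfl]
    have := nsq_pos (ne_of_le_nsq hl h)
    positivity
  have := HasL.kelvin hl.ne' (Z := (z, 0)) rfl hY (hU.eq _ (h1.trans (by norm_num)) h4)
  exact ((hU.eq Y hY4 hY).sub this).congr (fun _ => rfl) (sub_zero 0)

lemma PSol.neu_diff (hσ0 : 0 < σ) (hσ1 : σ < 1) (hq : 0 < (n : ℝ) - 2 * σ) {U : Pt n → ℝ}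
    (hU : PSol σ (((n : ℝ) + 2 * σ) / ((n : ℝ) - 2 * σ)) U) {z y : EuclideanSpace ℝ (Fin n)} {l : ℝ}
    (hl : 0 < l) (hlz : l < ‖z‖) (hz : ‖z‖ ≤ 1 / 2) (h : l ^ 2 ≤ nsq (z, 0) (y, 0))
    (hy : y ≠ 0) (hy2 : ‖y‖ < 2) : Neu σ (fun Y => U Y - kelvin σ (z, 0) l U Y) y
      ((kelvin σ (z, 0) l U (y, 0) ^ (((n : ℝ) + 2 * σ) / ((n : ℝ) - 2 * σ)) -
        U (y, 0) ^ (((n : ℝ) + 2 * σ) / ((n : ℝ) - 2 * σ))) / (2 * σ)) := by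
  obtain ⟨h1, h2, h3⟩ := inv1_mem hl hlz hz h le_rfl
  have hyz : y ≠ z := fun e => ne_of_le_nsq hl h (by rw [e])
  refine ((hU.neu y hy hy2).sub (hU.neu_kelvin hσ0 hσ1 hq hl hyz h2
    (h1.trans (by norm_num)))).congr (fun _ _ => rfl) ?_
  ring

lemma continuousOn_kelvin {U : Pt n → ℝ} {z : EuclideanSpace ℝ (Fin n)}
    (hU : ContinuousOn U {X | nsq 0 X ≤ 4 ∧ 0 ≤ X.2 ∧ X ≠ 0}) (hz : ‖z‖ ≤ 1 / 2) :
    ContinuousOn (fun P : ℝ × Pt n => kelvin σ (z, 0) P.1 U P.2)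
      {P | 0 < P.1 ∧ P.1 < ‖z‖ ∧ P.1 ^ 2 ≤ nsq (z, 0) P.2 ∧ 0 ≤ P.2.2} := by
  have hN : Continuous fun P : ℝ × Pt n => nsq (z, 0) P.2 := (continuous_nsq _).comp continuous_snd
  have hne : ∀ P ∈ {P : ℝ × Pt n | 0 < P.1 ∧ P.1 < ‖z‖ ∧ P.1 ^ 2 ≤ nsq (z, 0) P.2 ∧ 0 ≤ P.2.2},
      nsq (z, 0) P.2 ≠ 0 := fun P hP => (nsq_pos (ne_of_le_nsq hP.1 hP.2.2.1)).ne'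
  refine ContinuousOn.mul (fun P hP => ?_) (ContinuousOn.mul (fun P hP => ?_) ?_)
  · exact (continuous_fst.continuousAt.rpow_const (Or.inl hP.1.ne')).continuousWithinAt
  · exact (hN.continuousAt.rpow_const (Or.inl (hne P hP))).continuousWithinAt
  · refine hU.comp (t := {X | nsq 0 X ≤ 4 ∧ 0 ≤ X.2 ∧ X ≠ 0}) ?_ fun P hP => ?_
    · have h1 : Continuous fun P : ℝ × Pt n => P.2 - ((z, 0) : Pt n) := by fun_prop
      exact ((ContinuousOn.mul (by fun_prop) (hN.continuousOn.inv₀ hne)).smul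
        h1.continuousOn).add continuousOn_const
    · obtain ⟨h1, h2, h3⟩ := inv1_mem hP.1 hP.2.1 hz hP.2.2.1 hP.2.2.2
      exact ⟨h1.le.trans (by norm_num), h3, h2⟩

lemma PSol.continuousOn_diff {p : ℝ} {U : Pt n → ℝ} (hU : PSol σ p U)
    {z : EuclideanSpace ℝ (Fin n)} {l : ℝ} (hl : 0 < l) (hlz : l < ‖z‖) (hz : ‖z‖ ≤ 1 / 2) :
    ContinuousOn (fun Y => U Y - kelvin σ (z, 0) l U Y)
      {Y | l ^ 2 ≤ nsq (z, 0) Y ∧ nsq 0 Y ≤ 4 ∧ 0 ≤ Y.2 ∧ Y ≠ 0} := by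
  refine (hU.cont.mono fun Y hY => hY.2).sub ?_
  exact (continuousOn_kelvin hU.cont hz).comp (f := fun Y : Pt n => (l, Y)) (by fun_prop)
    fun Y hY => ⟨hl, hlz, hY.1, hY.2.2.1⟩

lemma one_le_exponent (hσ0 : 0 < σ) (hq : 0 < (n : ℝ) - 2 * σ) :
    1 ≤ ((n : ℝ) + 2 * σ) / ((n : ℝ) - 2 * σ) := by
  rw [le_div_iff₀ hq]; linarith

lemma PSol.exists_narrow (hσ0 : 0 < σ) (hσ1 : σ < 1) (hq : 0 < (n : ℝ) - 2 * σ) {U : Pt n → ℝ}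
    (hU : PSol σ (((n : ℝ) + 2 * σ) / ((n : ℝ) - 2 * σ)) U) {z : EuclideanSpace ℝ (Fin n)}
    {r M : ℝ} (hrz : r < ‖z‖) (hz : ‖z‖ ≤ 1 / 2) (hM0 : 0 ≤ M)
    (hM : ∀ X, nsq (z, 0) X ≤ r ^ 2 → 0 ≤ X.2 → U X ≤ M) :
    ∃ ε > 0, ∀ l ρ, 0 < l → l < ρ → ρ ≤ r → ρ ^ 2 ≤ l ^ 2 + ε →
      (∀ Y, nsq (z, 0) Y = ρ ^ 2 → 0 ≤ Y.2 → kelvin σ (z, 0) l U Y ≤ U Y) →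
      ∀ Y, l ^ 2 ≤ nsq (z, 0) Y → nsq (z, 0) Y ≤ ρ ^ 2 → 0 ≤ Y.2 →
        kelvin σ (z, 0) l U Y ≤ U Y := by
  set p : ℝ := ((n : ℝ) + 2 * σ) / ((n : ℝ) - 2 * σ) with hp
  have hp1 : 1 ≤ p := one_le_exponent hσ0 hq
  obtain ⟨ε, hε, h⟩ := narrow_principle (n := n) hσ0 hσ1 hq (C := p * M ^ (p - 1) / (2 * σ))
    (by positivity)
  refine ⟨ε, hε, fun l ρ hl hlρ hρr hρ hout Y hY1 hY2 hY3 => ?_⟩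
  have hlz : l < ‖z‖ := by linarith
  have hmem : ∀ X, nsq (z, 0) X ≤ ρ ^ 2 → nsq 0 X < 1 ∧ X ≠ 0 := fun X hX =>
    mem_of_nsq_le (hl.trans hlρ).le (by linarith) hz hX
  refine sub_nonneg.1 (h (z, 0) (l ^ 2) (ρ ^ 2) (fun Y => U Y - kelvin σ (z, 0) l U Y) rfl hρ ?_ ?_
    ?_ ?_ ?_ Y hY1 hY2 hY3)
  · exact (hU.continuousOn_diff hl hlz hz).mono fun X hX =>
      ⟨hX.1, (hmem X hX.2.1).1.le.trans (by norm_num), hX.2.2, (hmem X hX.2.1).2⟩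
  · intro X hX _
    rw [kelvin_of_nsq_eq hl hX, sub_self]
  · intro X hX hX2
    exact sub_nonneg.2 (hout X hX hX2)
  · intro X hX1 hX2 hX3
    exact hU.hasL_diff hl hlz hz hX1.le hX3 ((hmem X hX2.le).1.trans (by norm_num))
  · intro x hx1 hx2 hneg
    obtain ⟨h1, h2⟩ := hmem _ hx2.le
    have hx0 : x ≠ 0 := fun e => h2 (by rw [e]; rfl)
    rw [nsq_zero_bdry] at h1
    refine ⟨_, ?_, hU.neu_diff hσ0 hσ1 hq hl hlz hz hx1.le hx0 (by nlinarith [norm_nonneg x])⟩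
    have hv : kelvin σ (z, 0) l U (x, 0) ≤ M := by
      have h3 := nsq_inv1_le hl hl hx1.le
      rw [show l ^ 2 / l = l by field_simp] at h3
      have h4 := kelvin_le hq hl hl hx1.le hM0 (U := U)
        (hM _ (h3.trans (pow_le_pow_left₀ hl.le (by linarith) 2))
          (inv1_mem hl hlz hz hx1.le le_rfl).2.2)
      rwa [div_self hl.ne', Real.one_rpow, one_mul] at h4
    have hu : 0 ≤ U (x, 0) := hU.nonneg _ (by rw [nsq_zero_bdry]; linarith) le_rfl h2
    have h5 := rpow_sub_rpow_le hp1 hu (sub_neg.1 hneg).le hv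
    rw [show -(p * M ^ (p - 1) / (2 * σ)) * (U (x, 0) - kelvin σ (z, 0) l U (x, 0)) =
      p * M ^ (p - 1) * (kelvin σ (z, 0) l U (x, 0) - U (x, 0)) / (2 * σ) by ring]
    exact div_le_div_of_nonneg_right h5 (by positivity)

lemma PSol.exists_below_small (hσ0 : 0 < σ) (hσ1 : σ < 1) (hq : 0 < (n : ℝ) - 2 * σ)
    {U : Pt n → ℝ} (hU : PSol σ (((n : ℝ) + 2 * σ) / ((n : ℝ) - 2 * σ)) U)
    {z : EuclideanSpace ℝ (Fin n)} {r M m : ℝ} (hr : 0 < r) (hrz : r < ‖z‖) (hz : ‖z‖ ≤ 1 / 2)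
    (hM0 : 0 ≤ M) (hM : ∀ X, nsq (z, 0) X ≤ r ^ 2 → 0 ≤ X.2 → U X ≤ M) (hm : 0 < m)
    (hmU : ∀ X, nsq 0 X ≤ 1 → 0 ≤ X.2 → X ≠ 0 → m ≤ U X) :
    ∃ l₀ > 0, ∀ l, 0 < l → l ≤ l₀ → Below σ U z l := by
  obtain ⟨ε, hε, h⟩ := hU.exists_narrow hσ0 hσ1 hq hrz hz hM0 hM
  set q : ℝ := (n : ℝ) - 2 * σ with hqd
  set ρ := min r (Real.sqrt ε) with hρd
  have hρ0 : 0 < ρ := lt_min hr (Real.sqrt_pos.2 hε)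
  have hρr : ρ ≤ r := min_le_left _ _
  have hρε : ρ ^ 2 ≤ ε := by
    rw [← Real.sq_sqrt hε.le]
    exact pow_le_pow_left₀ hρ0.le (min_le_right _ _) 2
  have hc : 0 < m / (M + 1) := by positivity
  refine ⟨min (ρ / 2) (ρ * (m / (M + 1)) ^ (1 / q)), lt_min (by positivity) (by positivity),
    fun l hl hl0 => ?_⟩
  have hl1 : l ≤ ρ / 2 := hl0.trans (min_le_left _ _)
  have hl2 : l ≤ ρ * (m / (M + 1)) ^ (1 / q) := hl0.trans (min_le_right _ _)
  have hlz : l < ‖z‖ := by linarith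
  have hfar : ∀ Y : Pt n, ρ ^ 2 ≤ nsq (z, 0) Y → nsq 0 Y ≤ 1 → 0 ≤ Y.2 → Y ≠ 0 →
      kelvin σ (z, 0) l U Y ≤ U Y := by
    intro Y h1 h2 h3 h4
    have hlY : l ^ 2 ≤ nsq (z, 0) Y := (pow_le_pow_left₀ hl.le (by linarith) 2).trans h1
    have h5 := nsq_inv1_le hl hl hlY
    rw [show l ^ 2 / l = l by field_simp] at h5
    have h6 := kelvin_le hq hl hρ0 h1 hM0 (U := U)
      (hM _ (h5.trans (pow_le_pow_left₀ hl.le (by linarith) 2)) (inv1_mem hl hlz hz hlY h3).2.2)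
    refine h6.trans (le_trans ?_ (hmU Y h2 h3 h4))
    have h7 : (l / ρ) ^ q ≤ m / (M + 1) := by
      have h8 : l / ρ ≤ (m / (M + 1)) ^ (1 / q) := by
        rw [div_le_iff₀ hρ0]; linarith
      have h9 := Real.rpow_le_rpow (by positivity) h8 hq.le
      rwa [← Real.rpow_mul hc.le, one_div_mul_cancel hq.ne', Real.rpow_one] at h9
    calc (l / ρ) ^ q * M ≤ m / (M + 1) * M := mul_le_mul_of_nonneg_right h7 hM0
      _ ≤ m := by
        rw [div_mul_eq_mul_div, div_le_iff₀ (by positivity)]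
        nlinarith
  intro Y h1 h2 h3 h4
  rcases le_total (ρ ^ 2) (nsq (z, 0) Y) with h5 | h5
  · exact hfar Y h5 h2 h3 h4
  · refine h l ρ hl (by linarith) hρr (by linarith [sq_nonneg l]) (fun X hX hX2 => ?_) Y h1 h5 h3
    obtain ⟨h6, h7⟩ := mem_of_nsq_le hρ0.le (by linarith) hz hX.le
    exact hfar X hX.ge h6.le hX2 h7

lemma PSol.lt_of_below_interior (hσ0 : 0 < σ) (hσ1 : σ < 1)
    {p : ℝ} {U : Pt n → ℝ} (hU : PSol σ p U)
    {z : EuclideanSpace ℝ (Fin n)} {l : ℝ} (hl : 0 < l) (hlz : l < ‖z‖) (hz : ‖z‖ ≤ 1 / 2)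
    (hb : Below σ U z l)
    (hout : ∀ Y, nsq 0 Y = 1 → 0 ≤ Y.2 → kelvin σ (z, 0) l U Y < U Y) {Y : Pt n}
    (h1 : l ^ 2 < nsq (z, 0) Y) (h2 : nsq 0 Y < 1) (h3 : 0 < Y.2) :
    kelvin σ (z, 0) l U Y < U Y := by
  set Z : Pt n := (z, 0) with hZ
  set w : Pt n → ℝ := fun Y => U Y - kelvin σ Z l U Y with hw
  set Ω : Set (Pt n) := {X | l ^ 2 < nsq Z X ∧ nsq 0 X < 1 ∧ 0 < X.2} with hΩ
  have hΩo : IsOpen Ω := (isOpen_lt continuous_const (continuous_nsq Z)).inter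
    ((isOpen_lt (continuous_nsq 0) continuous_const).inter
      (isOpen_lt continuous_const continuous_snd))
  have hne0 : ∀ Y : Pt n, 0 < Y.2 → Y ≠ 0 := fun Y hY h => by simp [h] at hY
  have hΩh : ∀ X ∈ Ω, 0 < X.2 ∧ HasL σ w X 0 ∧ 0 ≤ w X := fun X hX =>
    ⟨hX.2.2, hU.hasL_diff hl hlz hz hX.1.le hX.2.2 (hX.2.1.trans (by norm_num)),
      sub_nonneg.2 (hb X hX.1.le hX.2.1.le hX.2.2.le (hne0 X hX.2.2))⟩
  set ray : ℝ → Pt n := fun s => Z + s • (Y - Z) with hray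
  have hrayc : Continuous ray := by fun_prop
  have hray1 : ray 1 = Y := by simp [hray]
  have hnr : ∀ s, nsq Z (ray s) = s ^ 2 * nsq Z Y := by
    intro s
    simp only [hray, nsq, Prod.fst_add, Prod.smul_fst, Prod.fst_sub, Prod.snd_add, Prod.smul_snd,
      Prod.snd_sub, add_sub_cancel_left, norm_smul, smul_eq_mul, Real.norm_eq_abs, mul_pow, sq_abs]
    ring
  have hrt : ∀ s, 1 ≤ s → 0 < (ray s).2 := by
    intro s hs
    have : (ray s).2 = s * Y.2 := by simp [hray, hZ]
    rw [this]; positivity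
  have hrn : ∀ s, 1 ≤ s → l ^ 2 < nsq Z (ray s) := by
    intro s hs
    rw [hnr]
    have h4 : 1 ≤ s ^ 2 := one_le_pow₀ hs
    nlinarith [nsq_nonneg Z Y]
  have hN0 : 0 < nsq Z Y := (sq_nonneg l).trans_lt h1
  set T : Set ℝ := {s | 1 ≤ s ∧ 1 ≤ nsq 0 (ray s)} with hT
  have hTc : IsClosed T := (isClosed_le continuous_const continuous_id).inter
    (isClosed_le continuous_const ((continuous_nsq 0).comp hrayc))
  have hTne : T.Nonempty := by
    refine ⟨1 + 2 / Real.sqrt (nsq Z Y), by simp; positivity, ?_⟩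
    by_contra! hlt
    have hs0 : 0 < Real.sqrt (nsq Z Y) := Real.sqrt_pos.2 hN0
    have h5 := nsq_triangle (P := 0) (Q := Z) (X := ray (1 + 2 / Real.sqrt (nsq Z Y)))
      (a := 1 / 2) (b := 1) (by norm_num) (by norm_num) (by
        rw [nsq_comm, nsq_zero_bdry]; exact pow_le_pow_left₀ (norm_nonneg z) hz 2)
      (by simpa using hlt.le)
    rw [hnr] at h5
    have h6 : (1 + 2 / Real.sqrt (nsq Z Y)) ^ 2 * nsq Z Y = (Real.sqrt (nsq Z Y) + 2) ^ 2 := by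
      nth_rewrite 2 [← Real.sq_sqrt hN0.le]
      rw [← mul_pow]; congr 1; field_simp
    rw [h6] at h5
    nlinarith
  have hTb : BddBelow T := ⟨1, fun s hs => hs.1⟩
  set s₁ := sInf T with hs₁
  have hs1T : s₁ ∈ T := hTc.csInf_mem hTne hTb
  have hlt : ∀ s, 1 ≤ s → s < s₁ → nsq 0 (ray s) < 1 := fun s h hs => by
    by_contra hge
    exact not_le.2 hs (csInf_le hTb ⟨h, not_lt.1 hge⟩)
  have hs1 : 1 < s₁ := hs1T.1.lt_of_ne fun e => by
    have := hs1T.2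
    rw [← e, hray1] at this
    linarith
  have hS1 : nsq 0 (ray s₁) = 1 := by
    refine le_antisymm ?_ hs1T.2
    have h5 : Tendsto (fun s => nsq 0 (ray s)) (𝓝[<] s₁) (𝓝 (nsq 0 (ray s₁))) :=
      (((continuous_nsq 0).comp hrayc).tendsto s₁).mono_left nhdsWithin_le_nhds
    refine le_of_tendsto h5 ?_
    filter_upwards [Ioo_mem_nhdsLT hs1] with s hs using (hlt s hs.1.le hs.2).le
  have hw1 : 0 < w (ray s₁) := sub_pos.2 (hout _ hS1 (hrt s₁ hs1.le).le)
  have hwc : ContinuousAt w (ray s₁) := (hU.hasL_diff hl hlz hz (hrn s₁ hs1.le).le (hrt s₁ hs1.le)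
    (by rw [hS1]; norm_num)).smooth.continuousAt
  have hev : ∀ᶠ s in 𝓝[<] s₁, 0 < w (ray s) :=
    ((hwc.comp hrayc.continuousAt).tendsto.mono_left nhdsWithin_le_nhds).eventually_const_lt hw1
  obtain ⟨s₂, hs2, hs2'⟩ := (hev.and (Ioo_mem_nhdsLT hs1)).exists
  have hfin := pos_of_isPreconnected hσ0 hσ1 hΩo hΩh (S := ray '' Set.Ico 1 s₁)
    (isPreconnected_Ico.image _ hrayc.continuousOn) (by
      rintro _ ⟨s, hs, rfl⟩
      exact ⟨hrn s hs.1, hlt s hs.1 hs.2, hrt s hs.1⟩)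
    ⟨ray s₂, ⟨s₂, ⟨hs2'.1.le, hs2'.2⟩, rfl⟩, hs2⟩ Y ⟨1, ⟨le_rfl, hs1⟩, hray1⟩
  exact sub_pos.1 hfin

lemma PSol.exists_neu_nonpos_diff (hσ0 : 0 < σ) (hσ1 : σ < 1) (hq : 0 < (n : ℝ) - 2 * σ)
    {U : Pt n → ℝ} (hU : PSol σ (((n : ℝ) + 2 * σ) / ((n : ℝ) - 2 * σ)) U)
    {z : EuclideanSpace ℝ (Fin n)} {l : ℝ} (hl : 0 < l) (hlz : l < ‖z‖) (hz : ‖z‖ ≤ 1 / 2)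
    (hb : Below σ U z l) {y : EuclideanSpace ℝ (Fin n)} (h1 : l ^ 2 ≤ nsq (z, 0) (y, 0))
    (h2 : nsq (0 : Pt n) (y, 0) ≤ 1) (h3 : y ≠ 0) :
    ∃ g ≤ 0, Neu σ (fun Y => U Y - kelvin σ (z, 0) l U Y) y g := by
  have hy0 : (y, (0 : ℝ)) ≠ 0 := fun h => h3 (congrArg Prod.fst h)
  have h4 := hb (y, 0) h1 h2 le_rfl hy0
  have hy2 : ‖y‖ < 2 := by
    rw [nsq_zero_bdry] at h2
    nlinarith [norm_nonneg y]
  refine ⟨_, ?_, hU.neu_diff hσ0 hσ1 hq hl hlz hz h1 h3 hy2⟩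
  obtain ⟨h5, h6, h7⟩ := inv1_mem hl hlz hz h1 le_rfl
  have h8 : 0 ≤ kelvin σ (z, 0) l U (y, 0) :=
    kelvin_nonneg hl (hU.nonneg _ (h5.le.trans (by norm_num)) h7 h6)
  have h9 := Real.rpow_le_rpow h8 h4 (zero_le_one.trans (one_le_exponent hσ0 hq))
  exact div_nonpos_of_nonpos_of_nonneg (sub_nonpos.2 h9) (by positivity)

lemma PSol.lt_of_below (hσ0 : 0 < σ) (hσ1 : σ < 1) (hq : 0 < (n : ℝ) - 2 * σ)
    {U : Pt n → ℝ} (hU : PSol σ (((n : ℝ) + 2 * σ) / ((n : ℝ) - 2 * σ)) U)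
    {z : EuclideanSpace ℝ (Fin n)} {l : ℝ} (hl : 0 < l) (hlz : l < ‖z‖) (hz : ‖z‖ ≤ 1 / 2)
    (hb : Below σ U z l)
    (hout : ∀ Y, nsq 0 Y = 1 → 0 ≤ Y.2 → kelvin σ (z, 0) l U Y < U Y) {Y : Pt n}
    (h1 : l ^ 2 < nsq (z, 0) Y) (h2 : nsq 0 Y ≤ 1) (h3 : 0 ≤ Y.2) (h4 : Y ≠ 0) :
    kelvin σ (z, 0) l U Y < U Y := by
  rcases h2.eq_or_lt with h2 | h2
  · exact hout Y h2 h3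
  rcases h3.lt_or_eq with h3 | h3
  · exact hU.lt_of_below_interior hσ0 hσ1 hl hlz hz hb hout h1 h2 h3
  obtain ⟨y, t⟩ := Y
  simp only at h3
  subst h3
  have hO : IsOpen {X : Pt n | l ^ 2 < nsq (z, 0) X ∧ nsq 0 X < 1 ∧ X.1 ≠ 0} :=
    (isOpen_lt continuous_const (continuous_nsq _)).inter
      ((isOpen_lt (continuous_nsq 0) continuous_const).inter
        (isOpen_ne_fun continuous_fst continuous_const))
  have hy : y ≠ 0 := fun h => h4 (by rw [h]; rfl)
  obtain ⟨ε, hε, hball⟩ := Metric.isOpen_iff.1 hO (y, 0) ⟨h1, h2, hy⟩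
  have hr : 0 < ε / 2 := by positivity
  have hsub : ∀ X ∈ Cyl y ((ε / 2) ^ 2) (ε / 2),
      l ^ 2 < nsq (z, 0) X ∧ nsq 0 X < 1 ∧ X.1 ≠ 0 := by
    rintro X ⟨h5, h6, h7⟩
    refine hball ?_
    rw [Metric.mem_ball, Prod.dist_eq, max_lt_iff, dist_eq_norm, dist_eq_norm, Real.norm_eq_abs,
      sub_zero, abs_of_nonneg h6]
    have := le_of_abs_le (abs_le_of_sq_le_sq h5 hr.le)
    exact ⟨by simp only; linarith, by linarith⟩
  have hsub0 : ∀ X ∈ Cyl y ((ε / 2) ^ 2) (ε / 2), X ≠ 0 := fun X hX h =>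
    (hsub X hX).2.2 (by rw [h]; rfl)
  refine sub_pos.1 (pos_bdry hσ0 hσ1 (U := fun Y => U Y - kelvin σ (z, 0) l U Y) hr ?_ ?_ ?_ ?_ ?_)
  · exact (hU.continuousOn_diff hl hlz hz).mono fun X hX =>
      ⟨(hsub X hX).1.le, (hsub X hX).2.1.le.trans (by norm_num), hX.2.1, hsub0 X hX⟩
  · exact fun X hX => sub_nonneg.2 (hb X (hsub X hX).1.le (hsub X hX).2.1.le hX.2.1 (hsub0 X hX))
  · exact fun X hX hX2 => sub_pos.2 (hU.lt_of_below_interior hσ0 hσ1 hl hlz hz hb hout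
      (hsub X hX).1 (hsub X hX).2.1 hX2)
  · exact fun X hX hX2 _ => hU.hasL_diff hl hlz hz (hsub X hX).1.le hX2
      ((hsub X hX).2.1.trans (by norm_num))
  · intro x hx
    obtain ⟨h5, h6, h7⟩ := hsub (x, 0) ⟨hx.le, le_rfl, hr.le⟩
    exact hU.exists_neu_nonpos_diff hσ0 hσ1 hq hl hlz hz hb h5.le h6.le h7

lemma PSol.exists_gap (hσ0 : 0 < σ) (hσ1 : σ < 1) (hq : 0 < (n : ℝ) - 2 * σ)
    {U : Pt n → ℝ} (hU : PSol σ (((n : ℝ) + 2 * σ) / ((n : ℝ) - 2 * σ)) U)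
    {z : EuclideanSpace ℝ (Fin n)} {l ρ : ℝ} (hl : 0 < l) (hlρ : l < ρ) (hρz : ρ < ‖z‖)
    (hz : ‖z‖ ≤ 1 / 2) (hb : Below σ U z l)
    (hout : ∀ Y, nsq 0 Y = 1 → 0 ≤ Y.2 → kelvin σ (z, 0) l U Y < U Y) :
    ∃ c > 0, ∀ Y, ρ ^ 2 ≤ nsq (z, 0) Y → nsq 0 Y ≤ 1 → 0 ≤ Y.2 → Y ≠ 0 →
      kelvin σ (z, 0) l U Y + c ≤ U Y := by
  have hlz : l < ‖z‖ := hlρ.trans hρz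
  have hρ0 : 0 < ρ := hl.trans hlρ
  have hlρ2 : l ^ 2 < ρ ^ 2 := pow_lt_pow_left₀ hlρ hl.le two_ne_zero
  set δ := ‖z‖ - ρ with hδ
  have hδ0 : 0 < δ := by linarith
  have hfar : ∀ Y : Pt n, nsq 0 Y ≤ δ ^ 2 → ρ ^ 2 ≤ nsq (z, 0) Y := by
    intro Y hY
    by_contra! h
    have h1 : nsq (z, 0) Y ≤ (Real.sqrt (nsq (z, 0) Y)) ^ 2 := (Real.sq_sqrt (nsq_nonneg _ _)).ge
    have h2 : Real.sqrt (nsq (z, 0) Y) < ρ := by rwa [Real.sqrt_lt' hρ0]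
    have h3 := nsq_triangle hδ0.le (Real.sqrt_nonneg _) hY ((nsq_comm Y (z, 0)).trans_le h1)
    rw [nsq_zero_bdry] at h3
    have h4 := pow_lt_pow_left₀ (show δ + Real.sqrt (nsq (z, 0) Y) < ‖z‖ by linarith)
      (by positivity) two_ne_zero
    linarith
  set K : Set (Pt n) := {Y | ρ ^ 2 ≤ nsq (z, 0) Y ∧ δ ^ 2 ≤ nsq 0 Y ∧ nsq 0 Y ≤ 1 ∧ 0 ≤ Y.2}
  have hK : IsCompact K := isCompact_of_nsq_le (P := 0) (C := 1)
    ((isClosed_le continuous_const (continuous_nsq _)).inter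
      ((isClosed_le continuous_const (continuous_nsq 0)).inter
        ((isClosed_le (continuous_nsq 0) continuous_const).inter
          (isClosed_le continuous_const continuous_snd)))) fun X hX => hX.2.2.1
  have hK0 : ∀ Y : Pt n, δ ^ 2 ≤ nsq 0 Y → Y ≠ 0 := fun Y hY => ne_of_le_nsq hδ0 hY
  have hc := hU.continuousOn_diff hl hlz hz
  have hKne : K.Nonempty := by
    refine ⟨(0, 1), ?_, ?_, ?_, zero_le_one⟩
    · simp only [nsq, zero_sub, norm_neg, sub_zero]
      nlinarith
    · simp only [nsq_zero, norm_zero]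
      nlinarith
    · simp [nsq_zero]
  obtain ⟨A, hA, hmin⟩ := hK.exists_isMinOn hKne (hc.mono fun X hX =>
    ⟨hlρ2.le.trans hX.1, hX.2.2.1.trans (by norm_num), hX.2.2.2, hK0 X hX.2.1⟩)
  have hmin := isMinOn_iff.1 hmin
  refine ⟨U A - kelvin σ (z, 0) l U A, sub_pos.2 (hU.lt_of_below hσ0 hσ1 hq hl hlz hz hb hout
    (hlρ2.trans_le hA.1) hA.2.2.1 hA.2.2.2 (hK0 A hA.2.1)), fun Y h1 h2 h3 h4 => ?_⟩
  suffices U A - kelvin σ (z, 0) l U A ≤ U Y - kelvin σ (z, 0) l U Y by linarith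
  rcases le_total (δ ^ 2) (nsq 0 Y) with h5 | h5
  · exact hmin Y ⟨h1, h5, h2, h3⟩
  have hδ1 : δ ^ 2 ≤ 1 := by nlinarith
  refine min_principle_punctured hσ0 hσ1 hq (w := fun Y => U Y - kelvin σ (z, 0) l U Y)
    (δ := δ ^ 2) (B := 0) (hc.mono fun X hX =>
      ⟨hlρ2.le.trans (hfar X hX.1), by linarith [hX.1], hX.2.1, hX.2.2⟩)
    (fun X e1 e2 e3 => ?_) (fun X e1 e2 => ?_) (fun X e1 e2 => ?_) (fun x e1 e2 => ?_) Y h5 h3 h4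
  · rw [neg_zero]
    exact sub_nonneg.2 (hb X (hlρ2.le.trans (hfar X e1)) (e1.trans hδ1) e2 e3)
  · exact hmin X ⟨hfar X e1.le, e1.ge, e1.le.trans hδ1, e2⟩
  · exact hU.hasL_diff hl hlz hz (hlρ2.le.trans (hfar X e1.le)) e2 (by linarith)
  · exact hU.exists_neu_nonpos_diff hσ0 hσ1 hq hl hlz hz hb (hlρ2.le.trans (hfar _ e1.le))
      (e1.le.trans hδ1) e2

lemma PSol.exists_below_gt (hσ0 : 0 < σ) (hσ1 : σ < 1) (hq : 0 < (n : ℝ) - 2 * σ)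
    {U : Pt n → ℝ} (hU : PSol σ (((n : ℝ) + 2 * σ) / ((n : ℝ) - 2 * σ)) U)
    {z : EuclideanSpace ℝ (Fin n)} {r M l b : ℝ} (hrz : r < ‖z‖) (hz : ‖z‖ ≤ 1 / 2)
    (hM0 : 0 ≤ M) (hM : ∀ X, nsq (z, 0) X ≤ r ^ 2 → 0 ≤ X.2 → U X ≤ M)
    (hl : 0 < l) (hlr : l < r) (hlb : l < b) (hb : Below σ U z l)
    (hout : ∀ Y, nsq 0 Y = 1 → 0 ≤ Y.2 → kelvin σ (z, 0) l U Y < U Y) :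
    ∃ μ, l < μ ∧ μ ≤ b ∧ Below σ U z μ := by
  obtain ⟨ε, hε, hnar⟩ := hU.exists_narrow hσ0 hσ1 hq hrz hz hM0 hM
  set ρ := min r (Real.sqrt (l ^ 2 + ε)) with hρd
  have hρr : ρ ≤ r := min_le_left _ _
  have hlρ : l < ρ := lt_min hlr (Real.lt_sqrt_of_sq_lt (by linarith))
  have hρ0 : 0 < ρ := hl.trans hlρ
  have hρε : ρ ^ 2 ≤ l ^ 2 + ε := by
    have := pow_le_pow_left₀ hρ0.le (min_le_right r (Real.sqrt (l ^ 2 + ε))) 2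
    rwa [Real.sq_sqrt (by positivity)] at this
  obtain ⟨c, hc, hgap⟩ := hU.exists_gap hσ0 hσ1 hq hl hlρ (hρr.trans_lt hrz) hz hb hout
  set K : Set (Pt n) := {Y | ρ ^ 2 ≤ nsq (z, 0) Y ∧ nsq 0 Y ≤ 1 ∧ 0 ≤ Y.2}
  have hK : IsCompact K := isCompact_of_nsq_le (P := 0) (C := 1)
    ((isClosed_le continuous_const (continuous_nsq _)).inter
      ((isClosed_le (continuous_nsq 0) continuous_const).inter
        (isClosed_le continuous_const continuous_snd))) fun X hX => hX.2.1
  have hcont : ContinuousOn (fun P : ℝ × Pt n => kelvin σ (z, 0) P.1 U P.2)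
      (Set.Icc l ρ ×ˢ K) := (continuousOn_kelvin hU.cont hz).mono fun P hP =>
    ⟨hl.trans_le hP.1.1, hP.1.2.trans_lt (hρr.trans_lt hrz),
      (pow_le_pow_left₀ (hl.le.trans hP.1.1) hP.1.2 2).trans hP.2.1, hP.2.2.2⟩
  have huc := Metric.uniformContinuousOn_iff.1
    ((isCompact_Icc.prod hK).uniformContinuousOn_of_continuous hcont) c hc
  obtain ⟨δ, hδ, huc⟩ := huc
  set μ := l + min (δ / 2) (min ((b - l) / 2) ((ρ - l) / 2)) with hμ
  have h0 : 0 < min (δ / 2) (min ((b - l) / 2) ((ρ - l) / 2)) :=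
    lt_min (by positivity) (lt_min (by linarith) (by linarith))
  have hμδ : μ - l ≤ δ / 2 := by rw [hμ, add_sub_cancel_left]; exact min_le_left _ _
  have hμb : μ - l ≤ (b - l) / 2 := by
    rw [hμ, add_sub_cancel_left]; exact (min_le_right _ _).trans (min_le_left _ _)
  have hμρ : μ - l ≤ (ρ - l) / 2 := by
    rw [hμ, add_sub_cancel_left]; exact (min_le_right _ _).trans (min_le_right _ _)
  have hlμ : l < μ := by linarith
  have hfar : ∀ Y, ρ ^ 2 ≤ nsq (z, 0) Y → nsq 0 Y ≤ 1 → 0 ≤ Y.2 → Y ≠ 0 →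
      kelvin σ (z, 0) μ U Y ≤ U Y := by
    intro Y h1 h2 h3 h4
    have h5 := huc (μ, Y) ⟨⟨hlμ.le, by linarith⟩, h1, h2, h3⟩ (l, Y)
      ⟨⟨le_rfl, hlρ.le⟩, h1, h2, h3⟩ (by
        rw [Prod.dist_eq, dist_self, max_eq_left dist_nonneg, Real.dist_eq,
          abs_of_pos (by simp only; linarith)]
        simp only; linarith)
    rw [Real.dist_eq] at h5
    have h6 := hgap Y h1 h2 h3 h4
    have h7 := (abs_lt.1 h5).2
    simp only at h7
    linarith
  refine ⟨μ, hlμ, by linarith, fun Y h1 h2 h3 h4 => ?_⟩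
  rcases le_total (ρ ^ 2) (nsq (z, 0) Y) with h5 | h5
  · exact hfar Y h5 h2 h3 h4
  · refine hnar μ ρ (hl.trans hlμ) (by linarith) hρr ?_ (fun X hX hX2 => ?_) Y h1 h5 h3
    · have := pow_le_pow_left₀ hl.le hlμ.le 2
      linarith
    · obtain ⟨h6, h7⟩ := mem_of_nsq_le hρ0.le (by linarith) hz hX.le
      exact hfar X hX.ge h6.le hX2 h7

/-- The method of moving spheres. -/
lemma PSol.below (hσ0 : 0 < σ) (hσ1 : σ < 1) (hq : 0 < (n : ℝ) - 2 * σ)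
    {U : Pt n → ℝ} (hU : PSol σ (((n : ℝ) + 2 * σ) / ((n : ℝ) - 2 * σ)) U)
    {z : EuclideanSpace ℝ (Fin n)} {l₀ m S : ℝ} (hl0z : l₀ < ‖z‖) (hz : ‖z‖ ≤ 1 / 2)
    (hm : 0 < m) (hmU : ∀ X, nsq 0 X ≤ 1 → 0 ≤ X.2 → X ≠ 0 → m ≤ U X) (hS0 : 0 ≤ S)
    (hS : ∀ X, nsq (z, 0) X ≤ (2 * l₀ ^ 2) ^ 2 → 0 ≤ X.2 → U X ≤ S)
    (hSm : (2 * l₀) ^ ((n : ℝ) - 2 * σ) * S < m) {l : ℝ} (hl : 0 < l) (hll : l ≤ l₀) :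
    Below σ U z l := by
  have hl00 : 0 < l₀ := hl.trans_le hll
  have hout : ∀ l, 0 < l → l ≤ l₀ → ∀ Y, nsq 0 Y = 1 → 0 ≤ Y.2 →
      kelvin σ (z, 0) l U Y < U Y := by
    intro l hl hll Y hY1 hY2
    have hn0 : Y ≠ 0 := fun h => by simp [h, nsq_self] at hY1
    have h1 : (1 / 2) ^ 2 ≤ nsq (z, 0) Y := by
      by_contra! h
      have h2 : nsq (z, 0) Y ≤ (Real.sqrt (nsq (z, 0) Y)) ^ 2 := (Real.sq_sqrt (nsq_nonneg _ _)).ge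
      have h3 : Real.sqrt (nsq (z, 0) Y) < 1 / 2 := by rwa [Real.sqrt_lt' (by norm_num)]
      have h4 := nsq_triangle (norm_nonneg z) (Real.sqrt_nonneg _) (nsq_zero_bdry z).le h2
      nlinarith [Real.sqrt_nonneg (nsq (z, 0) Y), norm_nonneg z]
    have h2 := nsq_inv1_le hl (by norm_num : (0 : ℝ) < 1 / 2) h1
    have hlY : l ^ 2 ≤ nsq (z, 0) Y := (pow_le_pow_left₀ hl.le (by linarith) 2).trans h1
    have h3 := kelvin_le hq hl (by norm_num : (0 : ℝ) < 1 / 2) h1 hS0 (U := U) (hS _ (h2.trans (by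
      refine pow_le_pow_left₀ (by positivity) ?_ 2
      have := pow_le_pow_left₀ hl.le hll 2
      linarith)) (inv1_mem hl (by linarith) hz hlY hY2).2.2)
    have h4 : (l / (1 / 2)) ^ ((n : ℝ) - 2 * σ) ≤ (2 * l₀) ^ ((n : ℝ) - 2 * σ) :=
      Real.rpow_le_rpow (by positivity) (by linarith) hq.le
    exact ((h3.trans (mul_le_mul_of_nonneg_right h4 hS0)).trans_lt hSm).trans_le
      (hmU Y hY1.le hY2 hn0)
  set r := (l₀ + ‖z‖) / 2 with hr
  have hr0 : 0 < r := by linarith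
  have hrz : r < ‖z‖ := by linarith
  have hcomp : IsCompact {X : Pt n | nsq (z, 0) X ≤ r ^ 2 ∧ 0 ≤ X.2} :=
    isCompact_of_nsq_le (P := (z, 0)) (C := r ^ 2)
      ((isClosed_le (continuous_nsq _) continuous_const).inter
        (isClosed_le continuous_const continuous_snd)) fun X hX => hX.1
  obtain ⟨M₁, hM1⟩ := hcomp.bddAbove_image (f := U) (hU.cont.mono fun X hX => by
    obtain ⟨h1, h2⟩ := mem_of_nsq_le hr0.le hrz hz hX.1
    exact ⟨h1.le.trans (by norm_num), hX.2, h2⟩)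
  have hM : ∀ X, nsq (z, 0) X ≤ r ^ 2 → 0 ≤ X.2 → U X ≤ max M₁ 0 := fun X h1 h2 =>
    (hM1 ⟨X, ⟨h1, h2⟩, rfl⟩).trans (le_max_left _ _)
  obtain ⟨ls, hls, hsmall⟩ := hU.exists_below_small hσ0 hσ1 hq hr0 hrz hz (le_max_right _ _) hM hm hmU
  rcases le_total l ls with h | h
  · exact hsmall l hl h
  have hsub : Set.Icc ls l ⊆ {μ | Below σ U z μ} := by
    refine IsClosed.Icc_subset_of_forall_exists_gt ?_ (hsmall ls hls le_rfl) ?_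
    · refine isClosed_of_closure_subset fun μ hμ => ?_
      have hμI : μ ∈ Set.Icc ls l :=
        isClosed_Icc.closure_subset_iff.2 Set.inter_subset_right hμ
      refine ⟨fun Y h1 h2 h3 h4 => ?_, hμI⟩
      have hμ0 : 0 < μ := hls.trans_le hμI.1
      rcases h1.eq_or_lt with h1 | h1
      · rw [kelvin_of_nsq_eq hμ0 h1.symm]
      obtain ⟨u, hu, hut⟩ := mem_closure_iff_seq_limit.1 hμ
      have hev : ∀ᶠ k in atTop, u k ^ 2 < nsq (z, 0) Y := (hut.pow 2).eventually_lt_const h1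
      have hcw := (continuousOn_kelvin hU.cont hz (z := z) (σ := σ)) (μ, Y)
        ⟨hμ0, by linarith [hμI.2], h1.le, h3⟩
      have hlim : Tendsto (fun k => (u k, Y)) atTop
          (𝓝[{P : ℝ × Pt n | 0 < P.1 ∧ P.1 < ‖z‖ ∧ P.1 ^ 2 ≤ nsq (z, 0) P.2 ∧ 0 ≤ P.2.2}] (μ, Y)) := by
        refine tendsto_nhdsWithin_iff.2 ⟨hut.prodMk_nhds tendsto_const_nhds, ?_⟩
        filter_upwards [hev] with k hk
        exact ⟨hls.trans_le (hu k).2.1, by linarith [(hu k).2.2], hk.le, h3⟩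
      refine le_of_tendsto (hcw.tendsto.comp hlim) ?_
      filter_upwards [hev] with k hk using (hu k).1 Y hk.le h2 h3 h4
    · rintro μ ⟨hμ1, hμ2⟩ b hb
      have hμ0 : 0 < μ := hls.trans_le hμ2.1
      obtain ⟨ν, h1, h2, h3⟩ := hU.exists_below_gt hσ0 hσ1 hq hrz hz (le_max_right _ _) hM hμ0
        (by linarith [hμ2.2]) hb hμ1 (hout μ hμ0 (by linarith [hμ2.2]))
      exact ⟨ν, h3, h1, h2⟩
  exact hsub ⟨h, le_rfl⟩

/-- Moving spheres around nearby centres turn into a one-sided Harnack inequality. -/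
lemma center_le (hq : 0 < (n : ℝ) - 2 * σ) {U : Pt n → ℝ} {x₀ x : EuclideanSpace ℝ (Fin n)}
    {a : ℝ} (ha : 0 < a) (hx : ‖x - x₀‖ ≤ a) (hx0 : x ≠ 0) (hx1 : ‖x‖ ≤ 1)
    (h0 : 0 ≤ U (x₀, 0))
    (hb : ∀ z l, ‖z - x₀‖ ≤ a → 0 < l → l ≤ 2 * a → Below σ U z l) :
    2 ^ (-(((n : ℝ) - 2 * σ) / 2)) * U (x₀, 0) ≤ U (x, 0) := by
  have h2 : (2 : ℝ) ^ (-(((n : ℝ) - 2 * σ) / 2)) ≤ 1 :=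
    Real.rpow_le_one_of_one_le_of_nonpos one_le_two (by linarith)
  rcases eq_or_ne x x₀ with rfl | hne
  · exact mul_le_of_le_one_left h0 h2
  set d := ‖x - x₀‖ with hd
  have hd0 : 0 < d := norm_pos_iff.2 (sub_ne_zero.2 hne)
  set z := x₀ - (a / d) • (x - x₀) with hz
  have hxz : x - z = ((a + d) / d) • (x - x₀) := by
    rw [hz, add_div, div_self hd0.ne', add_smul, one_smul]
    abel
  have hxz' : ‖x - z‖ = a + d := by
    rw [hxz, norm_smul, Real.norm_of_nonneg (by positivity), ← hd]
    field_simp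
  have hzx : ‖z - x₀‖ ≤ a := by
    rw [hz, sub_sub_cancel_left, norm_neg, norm_smul, Real.norm_of_nonneg (by positivity), ← hd]
    exact (div_mul_cancel₀ a hd0.ne').le
  set l := Real.sqrt (a * (a + d)) with hl
  have hl2 : l ^ 2 = a * (a + d) := Real.sq_sqrt (by positivity)
  have hl0 : 0 < l := Real.sqrt_pos.2 (by positivity)
  have hla : l ≤ 2 * a := by
    rw [hl, Real.sqrt_le_left (by positivity)]
    nlinarith
  have hns : nsq (z, 0) (x, 0) = (a + d) ^ 2 := by
    simp only [nsq, hxz']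
    ring
  have key := hb z l hzx hl0 hla (x, 0) (by rw [hns, hl2]; nlinarith)
    (by rw [nsq_zero_bdry]; nlinarith [norm_nonneg x]) le_rfl fun h => hx0 (congrArg Prod.fst h)
  have hinv : inv1 (z, 0) l (x, 0) = (x₀, 0) := by
    rw [inv1_bdry, hxz', hl2, hxz, smul_smul]
    have h3 : a * (a + d) * ((a + d) ^ 2 + 0 ^ 2)⁻¹ * ((a + d) / d) = a / d := by
      field_simp
      ring
    rw [h3, mul_zero, hz]
    simp
  rw [kelvin, hinv, hns, ← mul_assoc] at key
  refine le_trans (mul_le_mul_of_nonneg_right ?_ h0) key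
  have h4 : l ^ ((n : ℝ) - 2 * σ) = (a * (a + d)) ^ (((n : ℝ) - 2 * σ) / 2) := by
    rw [← hl2, ← Real.rpow_natCast, ← Real.rpow_mul hl0.le]
    congr 1
    push_cast
    ring
  rw [h4, Real.rpow_neg (by positivity), Real.rpow_neg (by positivity), ← Real.inv_rpow (by positivity),
    ← Real.inv_rpow (by positivity), ← Real.mul_rpow (by positivity) (by positivity)]
  refine Real.rpow_le_rpow (by positivity) ?_ (by linarith)
  rw [← div_eq_mul_inv, le_div_iff₀ (by positivity)]
  nlinarith

lemma mul_le_of_rpow_gain {q s D v ρ : ℝ} (hs : 0 < s) (hv : 0 < v) (hρ : 0 < ρ)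
    (h : (v / 2) ^ (q / 2 + s) * ρ ^ s ≤ D * v ^ (q / 2)) :
    v * ρ ≤ 2 * (D * 2 ^ (q / 2)) ^ s⁻¹ := by
  have hw : 0 < v / 2 := by positivity
  have h1 : v ^ (q / 2) = 2 ^ (q / 2) * (v / 2) ^ (q / 2) := by
    rw [← Real.mul_rpow zero_le_two hw.le]
    congr 1
    ring
  rw [Real.rpow_add hw, h1, mul_assoc, ← Real.mul_rpow hw.le hρ.le] at h
  have h2 : (v / 2 * ρ) ^ s ≤ D * 2 ^ (q / 2) := by
    have h3 : 0 < (v / 2) ^ (q / 2) := by positivity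
    nlinarith
  have h4 := Real.rpow_le_rpow (by positivity) h2 (inv_nonneg.2 hs.le)
  rw [Real.rpow_rpow_inv (by positivity) hs.ne'] at h4
  linarith

/-- The Neumann condition amplifies a lower bound on a boundary ball. -/
lemma PSol.gain (hσ0 : 0 < σ) (hσ1 : σ < 1) (hq : 0 < (n : ℝ) - 2 * σ)
    {U : Pt n → ℝ} (hU : PSol σ (((n : ℝ) + 2 * σ) / ((n : ℝ) - 2 * σ)) U)
    {x₀ : EuclideanSpace ℝ (Fin n)} {a : ℝ} (ha : 0 < a) (hax : a < ‖x₀‖) (hx : ‖x₀‖ ≤ 1 / 4)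
    (hpos : 0 < U (x₀, 0))
    (h : ∀ x, ‖x - x₀‖ ≤ a → 2 ^ (-(((n : ℝ) - 2 * σ) / 2)) * U (x₀, 0) ≤ U (x, 0)) :
    U (x₀, 0) ^ (2 / ((n : ℝ) - 2 * σ)) * a ≤
      2 * (2 * σ * (1 + kap n σ) * 2 ^ (((n : ℝ) - 2 * σ) / 2)) ^ (2 * σ)⁻¹ := by
  set q := (n : ℝ) - 2 * σ with hqd
  set v := U (x₀, 0) ^ (2 / q) with hv
  have hv0 : 0 < v := Real.rpow_pos_of_pos hpos _
  have hMv : U (x₀, 0) = v ^ (q / 2) := by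
    rw [hv, ← Real.rpow_mul hpos.le]
    field_simp
    rw [Real.rpow_one]
  have hκ := kap_nonneg (n := n) hσ1
  have hcyl := cyl_subset (n := n) (τ := a) (c := 4) ha.le hx (by nlinarith)
  have hcne : ∀ X ∈ Cyl x₀ (a ^ 2) a, X ≠ 0 := by
    intro X hX h0
    have := hX.1
    rw [h0, Prod.fst_zero, zero_sub, norm_neg] at this
    nlinarith
  set b := (v / 2) ^ (q / 2 + 2 * σ) with hb
  have hb0 : 0 < b := by positivity
  have hbU : ∀ x, ‖x - x₀‖ ≤ a → b ≤ U (x, 0) ^ (((n : ℝ) + 2 * σ) / q) := by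
    intro x hxa
    have h1 := h x hxa
    have h2 : (2 : ℝ) ^ (-(q / 2)) * U (x₀, 0) = (v / 2) ^ (q / 2) := by
      rw [hMv, Real.rpow_neg zero_le_two, Real.div_rpow hv0.le zero_le_two]
      field_simp
    rw [h2] at h1
    have h3 := Real.rpow_le_rpow (by positivity) h1
      (show 0 ≤ ((n : ℝ) + 2 * σ) / q by positivity)
    rw [← Real.rpow_mul (by positivity)] at h3
    refine le_of_eq_of_le ?_ h3
    rw [hb]
    congr 1
    rw [hqd] at hq ⊢
    field_simp
    ring
  set A := b * a ^ (2 * σ) / (2 * σ * (1 + kap n σ)) with hA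
  have key := bottom_barrier hσ0 hσ1 ha (A := A) (by positivity)
    (hU.cont.mono fun X hX => ⟨hcyl X hX, hX.2.1, hcne X hX⟩)
    (fun X hX => hU.nonneg X (hcyl X hX) hX.2.1 (hcne X hX))
    (fun X hX h1 h2 => hU.eq X (lt_of_le_of_lt
      (cyl_subset (n := n) (τ := a) (c := 1) ha.le hx (by nlinarith) X hX) (by norm_num)) h1) ?_
    (x₀, 0) ⟨by simp [sq_nonneg], le_rfl, ha.le⟩
  · simp only [sub_self, norm_zero] at key
    rw [Real.zero_rpow (by positivity)] at key
    refine mul_le_of_rpow_gain (by positivity) hv0 ha ?_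
    rw [← hMv, ← hb]
    rw [hA] at key
    norm_num at key
    rwa [div_le_iff₀ (by positivity), mul_comm (U _)] at key
  · intro x hxa
    have hxa' : ‖x - x₀‖ ≤ a := (abs_lt_of_sq_lt_sq' hxa ha.le).2.le
    have h1 := norm_sub_norm_le x x₀
    have h2 := norm_sub_norm_le x₀ x
    rw [norm_sub_rev] at h2
    refine Or.inr ⟨_, ?_, hU.neu x (norm_pos_iff.1 (by linarith)) (by linarith)⟩
    rw [neg_le_neg_iff]
    have h3 : A * (1 + kap n σ) * a ^ (-(2 * σ)) = b / (2 * σ) := by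
      rw [hA, Real.rpow_neg ha.le]
      field_simp
    rw [h3]
    gcongr
    exact hbU x hxa'

/-- Local estimates at a boundary point on a scale where `a² sup u^{2/(n-2σ)}` is small. -/
lemma PSol.exists_local (hn : 0 < n) (hσ0 : 0 < σ) (hσ1 : σ < 1) (hq : 0 < (n : ℝ) - 2 * σ)
    {U : Pt n → ℝ} (hU : PSol σ (((n : ℝ) + 2 * σ) / ((n : ℝ) - 2 * σ)) U)
    (hpos : ∀ X, nsq 0 X < 4 → 0 ≤ X.2 → X ≠ 0 → 0 < U X) :
    ∃ ε > 0, ∃ N > 0, ∀ (x₀ : EuclideanSpace ℝ (Fin n)) (a τ : ℝ), 0 < a → a ≤ 1 / 16 →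
      3 * a < ‖x₀‖ → ‖x₀‖ ≤ 1 / 4 → 0 ≤ τ →
      (∀ x, ‖x - x₀‖ ≤ 2 * a → U (x, 0) ≤ τ ^ (((n : ℝ) - 2 * σ) / 2)) → a ^ 2 * τ ≤ ε →
      (∀ x, ‖x - x₀‖ ≤ a → 2 ^ (-(((n : ℝ) - 2 * σ) / 2)) * U (x₀, 0) ≤ U (x, 0)) ∧
      U (x₀, 0) ^ (2 / ((n : ℝ) - 2 * σ)) * a ≤ N := by
  obtain ⟨C, hC, hD⟩ := exists_interior_le_bdry hn hσ0 hσ1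
  obtain ⟨m, hm, hmU⟩ := hU.exists_lower_bound hσ0 hσ1 hq hpos
  set q := (n : ℝ) - 2 * σ with hqd
  have hκ := kap_nonneg (n := n) hσ1
  refine ⟨(m / (2 * (1 + C))) ^ (2 / q) / 16, by positivity, _,
    show 0 < 2 * (2 * σ * (1 + kap n σ) * 2 ^ (q / 2)) ^ (2 * σ)⁻¹ by positivity, ?_⟩
  intro x₀ a τ ha ha16 hax hx hτ hsup hε
  have hSm : (2 * (2 * a)) ^ q * ((1 + C) * τ ^ (q / 2)) < m := by
    have h1 : (2 * (2 * a)) ^ q * τ ^ (q / 2) = (16 * (a ^ 2 * τ)) ^ (q / 2) := by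
      have h2 : (2 * (2 * a)) ^ q = ((2 * (2 * a)) ^ (2 : ℝ)) ^ (q / 2) := by
        rw [← Real.rpow_mul (by positivity)]
        congr 1
        ring
      rw [h2, ← Real.mul_rpow (by positivity) hτ, Real.rpow_two]
      congr 1
      ring
    have h3 : (16 * (a ^ 2 * τ)) ^ (q / 2) ≤ m / (2 * (1 + C)) := by
      refine (Real.rpow_le_rpow (by positivity) (show _ ≤ (m / (2 * (1 + C))) ^ (2 / q) by
        linarith) (by positivity)).trans_eq ?_
      rw [← Real.rpow_mul (by positivity)]
      rw [show 2 / q * (q / 2) = 1 by field_simp, Real.rpow_one]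
    have h4 : (1 + C) * (m / (2 * (1 + C))) = m / 2 := by field_simp
    calc (2 * (2 * a)) ^ q * ((1 + C) * τ ^ (q / 2))
        = (1 + C) * (16 * (a ^ 2 * τ)) ^ (q / 2) := by rw [← h1]; ring
      _ ≤ (1 + C) * (m / (2 * (1 + C))) := by gcongr
      _ < m := by linarith
  have hb : ∀ z l, ‖z - x₀‖ ≤ a → 0 < l → l ≤ 2 * a → Below σ U z l := by
    intro z l hz hl hla
    have hz1 := norm_sub_norm_le z x₀
    have hz2 := norm_sub_norm_le x₀ z
    rw [norm_sub_rev] at hz2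
    refine hU.below hσ0 hσ1 hq (l₀ := 2 * a) (S := (1 + C) * τ ^ (q / 2)) (by linarith)
      (by linarith) hm hmU (by positivity) ?_ hSm hl hla
    intro X hX hXt
    have ha2 : 8 * a ^ 2 ≤ a / 2 := by nlinarith
    have hX' : nsq (z, 0) X ≤ (8 * a ^ 2) ^ 2 := by
      refine hX.trans_eq ?_
      ring
    have hXz := norm_fst_sub_le (by positivity) hX'
    have hXt' := (le_abs_self _).trans (abs_snd_sub_le (by positivity) hX')
    simp only [sub_zero] at hXt' hXz
    have hX1 := (mem_of_nsq_le (by positivity) (show 8 * a ^ 2 < ‖z‖ by linarith)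
      (by linarith) hX').1
    have hP : 0 ≤ τ ^ (q / 2) := by positivity
    rcases hXt.eq_or_lt with h0 | h0
    · have hXe : X = (X.1, 0) := by ext1 <;> simp [h0]
      rw [hXe]
      have h5 : ‖X.1 - x₀‖ ≤ 2 * a := by
        have := norm_sub_le_norm_sub_add_norm_sub X.1 z x₀
        linarith
      have := hsup _ h5
      nlinarith [mul_nonneg hC.le hP]
    · obtain ⟨x, hx1, -, hx3⟩ := hD _ U hU X hX1.le h0
      have h5 : ‖x - x₀‖ ≤ 2 * a := by
        have h6 := norm_sub_le_norm_sub_add_norm_sub x X.1 x₀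
        have h7 := norm_sub_le_norm_sub_add_norm_sub X.1 z x₀
        linarith
      have := mul_le_mul_of_nonneg_left (hsup _ h5) hC.le
      linarith
  have hU0 : ∀ x : EuclideanSpace ℝ (Fin n), x ≠ 0 → ‖x‖ ≤ 1 → 0 < U (x, 0) := by
    intro x h1 h2
    refine hpos _ ?_ le_rfl fun h => h1 (congrArg Prod.fst h)
    rw [nsq_zero_bdry]
    nlinarith [norm_nonneg x]
  have hx0 : 0 < U (x₀, 0) := hU0 x₀ (norm_pos_iff.1 (by linarith)) (by linarith)
  have h1 : ∀ x, ‖x - x₀‖ ≤ a → 2 ^ (-(q / 2)) * U (x₀, 0) ≤ U (x, 0) := by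
    intro x hxa
    have hx1 := norm_sub_norm_le x x₀
    have hx2 := norm_sub_norm_le x₀ x
    rw [norm_sub_rev] at hx2
    exact center_le hq ha hxa (norm_pos_iff.1 (by linarith)) (by linarith) hx0.le hb
  exact ⟨h1, hU.gain hσ0 hσ1 hq ha (by linarith) hx hx0 h1⟩

lemma PSol.continuousOn_trace {p : ℝ} {U : Pt n → ℝ} (hU : PSol σ p U) :
    ContinuousOn (fun x : EuclideanSpace ℝ (Fin n) => U (x, 0)) {x | ‖x‖ ≤ 2 ∧ x ≠ 0} := by
  refine hU.cont.comp (by fun_prop) fun x hx => ⟨?_, le_rfl, fun h => hx.2 (congrArg Prod.fst h)⟩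
  rw [nsq_zero_bdry]
  have := hx.1
  nlinarith [norm_nonneg x]

lemma pos_trace {U : Pt n → ℝ} (hpos : ∀ X, nsq 0 X < 4 → 0 ≤ X.2 → X ≠ 0 → 0 < U X)
    {x : EuclideanSpace ℝ (Fin n)} (h1 : x ≠ 0) (h2 : ‖x‖ ≤ 1) : 0 < U (x, 0) := by
  refine hpos _ ?_ le_rfl fun h => h1 (congrArg Prod.fst h)
  rw [nsq_zero_bdry]
  nlinarith [norm_nonneg x]

/-- The a priori bound `u(x) ≤ C |x|^{-(n-2σ)/2}` near the singularity. -/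
lemma PSol.exists_upper_bound (hn : 0 < n) (hσ0 : 0 < σ) (hσ1 : σ < 1)
    (hq : 0 < (n : ℝ) - 2 * σ)
    {U : Pt n → ℝ} (hU : PSol σ (((n : ℝ) + 2 * σ) / ((n : ℝ) - 2 * σ)) U)
    (hpos : ∀ X, nsq 0 X < 4 → 0 ≤ X.2 → X ≠ 0 → 0 < U X) :
    ∃ r > 0, r ≤ 1 / 6 ∧ ∃ C > 0, ∀ x : EuclideanSpace ℝ (Fin n), x ≠ 0 → ‖x‖ ≤ r →
      U (x, 0) ^ (2 / ((n : ℝ) - 2 * σ)) * ‖x‖ ≤ C := by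
  obtain ⟨ε, hε, N, hN, hloc⟩ := hU.exists_local hn hσ0 hσ1 hq hpos
  have hct := hU.continuousOn_trace
  set q := (n : ℝ) - 2 * σ with hqd
  refine ⟨min (1 / 6) (ε / (N + 1)), by positivity, min_le_left _ _, 8 * (N + 1), by positivity,
    fun x₁ hx1 hxr => ?_⟩
  have hr6 : ‖x₁‖ ≤ 1 / 6 := hxr.trans (min_le_left _ _)
  have hrε : ‖x₁‖ * (N + 1) ≤ ε := (le_div_iff₀ (by positivity)).1 (hxr.trans (min_le_right _ _))
  have hn1 : 0 < ‖x₁‖ := norm_pos_iff.2 hx1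
  by_contra! hcon
  set R := ‖x₁‖ / 2 with hR
  have hball : ∀ x, ‖x - x₁‖ ≤ R → R ≤ ‖x‖ ∧ ‖x‖ ≤ 3 * R := by
    intro x hx
    have h1 := norm_sub_norm_le x x₁
    have h2 := norm_sub_norm_le x₁ x
    rw [norm_sub_rev] at h2
    constructor <;> linarith
  have hne : ∀ x, ‖x - x₁‖ ≤ R → x ≠ 0 := fun x hx =>
    norm_pos_iff.1 (lt_of_lt_of_le (by positivity) (hball x hx).1)
  have hupos : ∀ x, ‖x - x₁‖ ≤ R → 0 < U (x, 0) := fun x hx =>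
    pos_trace hpos (hne x hx) (by linarith [(hball x hx).2])
  have hq2 : 0 ≤ 2 / q := by positivity
  obtain ⟨x₀, hx₀, hmax⟩ := (isCompact_closedBall x₁ R).exists_isMaxOn
    (f := fun x => U (x, 0) ^ (2 / q) * (R - ‖x - x₁‖)) ⟨x₁, by simp; positivity⟩
    (((hct.mono fun x hx => by
        rw [mem_closedBall_iff_norm] at hx
        exact ⟨by linarith [(hball x hx).2], hne x hx⟩).rpow_const fun x _ => Or.inr hq2).mul
      (by fun_prop))
  rw [mem_closedBall_iff_norm] at hx₀
  have hmax : ∀ x, ‖x - x₁‖ ≤ R →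
      U (x, 0) ^ (2 / q) * (R - ‖x - x₁‖) ≤ U (x₀, 0) ^ (2 / q) * (R - ‖x₀ - x₁‖) :=
    fun x hx => isMaxOn_iff.1 hmax x (mem_closedBall_iff_norm.2 hx)
  have hM := hupos x₀ hx₀
  set v := U (x₀, 0) ^ (2 / q) with hv
  have hv0 : 0 < v := Real.rpow_pos_of_pos hM _
  set d := R - ‖x₀ - x₁‖ with hd
  have hvd : 4 * (N + 1) < v * d := by
    have h1 := hmax x₁ (by rw [sub_self, norm_zero]; positivity)
    rw [sub_self, norm_zero, sub_zero] at h1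
    refine lt_of_lt_of_le ?_ h1
    rw [hR]
    linarith
  have hd0 : 0 < d := by
    by_contra! h
    nlinarith
  have hdR : d ≤ R := by
    rw [hd]
    linarith [norm_nonneg (x₀ - x₁)]
  set a := (N + 1) / v with ha
  have ha0 : 0 < a := by positivity
  have hav : a * v = N + 1 := div_mul_cancel₀ _ hv0.ne'
  have had : 4 * a ≤ d := by
    rw [ha, ← mul_div_assoc, div_le_iff₀ hv0, mul_comm d]
    exact hvd.le
  have hb0 := hball x₀ hx₀
  have key := (hloc x₀ a (2 * v) ha0 (by linarith) (by linarith) (by linarith) (by positivity)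
    ?_ ?_).2
  · rw [mul_comm, hav] at key
    linarith
  · intro x hx
    have h1 := norm_sub_le_norm_sub_add_norm_sub x x₀ x₁
    have hxR : ‖x - x₁‖ ≤ R := by linarith
    have h2 := hmax x hxR
    have h3 : U (x, 0) ^ (2 / q) ≤ 2 * v := by
      have h4 : d / 2 ≤ R - ‖x - x₁‖ := by linarith
      have h5 : 0 < U (x, 0) ^ (2 / q) := Real.rpow_pos_of_pos (hupos x hxR) _
      nlinarith
    have h6 := Real.rpow_le_rpow (Real.rpow_nonneg (hupos x hxR).le _) h3
      (show 0 ≤ q / 2 by positivity)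
    rwa [← Real.rpow_mul (hupos x hxR).le, show 2 / q * (q / 2) = 1 by field_simp,
      Real.rpow_one] at h6
  · have : a ^ 2 * (2 * v) = 2 * (N + 1) * a := by rw [← hav]; ring
    rw [this]
    nlinarith

/-- One-sided Harnack inequality for the trace near the singularity. -/
lemma PSol.exists_trace_harnack (hn : 0 < n) (hσ0 : 0 < σ) (hσ1 : σ < 1)
    (hq : 0 < (n : ℝ) - 2 * σ)
    {U : Pt n → ℝ} (hU : PSol σ (((n : ℝ) + 2 * σ) / ((n : ℝ) - 2 * σ)) U)
    (hpos : ∀ X, nsq 0 X < 4 → 0 ≤ X.2 → X ≠ 0 → 0 < U X) :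
    ∃ r > 0, r ≤ 1 / 6 ∧ ∀ x y : EuclideanSpace ℝ (Fin n), x ≠ 0 → ‖x‖ ≤ r →
      ‖y - x‖ ≤ ‖x‖ / 4 → 2 ^ (-(((n : ℝ) - 2 * σ) / 2)) * U (x, 0) ≤ U (y, 0) := by
  obtain ⟨ε, hε, N, hN, hloc⟩ := hU.exists_local hn hσ0 hσ1 hq hpos
  obtain ⟨r, hr, hr6, C, hC, hub⟩ := hU.exists_upper_bound hn hσ0 hσ1 hq hpos
  set q := (n : ℝ) - 2 * σ with hqd
  refine ⟨min (r / 2) (8 * ε / C), by positivity, (min_le_left _ _).trans (by linarith),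
    fun x y hx hxr hy => ?_⟩
  have hn0 : 0 < ‖x‖ := norm_pos_iff.2 hx
  have hxr2 : ‖x‖ ≤ r / 2 := hxr.trans (min_le_left _ _)
  have hxε : ‖x‖ * C ≤ 8 * ε := (le_div_iff₀ hC).1 (hxr.trans (min_le_right _ _))
  refine (hloc x (‖x‖ / 4) (2 * C / ‖x‖) (by positivity) (by linarith) (by linarith)
    (by linarith) (by positivity) (fun w hw => ?_) ?_).1 y hy
  · have h1 := norm_sub_norm_le w x
    have h2 := norm_sub_norm_le x w
    rw [norm_sub_rev] at h2
    have hw0 : w ≠ 0 := norm_pos_iff.1 (by linarith)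
    have hu := pos_trace hpos hw0 (by linarith)
    have h3 := hub w hw0 (by linarith)
    have h5 : 0 < U (w, 0) ^ (2 / q) := Real.rpow_pos_of_pos hu _
    have h4 : U (w, 0) ^ (2 / q) ≤ 2 * C / ‖x‖ := by
      rw [le_div_iff₀ hn0]
      nlinarith
    have h6 := Real.rpow_le_rpow h5.le h4 (show 0 ≤ q / 2 by positivity)
    rwa [← Real.rpow_mul hu.le, show 2 / q * (q / 2) = 1 by field_simp, Real.rpow_one] at h6
  · have : (‖x‖ / 4) ^ 2 * (2 * C / ‖x‖) = ‖x‖ * C / 8 := by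
      field_simp
      ring
    linarith

/-- A lower bound on a boundary ball propagates to a comparable half ball. -/
lemma PSol.exists_half_ball_lower (n : ℕ) (hσ0 : 0 < σ) (hσ1 : σ < 1) :
    ∃ s > 0, s ≤ 1 ∧ ∀ (p : ℝ) (U : Pt n → ℝ), PSol σ p U →
      ∀ (y : EuclideanSpace ℝ (Fin n)) (ρ A : ℝ), 0 < ρ → ρ < ‖y‖ → ‖y‖ ≤ 1 / 4 → 0 ≤ A →
      (∀ x, ‖x - y‖ ≤ ρ → A ≤ U (x, 0)) →
      ∀ X, nsq (y, 0) X ≤ (s * ρ) ^ 2 → 0 ≤ X.2 → A / 2 ≤ U X := by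
  have hκ := kap_nonneg (n := n) hσ1
  set k := 1 + kap n σ with hk
  have hk0 : 0 < k := by positivity
  set s₀ := (1 / (4 * k)) ^ (2 * σ)⁻¹ with hs₀
  have hs0 : 0 < s₀ := by positivity
  refine ⟨min (1 / 2) s₀, by positivity, (min_le_left _ _).trans (by norm_num), ?_⟩
  set s := min (1 / 2) s₀ with hs
  have hs' : 0 < s := by positivity
  have hs12 : s ≤ 1 / 2 := min_le_left _ _
  have hsk : k * s ^ (2 * σ) ≤ 1 / 4 := by
    have h1 : s ^ (2 * σ) ≤ s₀ ^ (2 * σ) :=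
      Real.rpow_le_rpow hs'.le (min_le_right _ _) (by positivity)
    rw [hs₀, Real.rpow_inv_rpow (by positivity) (by positivity)] at h1
    calc k * s ^ (2 * σ) ≤ k * (1 / (4 * k)) := by gcongr
      _ = 1 / 4 := by field_simp
  intro p U hU y ρ A hρ hρy hy hA hlow X hX hXt
  have hcyl := cyl_subset (n := n) (τ := ρ) (c := 1) hρ.le hy (by nlinarith)
  have hcne : ∀ X ∈ Cyl y (ρ ^ 2) ρ, X ≠ 0 := by
    intro X hX h0
    have := hX.1
    rw [h0, Prod.fst_zero, zero_sub, norm_neg] at this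
    nlinarith
  have hX1 := norm_fst_sub_le (by positivity) hX
  have hX2 := (le_abs_self _).trans (abs_snd_sub_le (by positivity) hX)
  simp only [sub_zero] at hX1 hX2
  have hsρ : s * ρ ≤ ρ := by nlinarith
  have key := bottom_barrier hσ0 hσ1 hρ hA
    (hU.cont.mono fun X hX => ⟨(hcyl X hX).trans (by norm_num), hX.2.1, hcne X hX⟩)
    (fun X hX => hU.nonneg X ((hcyl X hX).trans (by norm_num)) hX.2.1 (hcne X hX))
    (fun X hX h1 h2 => hU.eq X ((hcyl X hX).trans_lt (by norm_num)) h1)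
    (fun x hx => Or.inl (hlow x (abs_lt_of_sq_lt_sq' hx hρ.le).2.le))
    X ⟨by gcongr; linarith, hXt, by linarith⟩
  refine le_trans ?_ key
  have h1 : ‖X.1 - y‖ ^ 2 / ρ ^ 2 ≤ 1 / 4 := by
    rw [div_le_iff₀ (by positivity)]
    have h2 : ‖X.1 - y‖ ^ 2 ≤ (s * ρ) ^ 2 := by gcongr
    have h3 : s ^ 2 ≤ (1 / 2) ^ 2 := by gcongr
    rw [mul_pow] at h2
    nlinarith [sq_nonneg ρ]
  have h2 : k * ρ ^ (-(2 * σ)) * X.2 ^ (2 * σ) ≤ 1 / 4 := by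
    refine le_trans ?_ hsk
    have h3 : X.2 ^ (2 * σ) ≤ s ^ (2 * σ) * ρ ^ (2 * σ) := by
      rw [← Real.mul_rpow hs'.le hρ.le]
      exact Real.rpow_le_rpow hXt hX2 (by positivity)
    calc k * ρ ^ (-(2 * σ)) * X.2 ^ (2 * σ)
        ≤ k * ρ ^ (-(2 * σ)) * (s ^ (2 * σ) * ρ ^ (2 * σ)) := by gcongr
      _ = k * s ^ (2 * σ) := by
        rw [Real.rpow_neg hρ.le]
        field_simp
  have h3 : 0 ≤ kap n σ * X.2 ^ 2 / ρ ^ 2 := by positivity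
  rw [sub_div]
  nlinarith

/-- A lower bound on a boundary ball propagates to the half sphere through its centre. -/
lemma PSol.exists_sphere_lower (n : ℕ) (hσ0 : 0 < σ) (hσ1 : σ < 1) (hq : 0 < (n : ℝ) - 2 * σ) :
    ∃ c > 0, ∀ (p : ℝ) (U : Pt n → ℝ), PSol σ p U →
      ∀ (y : EuclideanSpace ℝ (Fin n)) (A : ℝ), y ≠ 0 → ‖y‖ ≤ 1 / 4 → 0 ≤ A →
      (∀ x, ‖x - y‖ ≤ ‖y‖ / 4 → A ≤ U (x, 0)) →
      ∀ X, nsq 0 X = ‖y‖ ^ 2 → 0 ≤ X.2 → c * A ≤ U X := by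
  obtain ⟨s, hs, hs1, hball⟩ := PSol.exists_half_ball_lower n hσ0 hσ1
  set q := (n : ℝ) - 2 * σ with hqd
  have h416 : (16 : ℝ) ^ (-q) < 4 ^ (-q) :=
    Real.rpow_lt_rpow_of_neg (by norm_num) (by norm_num) (by linarith)
  have h41 : (4 : ℝ) ^ (-q) ≤ 1 := Real.rpow_le_one_of_one_le_of_nonpos (by norm_num) (by linarith)
  have h160 : (0 : ℝ) < 16 ^ (-q) := by positivity
  set t := (s / 4) ^ 2 with ht
  have ht0 : 0 < t := by positivity
  have ht1 : t ^ q ≤ 1 := Real.rpow_le_one ht0.le (by rw [ht]; nlinarith) hq.le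
  refine ⟨t ^ q * (4 ^ (-q) - 16 ^ (-q)) / 2, by
    have := sub_pos.2 h416
    positivity, fun p U hU y A hy hy4 hA hlow X hXr hXt => ?_⟩
  set r := ‖y‖ with hr
  have hr0 : 0 < r := norm_pos_iff.2 hy
  have hr2 : 0 < r ^ 2 := by positivity
  have hin : ∀ X, nsq (y, 0) X ≤ t * r ^ 2 → 0 ≤ X.2 → A / 2 ≤ U X := fun X hX =>
    hball p U hU y (r / 4) A (by positivity) (by linarith) hy4 hA hlow X (by
      refine hX.trans_eq ?_
      rw [ht]
      ring)
  set D := A / 2 * (t * r ^ 2) ^ q with hD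
  have hD0 : 0 ≤ D := by positivity
  set h : Pt n → ℝ := fun X => D * nsq (y, 0) X ^ (-q) + -(D * (16 * r ^ 2) ^ (-q)) with hh
  have hD1 : D * (t * r ^ 2) ^ (-q) = A / 2 := by
    rw [hD, Real.rpow_neg (by positivity)]
    field_simp
  have hDn : 0 ≤ D * (16 * r ^ 2) ^ (-q) := by positivity
  have hhA : ∀ X, t * r ^ 2 ≤ nsq (y, 0) X → h X ≤ A / 2 := by
    intro X hX
    have := mul_le_mul_of_nonneg_left
      (Real.rpow_le_rpow_of_nonpos (by positivity) hX (by linarith : -q ≤ 0)) hD0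
    simp only [hh]
    linarith
  have hne : ∀ X : Pt n, t * r ^ 2 ≤ nsq (y, 0) X → nsq (y, 0) X ≠ 0 := fun X hX =>
    (lt_of_lt_of_le (by positivity) hX).ne'
  have hKin : ∀ X, nsq (y, 0) X ≤ 16 * r ^ 2 → nsq 0 X < 4 := by
    intro X hX
    have h1 : nsq (y, 0) X ≤ (4 * r) ^ 2 := by
      refine hX.trans_eq ?_
      ring
    refine (nsq_triangle hr0.le (by positivity) (nsq_zero_bdry y).le h1).trans_lt ?_
    nlinarith
  have hcnsq := continuous_nsq ((y, 0) : Pt n)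
  have hK : IsCompact {X : Pt n | t * r ^ 2 ≤ nsq (y, 0) X ∧ nsq (y, 0) X ≤ 16 * r ^ 2 ∧ 0 ≤ X.2} :=
    isCompact_of_nsq_le (P := (y, 0)) (C := 16 * r ^ 2)
      ((isClosed_le continuous_const hcnsq).inter ((isClosed_le hcnsq continuous_const).inter
        (isClosed_le continuous_const continuous_snd))) fun X hX => hX.2.1
  have key := min_principle_sing hσ0 hσ1 hq (w := fun X => U X - h X) (P := 0) (Q := 0)
    (O := {X | t * r ^ 2 < nsq (y, 0) X ∧ nsq (y, 0) X < 16 * r ^ 2}) rfl rfl hK ?_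
    (fun X hX => hX.2.2) ((isOpen_lt continuous_const hcnsq).inter
      (isOpen_lt hcnsq continuous_const)) (fun Y hY h0 => ⟨hY.1.le, hY.2.le, h0⟩)
    ⟨A / 2, fun X hX h0 _ => by
      have h1 := hhA X hX.1
      have h2 := hU.nonneg X (hKin X hX.2.1).le hX.2.2 h0
      linarith⟩ ?_ ?_ ?_
  · have hX0 : X ≠ 0 := by
      rintro rfl
      rw [nsq_self] at hXr
      exact hr2.ne hXr
    rcases le_total (nsq (y, 0) X) (t * r ^ 2) with h1 | h1
    · refine le_trans ?_ (hin X h1 hXt)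
      have h2 : t ^ q * (4 ^ (-q) - 16 ^ (-q)) ≤ 1 :=
        mul_le_one₀ ht1 (sub_pos.2 h416).le (by linarith)
      have h3 := mul_le_mul_of_nonneg_right h2 hA
      linarith
    · have h2 : nsq (y, 0) X ≤ 4 * r ^ 2 := by
        refine (nsq_triangle hr0.le hr0.le (by rw [nsq_comm]; exact (nsq_zero_bdry y).le)
          hXr.le).trans_eq ?_
        ring
      have h3 := key X ⟨h1, by linarith, hXt⟩ hX0 hX0
      have h4 := mul_le_mul_of_nonneg_left (Real.rpow_le_rpow_of_nonpos
        (lt_of_lt_of_le (by positivity) h1) h2 (by linarith : -q ≤ 0)) hD0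
      simp only [hh] at h3
      have h5 : D * (4 * r ^ 2) ^ (-q) - D * (16 * r ^ 2) ^ (-q) =
          t ^ q * (4 ^ (-q) - 16 ^ (-q)) / 2 * A := by
        rw [hD, Real.mul_rpow ht0.le hr2.le, Real.mul_rpow (by norm_num) hr2.le,
          Real.mul_rpow (by norm_num) hr2.le, Real.rpow_neg hr2.le]
        field_simp
      linarith
  · refine (hU.cont.mono fun X hX => ⟨(hKin X hX.1.2.1).le, hX.1.2.2, hX.2.1⟩).sub ?_
    exact ((continuousOn_const.mul (hcnsq.continuousOn.rpow_const fun X hX =>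
      Or.inl (hne X hX.1.1))).add continuousOn_const)
  · intro X hX h0 _ hO
    rcases hX.1.eq_or_lt with h1 | h1
    · have h2 := hin X h1.ge hX.2.2
      have h3 := hhA X hX.1
      linarith
    · have h2 : nsq (y, 0) X = 16 * r ^ 2 := by
        by_contra h3
        exact hO ⟨h1, lt_of_le_of_ne hX.2.1 h3⟩
      have h3 := hU.nonneg X (hKin X hX.2.1).le hX.2.2 h0
      simp only [hh, h2]
      linarith
  · intro X hX _ hXt _
    have hL := ((hasL_nsq_rpow_bdry (σ := σ) hXt (P := (y, 0)) rfl (-q)).const_mul D).add_const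
      (-(D * (16 * r ^ 2) ^ (-q)))
    refine ⟨_, ?_, (hU.eq X (hKin X hX.2.1) hXt).sub hL⟩
    have h1 := Real.rpow_nonneg (nsq_nonneg (y, 0) X) (-q - 1)
    have h2 : 0 ≤ D * (2 * q * q * nsq (y, 0) X ^ (-q - 1)) := by positivity
    rw [← hqd]
    nlinarith
  · intro x hX _ h0 _ _
    have hx0 : x ≠ 0 := fun h => h0 (by rw [h]; rfl)
    have hx2 : ‖x‖ < 2 := by
      have := hKin _ hX.2.1
      rw [nsq_zero_bdry] at this
      nlinarith [norm_nonneg x]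
    obtain ⟨g, hg, hgN⟩ := hU.neu_nonpos hσ0 hx0 hx2
    have hxy : x ≠ y := by
      rintro rfl
      exact hne _ hX.1 (nsq_self _)
    exact ⟨_, by linarith, hgN.sub (((neu_nsq_rpow (σ := σ) hσ1 (P := (y, 0)) rfl hxy
      (-q)).const_mul D).add_const (-(D * (16 * r ^ 2) ^ (-q))))⟩

/-- If `U` does not blow up at the origin, then its trace is bounded near the origin. -/
lemma PSol.exists_trace_bound (hn : 0 < n) (hσ0 : 0 < σ) (hσ1 : σ < 1)
    (hq : 0 < (n : ℝ) - 2 * σ)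
    {U : Pt n → ℝ} (hU : PSol σ (((n : ℝ) + 2 * σ) / ((n : ℝ) - 2 * σ)) U)
    (hpos : ∀ X, nsq 0 X < 4 → 0 ≤ X.2 → X ≠ 0 → 0 < U X) {K : ℝ}
    (hK : ∀ δ > 0, ∃ X, X ≠ 0 ∧ nsq 0 X < δ ∧ 0 ≤ X.2 ∧ U X < K) :
    ∃ r > 0, r ≤ 1 / 6 ∧ ∃ M, ∀ x : EuclideanSpace ℝ (Fin n), x ≠ 0 → ‖x‖ ≤ r → U (x, 0) ≤ M := by
  obtain ⟨r, hr, hr6, hharn⟩ := hU.exists_trace_harnack hn hσ0 hσ1 hq hpos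
  obtain ⟨c, hc, hlow⟩ := PSol.exists_sphere_lower n hσ0 hσ1 hq
  set q := (n : ℝ) - 2 * σ with hqd
  refine ⟨r, hr, hr6, K / (c * 2 ^ (-(q / 2))), fun x hx hxr => ?_⟩
  have hx0 : 0 < ‖x‖ := norm_pos_iff.2 hx
  have hsph : ∃ X, nsq 0 X = ‖x‖ ^ 2 ∧ 0 ≤ X.2 ∧ U X < K := by
    by_contra! hcon
    have hx4 : ‖x‖ ^ 2 < 4 := by nlinarith
    obtain ⟨X, hX0, hXx, hXt, hXK⟩ := hK (‖x‖ ^ 2) (by positivity)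
    refine hXK.not_ge (min_principle_punctured hσ0 hσ1 hq (δ := ‖x‖ ^ 2) (B := 0)
      (hU.cont.mono fun X hX => ⟨hX.1.trans hx4.le, hX.2⟩)
      (fun X h1 h2 h3 => by rw [neg_zero]; exact hU.nonneg X (h1.trans hx4.le) h2 h3)
      hcon (fun X h1 h2 => hU.eq X (h1.trans hx4) h2)
      (fun y h1 h2 => hU.neu_nonpos hσ0 h2 ?_) X hXx.le hXt hX0)
    rw [nsq_zero_bdry] at h1
    nlinarith [norm_nonneg y]
  obtain ⟨X, hX1, hX2, hX3⟩ := hsph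
  have h1 := hlow _ U hU x _ hx (by linarith)
    (mul_nonneg (by positivity) (pos_trace hpos hx (by linarith)).le)
    (fun y hy => hharn x y hx hxr hy) X hX1 hX2
  rw [le_div_iff₀ (by positivity)]
  linarith

end FracExt

open FracExt

/-- If the origin is a non-removable singularity of `U`, then `U`
blows up at the origin: `U(X) → ∞` as `X → 0` in `{t ≥ 0}`. -/
theorem stmt_9 (n : ℕ) (hn : 2 ≤ n) (σ : ℝ) (hσ : σ ∈ Set.Ioo (0 : ℝ) 1)
    (U : Pt n → ℝ) (hU : ExtSol n σ 2 U)
    (hnonrem : ¬ ∃ ε : ℝ, 0 < ε ∧ ∃ v : EuclideanSpace ℝ (Fin n) → ℝ,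
      ContinuousOn v {x : EuclideanSpace ℝ (Fin n) | ‖x‖ < ε} ∧
      ∀ x : EuclideanSpace ℝ (Fin n), ‖x‖ < ε → x ≠ 0 → v x = U (x, 0)) :
    ∀ K : ℝ, 0 < K → ∃ δ : ℝ, 0 < δ ∧
      ∀ X : Pt n, 0 < enorm' X → enorm' X < δ → 0 ≤ X.2 → K ≤ U X := by
  obtain ⟨hσ0, hσ1⟩ := hσ
  have hn2 : (2 : ℝ) ≤ n := by exact_mod_cast hn
  have hq : 0 < (n : ℝ) - 2 * σ := by linarith
  have hn0 : 0 < n := by omega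
  have hP := psol_of_extSol hσ0 hU
  set p := ((n : ℝ) + 2 * σ) / ((n : ℝ) - 2 * σ) with hp
  have hbdd : ¬ ∃ r > 0, r ≤ 1 ∧ ∃ M, ∀ X, nsq 0 X ≤ r ^ 2 → 0 ≤ X.2 → X ≠ 0 → U X ≤ M := by
    rintro ⟨r, hr, hr1, M, hM⟩
    obtain ⟨L, hL⟩ := hP.exists_tendsto hσ0 hσ1 hq (by positivity) hr hr1 hM
    refine hnonrem ⟨1, one_pos, Function.update (fun x => U (x, 0)) 0 L, ?_, fun x _ hx =>
      Function.update_of_ne hx _ _⟩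
    have hct : ContinuousOn (fun x : EuclideanSpace ℝ (Fin n) => U (x, 0))
        ({x | ‖x‖ < 1} \ {0}) :=
      hP.continuousOn_trace.mono fun x hx => ⟨by
        have : ‖x‖ < 1 := hx.1
        linarith, hx.2⟩
    exact (continuousOn_update_iff.2 ⟨hct, fun _ => hL.mono_left (nhdsWithin_mono _ fun x hx =>
      hx.2)⟩)
  have hpos : ∀ X, nsq 0 X < 4 → 0 ≤ X.2 → X ≠ 0 → 0 < U X := by
    refine hP.pos hσ0 hσ1 ?_
    by_contra! hcon
    refine hbdd ⟨1, one_pos, le_rfl, 0, fun X h1 h2 h3 => ?_⟩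
    rcases h2.eq_or_lt with h0 | h0
    · have hX : X = (X.1, 0) := by ext1 <;> simp [h0]
      have hx0 : X.1 ≠ 0 := fun h => h3 (by rw [hX, h]; rfl)
      have hX1 : ‖X.1‖ ^ 2 ≤ 1 := by
        rw [nsq_zero] at h1
        nlinarith [sq_nonneg X.2]
      have hcont : Tendsto (fun t : ℝ => U (X.1, t)) (𝓝[>] 0) (𝓝 (U (X.1, 0))) := by
        have h4 : ContinuousWithinAt U {X | nsq 0 X ≤ 4 ∧ 0 ≤ X.2 ∧ X ≠ 0} (X.1, 0) :=
          hP.cont _ ⟨by rw [← hX]; linarith, le_rfl, by rwa [← hX]⟩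
        refine h4.tendsto.comp (tendsto_nhdsWithin_iff.2 ⟨?_, ?_⟩)
        · exact ((by fun_prop : Continuous fun t : ℝ => (X.1, t)).tendsto 0).mono_left
            nhdsWithin_le_nhds
        · filter_upwards [Ioo_mem_nhdsGT one_pos] with t ht
          refine ⟨?_, ht.1.le, fun h => hx0 (congrArg Prod.fst h)⟩
          rw [nsq_zero]
          simp only
          nlinarith [ht.1, ht.2]
      have hz : Tendsto (fun t : ℝ => U (X.1, t)) (𝓝[>] 0) (𝓝 0) := by
        refine tendsto_const_nhds.congr' ?_
        filter_upwards [Ioo_mem_nhdsGT one_pos] with t ht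
        refine (hcon _ ?_ ht.1).symm
        rw [nsq_zero]
        simp only
        nlinarith [ht.1, ht.2]
      rw [hX]
      exact (tendsto_nhds_unique hcont hz).le
    · exact (hcon X (by linarith) h0).le
  intro K _
  by_contra! hcon
  obtain ⟨r, hr, hr6, M, hM⟩ := hP.exists_trace_bound hn0 hσ0 hσ1 hq hpos (K := K) (by
    intro δ hδ
    obtain ⟨X, h1, h2, h3, h4⟩ := hcon (Real.sqrt δ) (Real.sqrt_pos.2 hδ)
    rw [enorm'_lt_iff (Real.sqrt_pos.2 hδ), Real.sq_sqrt hδ.le] at h2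
    refine ⟨X, ?_, h2, h3, h4⟩
    rintro rfl
    rw [enorm'_eq, nsq_self, Real.sqrt_zero] at h1
    exact lt_irrefl _ h1)
  obtain ⟨C, hC, hD⟩ := exists_interior_le_bdry hn0 hσ0 hσ1
  refine hbdd ⟨r / 2, by positivity, by linarith, max M (C * M), fun X h1 h2 h3 => ?_⟩
  have hx1 := norm_fst_sub_le (by positivity) h1
  have hx2 := (le_abs_self _).trans (abs_snd_sub_le (by positivity) h1)
  simp only [Prod.fst_zero, Prod.snd_zero, sub_zero] at hx1 hx2
  rcases h2.eq_or_lt with h0 | h0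
  · have hX : X = (X.1, 0) := by ext1 <;> simp [h0]
    refine le_max_of_le_left ?_
    rw [hX]
    exact hM _ (fun h => h3 (by rw [hX, h]; rfl)) (by linarith)
  · obtain ⟨x, -, hx, hxU⟩ := hD p U hP X (h1.trans (by nlinarith)) h0
    refine le_max_of_le_right (hxU.trans (mul_le_mul_of_nonneg_left (hM x ?_ ?_) hC.le))
    · refine norm_pos_iff.1 ?_
      rw [hx]
      positivity
    · linarith
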